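/- Given a dimaze (D, B_0), the sets of vertices linkable onto B_0 form the set of bases of a matroid if and only if (D, B_0) contains no alternating comb; moreover, in that case the independent sets of this matroid are exactly the linkable sets. -/

import Mathlib

open Set

universe u

variable {V : Type*}

/-- A directed path in the digraph `D`: a nonempty duplicate-free list of vertices
with an edge between consecutive vertices. -/
structure DiPath {V : Type*} (D : V → V → Prop) where
  verts : List V
  ne : verts ≠ []
  nodup : verts.Nodup
  chain : verts.Chain' D

namespace DiPath

variable {D : V → V → Prop}

/-- The initial vertex of a directed path. -/
def first (p : DiPath D) : V := p.verts.head p.ne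

/-- The terminal vertex of a directed path. -/
def last (p : DiPath D) : V := p.verts.getLast p.ne

/-- The set of vertices of a directed path. -/
def vertSet (p : DiPath D) : Set V := {v | v ∈ p.verts}

/-- The set of (directed) edges of a directed path. -/
def edgeSet (p : DiPath D) : Set (V × V) := {e | e ∈ p.verts.zip p.verts.tail}

end DiPath

/-- The set of initial vertices of a collection of paths. -/
def Ini {D : V → V → Prop} (P : Set (DiPath D)) : Set V := {v | ∃ p ∈ P, p.first = v}

/-- The set of terminal vertices of a collection of paths. -/
def Ter {D : V → V → Prop} (P : Set (DiPath D)) : Set V := {v | ∃ p ∈ P, p.last = v}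

/-- All vertices used by a collection of paths. -/
def LinkVerts {D : V → V → Prop} (P : Set (DiPath D)) : Set V := ⋃ p ∈ P, p.vertSet

/-- All edges used by a collection of paths. -/
def LinkEdges {D : V → V → Prop} (P : Set (DiPath D)) : Set (V × V) := ⋃ p ∈ P, p.edgeSet

/-- A linkage in the dimaze `(D, B0)`: a set of pairwise vertex-disjoint directed
paths, each ending in `B0`. -/
def IsLinkage (D : V → V → Prop) (B0 : Set V) (P : Set (DiPath D)) : Prop :=
  (∀ p ∈ P, p.last ∈ B0) ∧
  (∀ p ∈ P, ∀ q ∈ P, p ≠ q → Disjoint p.vertSet q.vertSet)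

/-- `(D, B0)` is a dimaze: every vertex of `B0` has out-degree `0`. -/
def IsDimaze (D : V → V → Prop) (B0 : Set V) : Prop := ∀ b ∈ B0, ∀ v, ¬ D b v

/-- A set of vertices is linkable if it is the set of initial vertices of a linkage. -/
def Linkable (D : V → V → Prop) (B0 : Set V) (I : Set V) : Prop :=
  ∃ P, IsLinkage D B0 P ∧ Ini P = I

/-- A set of vertices is linkable onto `B0` if it is the set of initial vertices of
a linkage whose terminal vertices are all of `B0`. -/
def LinkableOnto (D : V → V → Prop) (B0 : Set V) (I : Set V) : Prop :=
  ∃ P, IsLinkage D B0 P ∧ Ini P = I ∧ Ter P = B0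

/-- `I` is a maximal element (w.r.t. inclusion) of the set system `Ind`. -/
def MaximalIn {α : Type*} (Ind : Set α → Prop) (I : Set α) : Prop :=
  Ind I ∧ ∀ J, Ind J → I ⊆ J → J = I

/-- The maximality axiom (IM). -/
def SatisfiesIM {α : Type*} (Ind : Set α → Prop) : Prop :=
  ∀ I X : Set α, Ind I → I ⊆ X →
    ∃ J, Ind J ∧ I ⊆ J ∧ J ⊆ X ∧ ∀ K, Ind K → K ⊆ X → J ⊆ K → K = J

/-- `Ind` is the collection of independent sets of a matroid:
axioms (I1), (I2), (I3) and (IM). -/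
def IsMatroidIndep {α : Type*} (Ind : Set α → Prop) : Prop :=
  Ind ∅ ∧
  (∀ I J : Set α, I ⊆ J → Ind J → Ind I) ∧
  (∀ I B : Set α, Ind I → ¬ MaximalIn Ind I → MaximalIn Ind B →
    ∃ x ∈ B \ I, Ind (insert x I)) ∧
  SatisfiesIM Ind

/-- The dimaze `(D, B0)` contains an alternating comb: there is an alternating ray
(given by the injective vertex sequence `f` and edge orientations `o`, with
infinitely many vertices of in-degree 2) together with a linkage of all its
in-degree-2 vertices and its first vertex onto a set of exits contained in `B0`,
by disjoint paths meeting the ray exactly at their initial vertices. -/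
def ContainsAltComb (D : V → V → Prop) (B0 : Set V) : Prop :=
  ∃ (f : ℕ → V) (o : ℕ → Bool) (P : Set (DiPath D)),
    Function.Injective f ∧
    (∀ n, if o n then D (f n) (f (n+1)) else D (f (n+1)) (f n)) ∧
    (∀ N, ∃ k ≥ N, o k = true ∧ o (k+1) = false) ∧
    IsLinkage D B0 P ∧
    Ini P = insert (f 0) {v | ∃ k, o k = true ∧ o (k+1) = false ∧ v = f (k+1)} ∧
    (∀ p ∈ P, ∀ v ∈ p.vertSet, v ∈ Set.range f → v = p.first)
/-- `ℬ` is the set of bases of a matroid: axioms (B1), (B2) and (BM). -/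
def IsMatroidBases {α : Type*} (ℬ : Set (Set α)) : Prop :=
  ℬ.Nonempty ∧
  (∀ B1 ∈ ℬ, ∀ B2 ∈ ℬ, ∀ x ∈ B1 \ B2, ∃ y ∈ B2 \ B1, insert y (B1 \ {x}) ∈ ℬ) ∧
  SatisfiesIM (fun I => ∃ B ∈ ℬ, I ⊆ B)

variable {E : V → V → Prop} {B0 : Set V} {P Q : Set (List V)}

def IsP (E : V → V → Prop) (l : List V) : Prop := l ≠ [] ∧ l.Nodup ∧ l.IsChain E

def Sys (E : V → V → Prop) (P : Set (List V)) : Prop :=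
  (∀ l ∈ P, IsP E l) ∧ ∀ l ∈ P, ∀ m ∈ P, ∀ v, v ∈ l → v ∈ m → l = m

def Hd (P : Set (List V)) : Set V := {v | ∃ l ∈ P, l.head? = some v}
def Lst (P : Set (List V)) : Set V := {v | ∃ l ∈ P, l.getLast? = some v}
def Vs (P : Set (List V)) : Set V := {v | ∃ l ∈ P, v ∈ l}

attribute [grind] Hd Lst Vs Sys

theorem IsP.mono {E E' : V → V → Prop} {l : List V} (h : IsP E l) (hE : ∀ a b, E a b → E' a b) :
    IsP E' l := ⟨h.1, h.2.1, h.2.2.imp hE⟩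

theorem Sys.sub (h : Sys E P) (hQ : Q ⊆ P) : Sys E Q :=
  ⟨fun l hl => h.1 l (hQ hl), fun l hl m hm => h.2 l (hQ hl) m (hQ hm)⟩

theorem Hd_sub_Vs (P : Set (List V)) : Hd P ⊆ Vs P := by
  rintro v ⟨l, hl, h⟩; exact ⟨l, hl, List.mem_of_head? h⟩
theorem Lst_sub_Vs (P : Set (List V)) : Lst P ⊆ Vs P := by
  rintro v ⟨l, hl, h⟩; exact ⟨l, hl, List.mem_of_getLast? h⟩

theorem exists_head {l : List V} (h : l ≠ []) : ∃ v, l.head? = some v := by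
  cases l with
  | nil => exact absurd rfl h
  | cons a t => exact ⟨a, rfl⟩
theorem exists_last {l : List V} (h : l ≠ []) : ∃ v, l.getLast? = some v :=
  ⟨_, List.getLast?_eq_some_getLast h⟩

def toD (D : V → V → Prop) (P : Set (List V)) : Set (DiPath D) := {p | p.verts ∈ P}
def ofD {D : V → V → Prop} (P : Set (DiPath D)) : Set (List V) := {l | ∃ p ∈ P, p.verts = l}

theorem DiPath.head?_eq {D : V → V → Prop} (p : DiPath D) : p.verts.head? = some p.first :=
  List.head?_eq_some_head p.ne
theorem DiPath.getLast?_eq {D : V → V → Prop} (p : DiPath D) : p.verts.getLast? = some p.last :=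
  List.getLast?_eq_some_getLast p.ne
theorem DiPath.ext' {D : V → V → Prop} {p q : DiPath D} (h : p.verts = q.verts) : p = q := by
  cases p; cases q; cases h; rfl

theorem ofD_sys {D : V → V → Prop} {P : Set (DiPath D)} (h : IsLinkage D B0 P) :
    Sys D (ofD P) := by
  refine ⟨?_, ?_⟩
  · rintro l ⟨p, hp, rfl⟩; exact ⟨p.ne, p.nodup, p.chain⟩
  · rintro l ⟨p, hp, rfl⟩ m ⟨q, hq, rfl⟩ v hv hw
    by_contra hne
    have := h.2 p hp q hq (fun e => hne (e ▸ rfl))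
    exact disjoint_left.1 this hv hw

theorem Hd_ofD {D : V → V → Prop} (P : Set (DiPath D)) : Hd (ofD P) = Ini P := by
  ext v; constructor
  · rintro ⟨l, ⟨p, hp, rfl⟩, h⟩
    rw [p.head?_eq] at h; exact ⟨p, hp, Option.some.inj h⟩
  · rintro ⟨p, hp, rfl⟩; exact ⟨_, ⟨p, hp, rfl⟩, p.head?_eq⟩
theorem Lst_ofD {D : V → V → Prop} (P : Set (DiPath D)) : Lst (ofD P) = Ter P := by
  ext v; constructor
  · rintro ⟨l, ⟨p, hp, rfl⟩, h⟩
    rw [p.getLast?_eq] at h; exact ⟨p, hp, Option.some.inj h⟩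
  · rintro ⟨p, hp, rfl⟩; exact ⟨_, ⟨p, hp, rfl⟩, p.getLast?_eq⟩

theorem ofD_toD {D : V → V → Prop} (h : ∀ l ∈ P, IsP D l) :
    ofD (toD D P) = P := by
  ext l; constructor
  · rintro ⟨p, hp, rfl⟩; exact hp
  · intro hl; exact ⟨⟨l, (h l hl).1, (h l hl).2.1, (h l hl).2.2⟩, hl, rfl⟩

theorem toD_linkage {D : V → V → Prop} (h : Sys D P)
    (hl : Lst P ⊆ B0) : IsLinkage D B0 (toD D P) := by
  refine ⟨fun p hp => hl ⟨_, hp, p.getLast?_eq⟩, fun p hp q hq hne => ?_⟩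
  rw [disjoint_left]
  intro v hv hw
  exact hne (DiPath.ext' (h.2 _ hp _ hq v hv hw))
theorem Ini_toD {D : V → V → Prop} (h : Sys D P) : Ini (toD D P) = Hd P := by
  rw [← Hd_ofD, ofD_toD h.1]
theorem Ter_toD {D : V → V → Prop} (h : Sys D P) : Ter (toD D P) = Lst P := by
  rw [← Lst_ofD, ofD_toD h.1]

theorem linkable_iff {D : V → V → Prop} {B0 I : Set V} :
    Linkable D B0 I ↔ ∃ P, Sys D P ∧ Lst P ⊆ B0 ∧ Hd P = I := by
  constructor
  · rintro ⟨P, h, rfl⟩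
    exact ⟨ofD P, ofD_sys h, by rw [Lst_ofD]; rintro v ⟨p, hp, rfl⟩; exact h.1 p hp, Hd_ofD P⟩
  · rintro ⟨P, h, hl, rfl⟩
    exact ⟨toD D P, toD_linkage h hl, Ini_toD h⟩
theorem linkableOnto_iff {D : V → V → Prop} {B0 I : Set V} :
    LinkableOnto D B0 I ↔ ∃ P, Sys D P ∧ Lst P = B0 ∧ Hd P = I := by
  constructor
  · rintro ⟨P, h, rfl, rfl⟩
    exact ⟨ofD P, ofD_sys h, Lst_ofD P, Hd_ofD P⟩
  · rintro ⟨P, h, rfl, rfl⟩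
    exact ⟨toD D P, toD_linkage h le_rfl, Ini_toD h, Ter_toD h⟩

def Ed (E : V → V → Prop) : Bool → V → V → Prop
  | true, x, y => E x y
  | false, x, y => E y x

def Walk (E : V → V → Prop) : V → List (V × Bool) → V → Prop
  | x, [], w => x = w
  | x, a :: l, w => a.1 = x ∧ ∃ x', Ed E a.2 x x' ∧ Walk E x' l w

def lf : Bool → List (V × Bool) → Bool
  | d, [] => d
  | _, a :: l => lf a.2 l

def sinks : Bool → List (V × Bool) → Set V
  | _, [] => ∅
  | d, a :: l => {v | v = a.1 ∧ d = true ∧ a.2 = false} ∪ sinks a.2 l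

theorem Walk.append {x y w : V} {l m : List (V × Bool)} (h : Walk E x l y)
    (h' : Walk E y m w) : Walk E x (l ++ m) w := by
  induction l generalizing x with
  | nil => cases h; exact h'
  | cons a l ih => obtain ⟨h1, x', h2, h3⟩ := h; exact ⟨h1, x', h2, ih h3⟩

theorem lf_append (d : Bool) (l m : List (V × Bool)) : lf d (l ++ m) = lf (lf d l) m := by
  induction l generalizing d with
  | nil => rfl
  | cons a l ih => exact ih _

theorem sinks_append (d : Bool) (l m : List (V × Bool)) :
    sinks d (l ++ m) = sinks d l ∪ sinks (lf d l) m := by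
  induction l generalizing d with
  | nil => simp [sinks, lf]
  | cons a l ih => simp [sinks, lf, ih, union_assoc]

theorem sinks_sub {d : Bool} {l : List (V × Bool)} {v : V} (h : v ∈ sinks d l) :
    v ∈ l.map Prod.fst := by
  induction l generalizing d with
  | nil => exact h.elim
  | cons a l ih =>
    rcases h with h | h
    · simp [h.1]
    · simp only [List.map_cons, List.mem_cons]; exact Or.inr (ih h)

theorem mem_sinks {d : Bool} {l : List (V × Bool)} {v : V} : v ∈ sinks d l ↔
    (d = true ∧ l[0]? = some (v, false)) ∨
      ∃ k u, l[k]? = some (u, true) ∧ l[k+1]? = some (v, false) := by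
  induction l generalizing d with
  | nil => simp [sinks]
  | cons a l ih =>
    obtain ⟨a1, a2⟩ := a
    simp only [sinks, mem_union, ih, mem_ofPred_eq]
    constructor
    · rintro (⟨rfl, rfl, rfl⟩ | ⟨rfl, h⟩ | ⟨k, u, h⟩)
      · simp
      · exact Or.inr ⟨0, a1, by simp, by simpa using h⟩
      · exact Or.inr ⟨k+1, u, by simpa using h⟩
    · rintro (⟨rfl, h⟩ | ⟨k, u, h, h'⟩)
      · simp at h; simp [h]
      · cases k with
        | zero => simp at h; right; left; refine ⟨h.2, by simpa using h'⟩
        | succ k => right; right; exact ⟨k, u, by simpa using h, by simpa using h'⟩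

theorem Walk.edge {x w : V} {l : List (V × Bool)} (h : Walk E x l w) {i : ℕ}
    {a b : V × Bool} (ha : l[i]? = some a) (hb : l[i+1]? = some b) : Ed E a.2 a.1 b.1 := by
  induction l generalizing x i with
  | nil => simp at ha
  | cons c l ih =>
    obtain ⟨h1, x', h2, h3⟩ := h
    cases i with
    | zero =>
      simp at ha; subst ha
      cases l with
      | nil => simp at hb
      | cons e l => simp at hb; subst hb; obtain ⟨h4, -⟩ := h3; rw [h4, h1]; exact h2
    | succ i => exact ih h3 (by simpa using ha) (by simpa using hb)

def PTo (E : V → V → Prop) (T A : Set V) (v : V) (l : List V) : Prop :=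
  IsP E l ∧ l.head? = some v ∧ (∃ t ∈ T, l.getLast? = some t) ∧ ∀ u ∈ l, u ∈ A

structure ZW (E : V → V → Prop) (T A : Set V) (d : Bool) (x : V) (l : List (V × Bool)) (d' : Bool)
    (w : V) : Prop where
  walk : Walk E x l w
  lfe : lf d l = d'
  nodup : (l.map Prod.fst).Nodup
  sub : ∀ v ∈ l.map Prod.fst, v ∈ A
  links : ∃ L : V → List V, (∀ v ∈ sinks d l, PTo E T A v (L v) ∧
    ∀ u ∈ L v, u ∈ l.map Prod.fst → u = v) ∧
    ∀ v ∈ sinks d l, ∀ v' ∈ sinks d l, ∀ u, u ∈ L v → u ∈ L v' → v = v'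

theorem PTo.mono {T A B : Set V} {v : V} {l : List V} (h : PTo E T A v l)
    (hA : A ⊆ B) : PTo E T B v l := ⟨h.1, h.2.1, h.2.2.1, fun u hu => hA (h.2.2.2 u hu)⟩

theorem ZW.append {T A B : Set V} {d e d' : Bool} {x y w : V}
    {l m : List (V × Bool)} (h : ZW E T A d x l e y) (h' : ZW E T B e y m d' w)
    (hd : Disjoint A B) : ZW E T (A ∪ B) d x (l ++ m) d' w := by
  classical
  rw [disjoint_left] at hd
  obtain ⟨L, hL1, hL2⟩ := h.links
  obtain ⟨M, hM1, hM2⟩ := h'.links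
  have hs : sinks d (l ++ m) = sinks d l ∪ sinks e m := by rw [sinks_append, h.lfe]
  have hlA : ∀ v ∈ sinks d l, v ∈ A := fun v hv => h.sub v (sinks_sub hv)
  have hmB : ∀ v ∈ sinks e m, v ∈ B := fun v hv => h'.sub v (sinks_sub hv)
  refine ⟨h.walk.append h'.walk, by rw [lf_append, h.lfe, h'.lfe], ?_, ?_, ?_⟩
  · rw [List.map_append, List.nodup_append]
    exact ⟨h.nodup, h'.nodup, fun a ha b hb e => hd (h.sub a ha) (e ▸ h'.sub b hb)⟩
  · intro v hv
    rw [List.map_append, List.mem_append] at hv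
    exact hv.imp (h.sub v) (h'.sub v)
  · obtain ⟨N, hN1, hN2⟩ : ∃ N : V → List V, (∀ v ∈ A, N v = L v) ∧ ∀ v, v ∉ A → N v = M v :=
      ⟨fun v => if v ∈ A then L v else M v, fun v h => if_pos h, fun v h => if_neg h⟩
    refine ⟨N, ?_, ?_⟩
    · rw [hs]
      rintro v (hv | hv)
      · rw [hN1 v (hlA v hv)]
        refine ⟨(hL1 v hv).1.mono subset_union_left, fun u hu hu' => ?_⟩
        rw [List.map_append, List.mem_append] at hu'
        rcases hu' with hu' | hu'
        · exact (hL1 v hv).2 u hu hu'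
        · exact (hd ((hL1 v hv).1.2.2.2 u hu) (h'.sub u hu')).elim
      · rw [hN2 v (fun c => hd c (hmB v hv))]
        refine ⟨(hM1 v hv).1.mono subset_union_right, fun u hu hu' => ?_⟩
        rw [List.map_append, List.mem_append] at hu'
        rcases hu' with hu' | hu'
        · exact (hd (h.sub u hu') ((hM1 v hv).1.2.2.2 u hu)).elim
        · exact (hM1 v hv).2 u hu hu'
    · rw [hs]
      rintro v (hv | hv) v' (hv' | hv') u
      · rw [hN1 v (hlA v hv), hN1 v' (hlA v' hv')]; exact hL2 v hv v' hv' u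
      · rw [hN1 v (hlA v hv), hN2 v' (fun c => hd c (hmB v' hv'))]
        intro h1 h2
        exact (hd ((hL1 v hv).1.2.2.2 u h1) ((hM1 v' hv').1.2.2.2 u h2)).elim
      · rw [hN2 v (fun c => hd c (hmB v hv)), hN1 v' (hlA v' hv')]
        intro h1 h2
        exact (hd ((hL1 v' hv').1.2.2.2 u h2) ((hM1 v hv).1.2.2.2 u h1)).elim
      · rw [hN2 v (fun c => hd c (hmB v hv)), hN2 v' (fun c => hd c (hmB v' hv'))]
        exact hM2 v hv v' hv' u

theorem ZW.mono {T A B : Set V} {d d' : Bool} {x w : V}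
    {l : List (V × Bool)} (h : ZW E T A d x l d' w) (hA : A ⊆ B) : ZW E T B d x l d' w := by
  obtain ⟨L, hL1, hL2⟩ := h.links
  exact ⟨h.walk, h.lfe, h.nodup, fun v hv => hA (h.sub v hv), L,
    fun v hv => ⟨(hL1 v hv).1.mono hA, (hL1 v hv).2⟩, hL2⟩

theorem ZW.single {T : Set V} {d d' : Bool} {x w : V} (h : Ed E d' x w)
    (hd : d = false ∨ d' = true) : ZW E T {x} d x [(x, d')] d' w := by
  have hs : sinks d [(x, d')] = ∅ := by
    ext v; simp only [sinks]; cases d <;> cases d' <;> simp_all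
  refine ⟨⟨rfl, w, h, rfl⟩, rfl, by simp, by simp, fun _ => [], ?_, ?_⟩ <;> rw [hs] <;> simp

theorem Walk.split {x w : V} {l m : List (V × Bool)} (h : Walk E x (l ++ m) w) :
    ∃ y, Walk E x l y ∧ Walk E y m w := by
  induction l generalizing x with
  | nil => exact ⟨x, rfl, h⟩
  | cons a l ih =>
    obtain ⟨h1, x', h2, h3⟩ := h
    obtain ⟨y, h4, h5⟩ := ih h3
    exact ⟨y, ⟨h1, x', h2, h4⟩, h5⟩

theorem first_false {l : List (V × Bool)} (h : ∃ a ∈ l, a.2 = false) :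
    ∃ a v b, l = a ++ (v, false) :: b ∧ lf true a = true := by
  induction l with
  | nil => simp at h
  | cons c l ih =>
    obtain ⟨c1, c2⟩ := c
    cases c2 with
    | false => exact ⟨[], c1, l, rfl, rfl⟩
    | true =>
      simp at h
      obtain ⟨a, v, b, rfl, h2⟩ := ih (by simpa using h)
      exact ⟨(c1, true) :: a, v, b, rfl, h2⟩

theorem ZW.trim {T A : Set V} {x w : V} {l : List (V × Bool)}
    (h : ZW E T A true x l true w) (hf : ∃ a ∈ l, a.2 = false) :
    ∃ v l', ZW E T A true v ((v, false) :: l') true w ∧ v ∈ sinks true l := by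
  obtain ⟨a, v, b, rfl, hl⟩ := first_false hf
  obtain ⟨y, h1, h2⟩ := h.walk.split
  have hs : sinks true (a ++ (v, false) :: b) = sinks true a ∪ sinks true ((v, false) :: b) := by
    rw [sinks_append, hl]
  have hv : y = v := h2.1.symm
  subst hv
  have hm : ∀ u ∈ ((y, false) :: b).map Prod.fst, u ∈ (a ++ (y, false) :: b).map Prod.fst := by grind
  obtain ⟨L, hL1, hL2⟩ := h.links
  rw [hs] at hL1 hL2
  refine ⟨y, b, ⟨h2, ?_, ?_, fun u hu => h.sub u (hm u hu), L, ?_, ?_⟩, ?_⟩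
  · have := h.lfe; rwa [lf_append, hl] at this
  · have := h.nodup; rw [List.map_append, List.nodup_append] at this; exact this.2.1
  · grind
  · grind
  · rw [hs]; right; left; exact ⟨rfl, rfl, rfl⟩

def catn (l : ℕ → List (V × Bool)) : ℕ → List (V × Bool)
  | 0 => []
  | n + 1 => catn l n ++ l n

theorem catn_prefix (l : ℕ → List (V × Bool)) {m n : ℕ} (h : m ≤ n) : catn l m <+: catn l n := by
  induction n, h using Nat.le_induction with
  | base => exact List.prefix_rfl
  | succ n h ih => exact ih.trans (List.prefix_append _ _)

theorem get_prefix {α : Type*} {l m : List α} (h : l <+: m) {i : ℕ} {a : α}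
    (ha : l[i]? = some a) : m[i]? = some a := by
  obtain ⟨t, rfl⟩ := h
  rw [List.getElem?_append_left (List.getElem?_eq_some_iff.1 ha).1]; exact ha

theorem asm0 {T : Set V} (A : ℕ → Set V) (x : ℕ → V) (l : ℕ → List (V × Bool))
    (hz : ∀ k, ZW E T (A k) true (x k) (l k) true (x (k+1)))
    (hA : ∀ i j, i ≠ j → Disjoint (A i) (A j)) (hf : ∀ k, ∃ a ∈ l k, a.2 = false)
    (v0 : V) (l0 : List (V × Bool)) (h0 : l 0 = (v0, false) :: l0) : ContainsAltComb E T := by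
  have hzw : ∀ n, ZW E T (⋃ k < n, A k) true (x 0) (catn l n) true (x n) := by
    intro n
    induction n with
    | zero => exact ⟨rfl, rfl, by simp [catn], by simp [catn], fun _ => [], by simp [catn, sinks],
        by simp [catn, sinks]⟩
    | succ n ih =>
      refine ((ih.append (hz n)) ?_).mono ?_
      · simp only [disjoint_iUnion_left]
        intro i hi; exact hA _ _ (by omega)
      · apply union_subset
        · exact biUnion_subset_biUnion_left (fun i (hi : i < n) => Nat.lt_succ_of_lt hi)
        · exact subset_biUnion_of_mem (u := A) (show n < n + 1 by omega)
  have hlen : ∀ n, n ≤ (catn l n).length := by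
    intro n
    induction n with
    | zero => simp
    | succ n ih =>
      simp only [catn, List.length_append]
      have : 0 < (l n).length := by
        obtain ⟨a, ha, -⟩ := hf n; exact List.length_pos_of_mem ha
      omega
  have hg : ∀ n, ∃ g, ∀ m, n < m → (catn l m)[n]? = some g := by
    intro n
    refine ⟨(catn l (n+1))[n]'(hlen (n+1)), fun m hm => ?_⟩
    exact get_prefix (catn_prefix l hm) (List.getElem?_eq_getElem _)
  choose g hg using hg
  have hg' : ∀ m n a, (catn l m)[n]? = some a → a = g n := by
    intro m n a h
    have h1 := get_prefix (catn_prefix l (le_max_left m (n+1))) h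
    rw [hg n _ (by omega)] at h1
    exact (Option.some.inj h1).symm
  have hg0 : g 0 = (v0, false) := by
    have := hg 0 1 (by omega); simp [catn, h0] at this; exact this.symm
  have hsink : ∀ n, sinks true (catn l n) = ⋃ k < n, sinks true (l k) := by
    intro n
    induction n with
    | zero => simp [catn, sinks]
    | succ n ih =>
      rw [catn, sinks_append, ih, (hzw n).lfe, biUnion_lt_succ]
  have hS : (⋃ k, sinks true (l k)) =
      insert (g 0).1 {v | ∃ k, (g k).2 = true ∧ (g (k+1)).2 = false ∧ v = (g (k+1)).1} := by
    ext v; constructor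
    · intro hv
      obtain ⟨k, hk⟩ := mem_iUnion.1 hv
      have : v ∈ sinks true (catn l (k+1)) := by
        rw [hsink]; simp only [mem_iUnion]; exact ⟨k, by omega, hk⟩
      rcases mem_sinks.1 this with ⟨-, h⟩ | ⟨j, u, h, h'⟩
      · grind
      · grind
    · intro hv
      have : ∃ n, v ∈ sinks true (catn l n) := by
        rcases hv with rfl | ⟨k, h1, h2, rfl⟩
        · exact ⟨1, mem_sinks.2 (Or.inl ⟨rfl, by rw [hg 0 1 (by omega), hg0]⟩)⟩
        · refine ⟨k+2, mem_sinks.2 (Or.inr ⟨k, (g k).1, ?_, ?_⟩)⟩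
          · grind
          · grind
      obtain ⟨n, hn⟩ := this
      rw [hsink] at hn; simp only [mem_iUnion] at hn ⊢
      obtain ⟨k, -, hk⟩ := hn; exact ⟨k, hk⟩
  have hfA : ∀ n, ∃ k ≤ n, (g n).1 ∈ A k := by
    intro n
    have := (hzw (n+1)).sub (g n).1 (List.mem_map_of_mem (List.mem_of_getElem? (hg n (n+1) (by omega))))
    simp only [mem_iUnion] at this
    obtain ⟨k, hk, h⟩ := this; exact ⟨k, by omega, h⟩
  have hgl : ∀ n k, (g n).1 ∈ A k → (g n).1 ∈ (l k).map Prod.fst := by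
    intro n k h
    have hn : ∀ m, (g n).1 ∈ (catn l m).map Prod.fst →
        ∃ k, (g n).1 ∈ (l k).map Prod.fst := by
      intro m
      induction m with
      | zero => simp [catn]
      | succ m ih =>
        rw [catn, List.map_append, List.mem_append]
        rintro (h | h)
        · exact ih h
        · exact ⟨m, h⟩
    obtain ⟨j, hj⟩ := hn (n+1) (List.mem_map_of_mem (List.mem_of_getElem? (hg n (n+1) (by omega))))
    by_cases hjk : j = k
    · rwa [← hjk]
    · exact (disjoint_left.1 (hA j k hjk) ((hz j).sub _ hj) h).elim
  choose L hL1 hL2 using fun k => (hz k).links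
  have hLA : ∀ k v, v ∈ sinks true (l k) → ∀ u ∈ L k v, u ∈ A k :=
    fun k v hv u hu => (hL1 k v hv).1.2.2.2 u hu
  let P : Set (List V) := {p | ∃ k, ∃ v ∈ sinks true (l k), p = L k v}
  have hP : Sys E P := by
    refine ⟨?_, ?_⟩
    · rintro p ⟨k, v, hv, rfl⟩; exact (hL1 k v hv).1.1
    · rintro p ⟨k, v, hv, rfl⟩ q ⟨k', v', hv', rfl⟩ u hu hu'
      by_cases hk : k = k'
      · grind
      · exact (disjoint_left.1 (hA k k' hk) (hLA k v hv u hu) (hLA k' v' hv' u hu')).elim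
  have hPT : Lst P ⊆ T := by
    rintro t ⟨p, ⟨k, v, hv, rfl⟩, ht⟩
    obtain ⟨t', ht', h⟩ := (hL1 k v hv).1.2.2.1
    rw [ht] at h; cases h; exact ht'
  refine ⟨fun n => (g n).1, fun n => (g n).2, toD E P, ?_, ?_, ?_, toD_linkage hP hPT, ?_, ?_⟩
  · intro i j hij
    have hnd := (hzw (max i j + 1)).nodup
    have hi := hg i (max i j + 1) (by omega)
    have hj := hg j (max i j + 1) (by omega)
    rw [List.nodup_iff_getElem?_ne_getElem?] at hnd
    by_contra hne
    rcases Nat.lt_or_gt_of_ne hne with h | h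
    · grind
    · grind
  · intro n
    have := (hzw (n+2)).walk.edge (hg n (n+2) (by omega)) (hg (n+1) (n+2) (by omega))
    split
    · rename_i hb; rw [show (g n).2 = true from hb] at this; exact this
    · rename_i hb; rw [show (g n).2 = false from Bool.eq_false_iff.2 hb] at this; exact this
  · intro N
    obtain ⟨v, l', hv, hvs⟩ := (hz (N+1)).trim (hf (N+1))
    have hvA : v ∈ A (N+1) := (hz (N+1)).sub v (sinks_sub hvs)
    have : v ∈ ⋃ k, sinks true (l k) := mem_iUnion.2 ⟨_, hvs⟩
    have hne : ∀ n, v = (g n).1 → N < n := by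
      rintro n rfl
      obtain ⟨k, hk, h⟩ := hfA n
      by_contra hlt
      exact disjoint_left.1 (hA k (N+1) (by omega)) h hvA
    rw [hS] at this
    rcases this with h | ⟨k, h1, h2, h3⟩
    · grind
    · grind
  · rw [Ini_toD hP, ← hS]
    ext v; constructor
    · rintro ⟨p, ⟨k, v', hv, rfl⟩, h⟩
      have := (hL1 k v' hv).1.2.1
      rw [h] at this; cases this; exact mem_iUnion.2 ⟨k, hv⟩
    · intro hv
      obtain ⟨k, hk⟩ := mem_iUnion.1 hv
      exact ⟨_, ⟨k, v, hk, rfl⟩, (hL1 k v hk).1.2.1⟩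
  · rintro p ⟨k, v, hv, hp⟩ u hu ⟨n, rfl⟩
    have hu' : (g n).1 ∈ L k v := by rw [← hp]; exact hu
    have h1 := (hL1 k v hv).2 _ hu' (hgl n k (hLA k v hv _ hu'))
    have h2 := (hL1 k v hv).1.2.1
    rw [← hp, p.head?_eq] at h2
    rw [Option.some.inj h2]; exact h1

theorem asm {T : Set V} (A : ℕ → Set V) (x : ℕ → V) (l : ℕ → List (V × Bool))
    (hz : ∀ k, ZW E T (A k) true (x k) (l k) true (x (k+1)))
    (hA : ∀ i j, i ≠ j → Disjoint (A i) (A j)) (hf : ∀ k, ∃ a ∈ l k, a.2 = false) :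
    ContainsAltComb E T := by
  obtain ⟨v, l', h, -⟩ := (hz 0).trim (hf 0)
  refine asm0 A (fun k => if k = 0 then v else x k) (fun k => if k = 0 then (v, false) :: l' else l k)
    ?_ hA ?_ v l' (by simp)
  · grind
  · intro k
    by_cases hk : k = 0
    · subst hk; simp
    · simpa [hk] using hf k

theorem first_hit {l : List V} {X : Set V} (h : ∃ v ∈ l, v ∈ X) :
    ∃ s v t, l = s ++ v :: t ∧ v ∈ X ∧ ∀ u ∈ s, u ∉ X := by
  induction l with
  | nil => simp at h
  | cons a l ih =>
    by_cases ha : a ∈ X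
    · exact ⟨[], a, l, rfl, ha, by simp⟩
    · obtain ⟨v, hv, hvX⟩ := h
      have hv' : v ∈ l := by grind
      obtain ⟨s, w, t, rfl, h1, h2⟩ := ih ⟨v, hv', hvX⟩
      refine ⟨a :: s, w, t, rfl, h1, ?_⟩
      intro u hu
      rcases List.mem_cons.1 hu with rfl | h
      · exact ha
      · exact h2 u h

theorem last_hit {l : List V} {X : Set V} (h : ∃ v ∈ l, v ∈ X) :
    ∃ s v t, l = s ++ v :: t ∧ v ∈ X ∧ ∀ u ∈ t, u ∉ X := by
  obtain ⟨s, v, t, h1, h2, h3⟩ := first_hit (l := l.reverse) (X := X) (by simpa using h)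
  refine ⟨t.reverse, v, s.reverse, ?_, h2, by simpa using h3⟩
  rw [← List.reverse_reverse l, h1]; simp

theorem split_first {s s' t t' : List V} {v v' : V} {X : Set V} (h : s ++ v :: t = s' ++ v' :: t')
    (hv : v ∈ X) (hv' : v' ∈ X) (hs : ∀ u ∈ s, u ∉ X) (hs' : ∀ u ∈ s', u ∉ X) :
    s = s' ∧ v = v' ∧ t = t' := by
  induction s generalizing s' with
  | nil =>
    cases s' with
    | nil => simpa using h
    | cons b s' => simp at h; exact (hs' b (by simp) (h.1 ▸ hv)).elim
  | cons a s ih =>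
    cases s' with
    | nil => simp at h; exact (hs a (by simp) (h.1 ▸ hv')).elim
    | cons b s' =>
      simp at h
      obtain ⟨rfl, h⟩ := h
      obtain ⟨rfl, h1⟩ := ih h (fun u hu => hs u (by simp [hu])) (fun u hu => hs' u (by simp [hu]))
      exact ⟨rfl, h1⟩

theorem split_last {s s' t t' : List V} {v v' : V} {X : Set V} (h : s ++ v :: t = s' ++ v' :: t')
    (hv : v ∈ X) (hv' : v' ∈ X) (hs : ∀ u ∈ t, u ∉ X) (hs' : ∀ u ∈ t', u ∉ X) :
    s = s' ∧ v = v' ∧ t = t' := by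
  have h1 : t.reverse ++ v :: s.reverse = t'.reverse ++ v' :: s'.reverse := by grind
  obtain ⟨a, b, c⟩ := split_first h1 hv hv' (by simpa using hs) (by simpa using hs')
  exact ⟨by simpa using c, b, by simpa using a⟩

theorem nd_split {s t : List V} {v : V} (h : (s ++ v :: t).Nodup) :
    s.Nodup ∧ t.Nodup ∧ v ∉ s ∧ v ∉ t ∧ ∀ u ∈ s, u ∉ t := by
  rw [List.nodup_append, List.nodup_cons] at h
  obtain ⟨h1, ⟨h2, h3⟩, h4⟩ := h
  exact ⟨h1, h3, fun hv => h4 v hv v (by simp) rfl, h2,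
    fun u hu hu' => h4 u hu u (by simp [hu']) rfl⟩

theorem split_uniq {s s' t t' : List V} {v : V} (h : s ++ v :: t = s' ++ v :: t')
    (hn : (s ++ v :: t).Nodup) : s = s' ∧ t = t' := by
  have h1 := nd_split hn
  have h2 := nd_split (h ▸ hn)
  obtain ⟨a, -, c⟩ := split_first (X := {v}) h rfl rfl (fun u hu e => h1.2.2.1 (e ▸ hu))
    (fun u hu e => h2.2.2.1 (e ▸ hu))
  exact ⟨a, c⟩

theorem IsP.glue {s t s' t' : List V} {v : V} (h : IsP E (s ++ v :: t))
    (h' : IsP E (s' ++ v :: t')) (hd : ∀ u ∈ s, u ∉ t') : IsP E (s ++ v :: t') := by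
  obtain ⟨-, n1, c1⟩ := h
  obtain ⟨-, n2, c2⟩ := h'
  have m1 := nd_split n1
  have m2 := nd_split n2
  refine ⟨by simp, ?_, ?_⟩
  · grind
  · rw [List.isChain_split] at c1 c2 ⊢
    exact ⟨c1.1, c2.2⟩

theorem head?_split (s t t' : List V) (v : V) : (s ++ v :: t).head? = (s ++ v :: t').head? := by
  cases s <;> simp
theorem last?_split (s s' t : List V) (v : V) :
    (s ++ v :: t).getLast? = (s' ++ v :: t).getLast? := by
  rw [List.getLast?_append_cons, List.getLast?_append_cons]

def PI (P : Set (List V)) (T : Set V) : Set V :=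
  {v | ∃ s t, s ++ v :: t ∈ P ∧ ∀ u ∈ s, u ∉ T}
def PT (Q : Set (List V)) (I : Set V) : Set V :=
  {v | ∃ s t, s ++ v :: t ∈ Q ∧ ∀ u ∈ t, u ∉ I}

def Phi (P Q : Set (List V)) : Set V →o Set V where
  toFun T := PT Q (PI P T)
  monotone' := by
    rintro T T' h v ⟨s, t, h1, h2⟩
    refine ⟨s, t, h1, fun u hu => ?_⟩
    rintro ⟨a, b, h3, h4⟩
    exact h2 u hu ⟨a, b, h3, fun z hz hz' => h4 z hz (h hz')⟩

theorem PI_pre {T : Set V} {s t : List V} {v : V} (h : s ++ v :: t ∈ P)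
    (hs : ∀ u ∈ s, u ∉ T) : ∀ u ∈ s, u ∈ PI P T := by
  intro u hu
  obtain ⟨a, b, rfl⟩ := List.append_of_mem hu
  exact ⟨a, b ++ v :: t, by simpa using h, fun z hz => hs z (by simp [hz])⟩
theorem PT_post {T : Set V} {s t : List V} {v : V} (h : s ++ v :: t ∈ P)
    (hs : ∀ u ∈ t, u ∉ T) : ∀ u ∈ t, u ∈ PT P T := by
  intro u hu
  obtain ⟨a, b, rfl⟩ := List.append_of_mem hu
  exact ⟨s ++ v :: a, b, by simpa using h, fun z hz => hs z (by simp [hz])⟩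

theorem pym (hP : Sys E P) (hQ : Sys E Q) :
    ∃ R, Sys E R ∧ Hd P ⊆ Hd R ∧ Hd R ⊆ Hd P ∪ Hd Q ∧ Lst Q ⊆ Lst R ∧ Lst R ⊆ Lst P ∪ Lst Q := by
  obtain ⟨T, hT⟩ : ∃ T, PT Q (PI P T) = T := ⟨_, (Phi P Q).map_lfp⟩
  obtain ⟨I, hI⟩ : ∃ I, PI P T = I := ⟨_, rfl⟩
  rw [hI] at hT
  have preI : ∀ {s t v}, s ++ v :: t ∈ P → (∀ u ∈ s, u ∉ T) → ∀ u ∈ s, u ∈ I := by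
    rw [← hI]; exact PI_pre
  have posT : ∀ {s t v}, s ++ v :: t ∈ Q → (∀ u ∈ t, u ∉ I) → ∀ u ∈ t, u ∈ T := by
    intro s t v; rw [← hT]; exact PT_post
  have memI : ∀ {s t v}, s ++ v :: t ∈ P → (∀ u ∈ s, u ∉ T) → v ∈ I := by
    intro s t v h1 h2; rw [← hI]; exact ⟨s, t, h1, h2⟩
  have memT : ∀ {s t v}, s ++ v :: t ∈ Q → (∀ u ∈ t, u ∉ I) → v ∈ T := by
    intro s t v h1 h2; rw [← hT]; exact ⟨s, t, h1, h2⟩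
  let R1 : Set (List V) := {l | ∃ s v t s' t', s ++ v :: t ∈ P ∧ s' ++ v :: t' ∈ Q ∧
    (∀ u ∈ s, u ∉ T) ∧ (∀ u ∈ t', u ∉ I) ∧ l = s ++ v :: t'}
  let R2 : Set (List V) := {p | p ∈ P ∧ ∀ u ∈ p, u ∉ T}
  let R3 : Set (List V) := {q | q ∈ Q ∧ ∀ u ∈ q, u ∉ I}
  have R2I : ∀ p ∈ R2, ∀ u ∈ p, u ∈ I := by
    rintro p ⟨hp, hp'⟩ u hu
    obtain ⟨a, b, rfl⟩ := List.append_of_mem hu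
    exact memI hp (fun z hz => hp' z (by simp [hz]))
  have R3T : ∀ q ∈ R3, ∀ u ∈ q, u ∈ T := by
    rintro p ⟨hp, hp'⟩ u hu
    obtain ⟨a, b, rfl⟩ := List.append_of_mem hu
    exact memT hp (fun z hz => hp' z (by simp [hz]))
  have h11 : ∀ l ∈ R1, ∀ m ∈ R1, ∀ w, w ∈ l → w ∈ m → l = m := by
    rintro l ⟨s, v, t, s', t', h1, h2, h3, h4, rfl⟩ m ⟨a, y, b, a', b', g1, g2, g3, g4, rfl⟩ w hw hw'
    have hvT := memT h2 h4
    have hyT := memT g2 g4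
    have hvI := memI h1 h3
    have hyI := memI g1 g3
    by_cases hwT : w ∈ T
    · have e1 : w ∈ s' ++ v :: t' := by
        rcases List.mem_append.1 hw with h | h
        · exact (h3 w h hwT).elim
        · exact List.mem_append_right _ h
      have e2 : w ∈ a' ++ y :: b' := by grind
      obtain ⟨rfl, rfl, rfl⟩ := split_last (hQ.2 _ h2 _ g2 w e1 e2) hvI hyI h4 g4
      obtain ⟨rfl, -⟩ := split_uniq (hP.2 _ h1 _ g1 v (by simp) (by simp)) (hP.1 _ h1).2.1
      rfl
    · have e1 : w ∈ s ++ v :: t := by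
        rcases List.mem_append.1 hw with h | h
        · exact List.mem_append_left _ h
        · rcases List.mem_cons.1 h with rfl | h
          · exact (hwT hvT).elim
          · exact (hwT (posT h2 h4 w h)).elim
      have e2 : w ∈ a ++ y :: b := by
        rcases List.mem_append.1 hw' with h | h
        · exact List.mem_append_left _ h
        · rcases List.mem_cons.1 h with rfl | h
          · exact (hwT hyT).elim
          · exact (hwT (posT g2 g4 w h)).elim
      obtain ⟨rfl, rfl, rfl⟩ := split_first (hP.2 _ h1 _ g1 w e1 e2) hvT hyT h3 g3
      obtain ⟨-, rfl⟩ := split_uniq (hQ.2 _ h2 _ g2 v (by simp) (by simp)) (hQ.1 _ h2).2.1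
      rfl
  have h12 : ∀ l ∈ R1, ∀ m ∈ R2, ∀ w, w ∈ l → w ∈ m → False := by
    rintro l ⟨s, v, t, s', t', h1, h2, h3, h4, rfl⟩ m hm w hw hw'
    have hwT := hm.2 w hw'
    have hvT := memT h2 h4
    have e1 : w ∈ s ++ v :: t := by grind
    have := hP.2 _ h1 _ hm.1 w e1 hw'
    exact hm.2 v (this ▸ (by simp)) hvT
  have h13 : ∀ l ∈ R1, ∀ m ∈ R3, ∀ w, w ∈ l → w ∈ m → False := by
    rintro l ⟨s, v, t, s', t', h1, h2, h3, h4, rfl⟩ m hm w hw hw'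
    have hwI := hm.2 w hw'
    have hvI := memI h1 h3
    have e1 : w ∈ s' ++ v :: t' := by grind
    have := hQ.2 _ h2 _ hm.1 w e1 hw'
    exact hm.2 v (this ▸ (by simp)) hvI
  have h23 : ∀ l ∈ R2, ∀ m ∈ R3, ∀ w, w ∈ l → w ∈ m → False :=
    fun l hl m hm w hw hw' => hl.2 w hw (R3T m hm w hw')
  refine ⟨R1 ∪ (R2 ∪ R3), ⟨?_, ?_⟩, ?_, ?_, ?_, ?_⟩
  · rintro l (⟨s, v, t, s', t', h1, h2, h3, h4, rfl⟩ | hl | hl)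
    · exact (hP.1 _ h1).glue (hQ.1 _ h2) (fun u hu hu' => h4 u hu' (preI h1 h3 u hu))
    · exact hP.1 _ hl.1
    · exact hQ.1 _ hl.1
  · rintro l (hl | hl | hl) m (hm | hm | hm) w hw hw'
    · exact h11 l hl m hm w hw hw'
    · grind
    · grind
    · grind
    · grind
    · grind
    · grind
    · grind
    · grind
  · rintro x ⟨p, hp, hx⟩
    by_cases h : ∃ v ∈ p, v ∈ T
    · obtain ⟨s, v, t, rfl, h1, h2⟩ := first_hit h
      have hv := h1
      rw [← hT] at h1
      obtain ⟨s', t', h3, h4⟩ := h1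
      exact ⟨_, Or.inl ⟨s, v, t, s', t', hp, h3, h2, h4, rfl⟩, by rw [← hx]; exact head?_split _ _ _ _⟩
    · grind
  · rintro x ⟨l, ⟨s, v, t, s', t', h1, h2, h3, h4, rfl⟩ | hl | hl, hx⟩
    · grind
    · grind
    · grind
  · rintro x ⟨q, hq, hx⟩
    by_cases h : ∃ v ∈ q, v ∈ I
    · obtain ⟨s', v, t', rfl, h1, h2⟩ := last_hit h
      rw [← hI] at h1
      obtain ⟨s, t, h3, h4⟩ := h1
      exact ⟨_, Or.inl ⟨s, v, t, s', t', h3, hq, h4, h2, rfl⟩, by rw [← hx]; exact last?_split _ _ _ _⟩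
    · grind
  · rintro x ⟨l, ⟨s, v, t, s', t', h1, h2, h3, h4, rfl⟩ | hl | hl, hx⟩
    · grind
    · grind
    · grind

theorem walk_fwd {x y : V} {l : List V} (h : (x :: (l ++ [y])).IsChain E) :
    Walk E x ((x :: l).map (fun v => (v, true))) y := by
  induction l generalizing x with
  | nil => simp at h; exact ⟨rfl, y, h, rfl⟩
  | cons b l ih =>
    rw [List.cons_append, List.isChain_cons_cons] at h
    exact ⟨rfl, b, h.1, ih h.2⟩

theorem walk_bwd {x y : V} {l : List V} (h : (y :: (l ++ [x])).IsChain E) :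
    Walk E x ((x :: l.reverse).map (fun v => (v, false))) y := by
  induction l generalizing y with
  | nil => simp at h; exact ⟨rfl, y, h, rfl⟩
  | cons b l ih =>
    rw [List.cons_append, List.isChain_cons_cons] at h
    have : (x :: (b :: l).reverse).map (fun v => (v, false)) =
      (x :: l.reverse).map (fun v => (v, false)) ++ [(b, false)] := by simp
    rw [this]
    exact (ih h.2).append ⟨rfl, y, h.1, rfl⟩

theorem lf_const (d e : Bool) (x : V) (l : List V) : lf d ((x :: l).map (fun v => (v, e))) = e := by
  induction l generalizing x d with
  | nil => rfl
  | cons b l ih => exact ih e b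

theorem sinks_true (d : Bool) (l : List V) : sinks d (l.map (fun v => (v, true))) = ∅ := by
  induction l generalizing d with
  | nil => rfl
  | cons b l ih => simp [sinks, ih]

theorem sinks_false (l : List V) : sinks false (l.map (fun v => (v, false))) = ∅ := by
  induction l with
  | nil => rfl
  | cons b l ih => simp [sinks, ih]

theorem map_fst_const (e : Bool) (l : List V) : (l.map (fun v => (v, e))).map Prod.fst = l := by
  induction l <;> simp_all

theorem ZW.fwd {T A : Set V} {d : Bool} {x y : V} {l : List V}
    (h : (x :: (l ++ [y])).IsChain E) (hn : (x :: l).Nodup) (hA : ∀ v ∈ x :: l, v ∈ A) :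
    ZW E T A d x ((x :: l).map (fun v => (v, true))) true y := by
  refine ⟨walk_fwd h, lf_const _ _ _ _, ?_, ?_, fun _ => [], ?_, ?_⟩
  · rwa [map_fst_const]
  · rwa [map_fst_const]
  · rw [sinks_true]; simp
  · rw [sinks_true]; simp

theorem ZW.bwd {T A : Set V} {d : Bool} {x y : V} {l : List V}
    (h : (y :: (l ++ [x])).IsChain E) (hn : (l ++ [x]).Nodup) (hA : ∀ v ∈ l ++ [x], v ∈ A)
    (hl : d = true → ∃ m, PTo E T A x m ∧ ∀ u ∈ m, u ∈ l ++ [x] → u = x) :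
    ZW E T A d x ((x :: l.reverse).map (fun v => (v, false))) false y := by
  have hr : x :: l.reverse = (l ++ [x]).reverse := by simp
  have hs : ∀ v ∈ sinks d ((x :: l.reverse).map (fun v => (v, false))), d = true ∧ v = x := by
    intro v hv
    simp only [List.map_cons, sinks, sinks_false] at hv
    rcases hv with hv | hv
    · grind
    · exact hv.elim
  refine ⟨walk_bwd h, lf_const _ _ _ _, ?_, ?_, ?_⟩
  · grind
  · rw [map_fst_const, hr]; intro v hv; exact hA v (List.mem_reverse.1 hv)
  · cases d with
    | false =>
      refine ⟨fun _ => [], fun v hv => absurd (hs v hv).1 (by simp), fun v hv => absurd (hs v hv).1 (by simp)⟩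
    | true =>
      obtain ⟨m, h1, h2⟩ := hl rfl
      refine ⟨fun _ => m, ?_, ?_⟩
      · intro v hv
        rw [(hs v hv).2]
        refine ⟨h1, fun u hu hu' => h2 u hu ?_⟩
        rw [map_fst_const, hr] at hu'; exact List.mem_reverse.1 hu'
      · grind

theorem IsP.suffix {s t : List V} (h : IsP E (s ++ t)) (ht : t ≠ []) :
    IsP E t := ⟨ht, (List.nodup_append.1 h.2.1).2.1, (List.isChain_append.1 h.2.2).2.1⟩
theorem IsP.prefix {s t : List V} (h : IsP E (s ++ t)) (ht : s ≠ []) :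
    IsP E s := ⟨ht, (List.nodup_append.1 h.2.1).1, (List.isChain_append.1 h.2.2).1⟩

theorem lemmaC {P R : Set (List V)} (hP : Sys E P) (hR : Sys E R)
    (hRB : Lst R ⊆ B0) (hH : Hd R ⊆ Hd P) (hL : Lst P ⊆ Lst R)
    {a0 : V} (ha : a0 ∈ Hd P) (ha' : a0 ∉ Hd R) : ContainsAltComb E B0 := by
  obtain ⟨T, hTg⟩ : ∃ T, OrderHom.gfp (Phi P R) = T := ⟨_, rfl⟩
  have hT : PT R (PI P T) = T := by rw [← hTg]; exact (Phi P R).map_gfp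
  have hTmax : ∀ T', T' ⊆ PT R (PI P T') → T' ⊆ T := fun T' h => hTg ▸ (Phi P R).le_gfp h
  obtain ⟨I, hI⟩ : ∃ I, PI P T = I := ⟨_, rfl⟩
  rw [hI] at hT
  have preI : ∀ {s t v}, s ++ v :: t ∈ P → (∀ u ∈ s, u ∉ T) → ∀ u ∈ s, u ∈ I := by
    rw [← hI]; exact PI_pre
  have memI : ∀ {s t v}, s ++ v :: t ∈ P → (∀ u ∈ s, u ∉ T) → v ∈ I := by
    intro s t v h1 h2; rw [← hI]; exact ⟨s, t, h1, h2⟩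
  have memT : ∀ {s t v}, s ++ v :: t ∈ R → (∀ u ∈ t, u ∉ I) → v ∈ T := by
    intro s t v h1 h2; rw [← hT]; exact ⟨s, t, h1, h2⟩
  have hit : ∀ p ∈ P, ∃ v ∈ p, v ∈ T := by
    intro p hp
    obtain ⟨z, hz⟩ := exists_last (hP.1 p hp).1
    obtain ⟨r, hr, hrz⟩ := hL ⟨p, hp, hz⟩
    refine ⟨z, List.mem_of_getLast? hz, ?_⟩
    obtain ⟨r', rfl⟩ := List.getLast?_eq_some_iff.1 hrz
    exact memT (t := []) hr (by simp)
  have hdI : ∀ z ∈ Hd P, z ∈ I := by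
    rintro z ⟨p, hp, hz⟩
    obtain ⟨p', rfl⟩ := List.head?_eq_some_iff.1 hz
    exact memI (s := []) hp (by simp)
  have hdP : ∀ {s t z}, s ++ z :: t ∈ P → z ∈ Hd P → s = [] := by
    rintro s t z h ⟨p, hp, hz⟩
    have := hP.2 _ h _ hp z (by simp) (List.mem_of_head? hz)
    cases s with
    | nil => rfl
    | cons b s =>
      rw [← this] at hz; simp at hz
      have := nd_split (hP.1 _ h).2.1
      exact (this.2.2.1 (by simp [hz])).elim
  have step : ∀ w, w ∈ I ∧ w ∈ T ∧ w ∉ Hd R → ∃ v w' s a t b c d, s ++ v :: (a ++ w :: t) ∈ R ∧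
      b ++ v :: (c ++ w' :: d) ∈ P ∧ v ∈ I ∧ v ∉ T ∧ (∀ u ∈ a, u ∉ I) ∧ (∀ u ∈ t, u ∉ I) ∧
      (∀ u ∈ b, u ∉ T) ∧ (∀ u ∈ c, u ∉ T) ∧ w' ∈ I ∧ w' ∈ T ∧ w' ∉ Hd R := by
    rintro w ⟨h1, h2, h3⟩
    have hw := h2
    rw [← hT] at h2
    obtain ⟨q, t, hq, ht⟩ := h2
    have hqh : ∃ z ∈ q, z ∈ I := by
      cases q with
      | nil => exact (h3 ⟨_, hq, by simp⟩).elim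
      | cons z q =>
        exact ⟨z, by simp, hdI z (hH ⟨_, hq, by simp⟩)⟩
    obtain ⟨s, v, a, rfl, hv, hva⟩ := last_hit hqh
    have hvT : v ∉ T := by
      intro hvT
      rw [← hT] at hvT
      obtain ⟨s', t', g1, g2⟩ := hvT
      have e : s ++ v :: (a ++ w :: t) ∈ R := by simpa using hq
      obtain ⟨-, rfl⟩ := split_uniq (hR.2 _ e _ g1 v (by simp) (by simp)) (hR.1 _ e).2.1
      exact g2 w (by simp) h1
    have hv' := hv
    rw [← hI] at hv'
    obtain ⟨b, c', hp, hb⟩ := hv'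
    obtain ⟨z, hz, hzT⟩ := hit _ hp
    have hz' : z ∈ c' := by grind
    obtain ⟨c, w', d, rfl, hw', hc⟩ := first_hit ⟨z, hz', hzT⟩
    have hp' : (b ++ v :: c) ++ w' :: d ∈ P := by simpa using hp
    refine ⟨v, w', s, a, t, b, c, d, by simpa using hq, hp, hv, hvT, hva, ht, hb, hc, ?_, hw', ?_⟩
    · refine memI hp' ?_
      intro u hu
      simp at hu
      rcases hu with hu | rfl | hu
      · exact hb u hu
      · exact hvT
      · exact hc u hu
    · intro h
      have := hdP hp' (hH h)
      simp at this
  choose! v g s a t b c d h1 h2 h3 h4 h5 h6 h7 h8 h9 using step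
  obtain ⟨p0, hp0, hp0a⟩ := ha
  obtain ⟨x0, w0, y0, rfl, hw0, hx0⟩ := first_hit (hit _ hp0)
  have hw0v : w0 ∈ I ∧ w0 ∈ T ∧ w0 ∉ Hd R := by
    refine ⟨memI hp0 hx0, hw0, fun h => ?_⟩
    have := hdP hp0 (hH h)
    subst this
    simp at hp0a; subst hp0a; exact ha' h
  let w : ℕ → V := fun n => g^[n] w0
  have hws : ∀ n, w (n+1) = g (w n) := fun n => Function.iterate_succ_apply' g n w0
  have hwv : ∀ n, w n ∈ I ∧ w n ∈ T ∧ w n ∉ Hd R := by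
    intro n
    induction n with
    | zero => exact hw0v
    | succ n ih => rw [hws]; exact h9 _ ih
  have nocyc : ∀ O : Set V, (∀ z ∈ O, (z ∈ I ∧ z ∈ T ∧ z ∉ Hd R) ∧ ∃ z' ∈ O, z = g z') → ∀ z, z ∉ O := by
    intro O hO z hz
    have key : T ∪ {u | ∃ z ∈ O, u ∈ v z :: (a z ++ z :: t z)} ⊆ T := by
      apply hTmax
      obtain ⟨T', hT'⟩ : ∃ T', T ∪ {u | ∃ z ∈ O, u ∈ v z :: (a z ++ z :: t z)} = T' := ⟨_, rfl⟩
      have hTT : T ⊆ T' := hT' ▸ subset_union_left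
      have hII : ∀ u, u ∈ PI P T' → u ∈ I := by
        rintro u ⟨x, y, e1, e2⟩
        exact memI e1 (fun z hz hz' => e2 z hz (hTT hz'))
      rw [hT']
      intro u hu
      rw [← hT'] at hu
      rcases hu with hu | ⟨z, hz, hu⟩
      · rw [← hT] at hu
        obtain ⟨x, y, e1, e2⟩ := hu
        exact ⟨x, y, e1, fun z hz hz' => e2 z hz (hII z hz')⟩
      · obtain ⟨hzv, z', hz', e⟩ := hO z hz
        have hzI : z ∉ PI P T' := by
          rintro ⟨x, y, e1, e2⟩
          have e3 := h2 z' (hO z' hz').1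
          rw [← e] at e3
          have e4 : (b z' ++ v z' :: c z') ++ z :: d z' ∈ P := by simpa using e3
          obtain ⟨rfl, -⟩ := split_uniq (hP.2 _ e4 _ e1 z (by simp) (by simp)) (hP.1 _ e4).2.1
          refine e2 (v z') (by simp) ?_
          rw [← hT']; right; exact ⟨z', hz', by simp⟩
        have hn : ∀ y ∈ a z ++ z :: t z, y ∉ PI P T' := by grind
        rcases List.mem_cons.1 hu with rfl | hu
        · exact ⟨s z, _, h1 z hzv, hn⟩
        · exact PT_post (h1 z hzv) hn u hu
    exact h4 z (hO z hz).1 (key (Or.inr ⟨z, hz, by simp⟩))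
  have hinj : ∀ i j, i < j → w i ≠ w j := by
    intro i j hij e
    refine nocyc {z | ∃ k, i < k ∧ k ≤ j ∧ z = w k} ?_ (w j) ⟨j, hij, le_rfl, rfl⟩
    rintro z ⟨k, hk1, hk2, rfl⟩
    refine ⟨hwv k, ?_⟩
    obtain ⟨k, rfl⟩ : ∃ m, k = m + 1 := ⟨k - 1, by omega⟩
    by_cases hk : i < k
    · exact ⟨w k, ⟨k, hk, by omega, rfl⟩, hws k⟩
    · obtain rfl : k = i := by omega
      exact ⟨w j, ⟨j, hij, le_rfl, rfl⟩, by rw [← e]; exact hws k⟩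
  have hinj' : ∀ i j, i ≠ j → w i ≠ w j := by grind
  let X : ℕ → Set V := fun k => {u | u ∈ v (w k) :: c (w k)}
  let Y : ℕ → Set V := fun k => {u | u ∈ a (w k) ++ w k :: t (w k)}
  have hXT : ∀ k, ∀ u ∈ X k, u ∉ T := by grind
  have hXp : ∀ k, (b (w k) ++ v (w k) :: c (w k)) ++ w (k+1) :: d (w k) ∈ P := by grind
  have hXI : ∀ k, ∀ u ∈ X k, u ∈ I := by
    intro k u hu
    refine preI (hXp k) ?_ u (by simp only [X, mem_ofPred_eq] at hu; simp at hu ⊢; tauto)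
    intro y hy
    rcases List.mem_append.1 hy with h | h
    · exact h7 _ (hwv k) y h
    · exact hXT k y h
  have hYp : ∀ k, (s (w k) ++ v (w k) :: a (w k)) ++ w k :: t (w k) ∈ R := by grind
  have hXX : ∀ i j, i ≠ j → ∀ u ∈ X i, u ∉ X j := by
    intro i j hij u hu hu'
    have e := hP.2 _ (hXp i) _ (hXp j) u
      (by simp only [X, mem_ofPred_eq] at hu; simp at hu ⊢; tauto)
      (by simp only [X, mem_ofPred_eq] at hu'; simp at hu' ⊢; tauto)
    have hh : ∀ k, ∀ y ∈ b (w k) ++ v (w k) :: c (w k), y ∉ T := by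
      intro k y hy
      rcases List.mem_append.1 hy with h | h
      · exact h7 _ (hwv k) y h
      · exact hXT k y h
    exact hinj' (i+1) (j+1) (by omega) (split_first e (hwv _).2.1 (hwv _).2.1 (hh i) (hh j)).2.1
  have hYY : ∀ i j, i ≠ j → ∀ u ∈ Y i, u ∉ Y j := by
    intro i j hij u hu hu'
    have e := hR.2 _ (hYp i) _ (hYp j) u
      (by simp only [Y, mem_ofPred_eq] at hu; simp at hu ⊢; tauto)
      (by simp only [Y, mem_ofPred_eq] at hu'; simp at hu' ⊢; tauto)
    exact hinj' i j hij (split_last e (hwv _).1 (hwv _).1 (h6 _ (hwv i)) (h6 _ (hwv j))).2.1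
  have hXY : ∀ i j, ∀ u ∈ X i, u ∉ Y j := by
    intro i j u hu hu'
    rcases List.mem_append.1 hu' with h | h
    · grind
    · grind
  have hch : ∀ k, ZW E B0 (Y k) true (w k) ((w k :: (a (w k)).reverse).map (fun v => (v, false))) false
      (v (w k)) := by
    intro k
    have hr := hR.1 _ (h1 _ (hwv k))
    have hr1 : IsP E ((v (w k) :: (a (w k) ++ [w k])) ++ t (w k)) := by
      have := hr.suffix (by simp); simpa using this
    have hr2 : IsP E (w k :: t (w k)) := (hR.1 _ (hYp k)).suffix (by simp)
    have hnd := nd_split (hR.1 _ (hYp k)).2.1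
    refine ZW.bwd (hr1.prefix (by simp)).2.2 ?_ ?_ ?_
    · exact ((hr1.prefix (by simp)).2.1).of_cons
    · intro u hu; simp only [Y, mem_ofPred_eq]; simp at hu ⊢; tauto
    · intro _
      refine ⟨w k :: t (w k), ⟨hr2, rfl, ?_, ?_⟩, ?_⟩
      · obtain ⟨z, hz⟩ := exists_last (l := w k :: t (w k)) (by simp)
        exact ⟨z, hRB ⟨_, hYp k, by rw [List.getLast?_append_cons]; exact hz⟩, hz⟩
      · grind
      · intro u hu hu'
        rcases List.mem_cons.1 hu with h | h
        · exact h
        · simp at hu'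
          rcases hu' with hu' | hu'
          · grind
          · exact hu'
  have hch2 : ∀ k, ZW E B0 (X k) false (v (w k)) ((v (w k) :: c (w k)).map (fun v => (v, true))) true
      (w (k+1)) := by
    intro k
    have hp := hP.1 _ (h2 _ (hwv k))
    have hp1 : IsP E ((v (w k) :: (c (w k) ++ [w (k+1)])) ++ d (w k)) := by
      have := hp.suffix (by simp); rw [hws]; simpa using this
    have hp2 : IsP E ((v (w k) :: c (w k)) ++ ([w (k+1)] ++ d (w k))) := by simpa using hp1
    exact ZW.fwd (hp1.prefix (by simp)).2.2 (hp2.prefix (by simp)).2.1 (fun u hu => hu)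
  refine asm (fun k => Y k ∪ X k) w _ (fun k => (hch k).append (hch2 k) ?_) ?_ ?_
  · rw [disjoint_right]; exact hXY k k
  · intro i j hij
    rw [disjoint_left]
    rintro u (hu | hu) (hu' | hu')
    · exact hYY i j hij u hu hu'
    · exact hXY j i u hu' hu
    · exact hXY i j u hu hu'
    · exact hXX i j hij u hu hu'
  · intro k; exact ⟨(w k, false), by simp, rfl⟩

def comp (A B : Set (List V)) : Set (List V) :=
  {l | ∃ s v t, s ++ [v] ∈ A ∧ v :: t ∈ B ∧ l = s ++ v :: t} ∪
  {l | l ∈ A ∧ ∀ v, l.getLast? = some v → v ∉ Hd B}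

theorem comp_sys {A B : Set (List V)} (hA : Sys E A) (hB : Sys E B)
    (h : ∀ a ∈ A, ∀ b ∈ B, ∀ u, u ∈ a → u ∈ b → a.getLast? = some u ∧ b.head? = some u) :
    Sys E (comp A B) := by
  have key : ∀ {s v t b u}, s ++ [v] ∈ A → v :: t ∈ B → u ∈ s → b ∈ B → u ∉ b := by
    intro s v t b u h1 h2 h3 h4 h5
    have := (h _ h1 _ h4 u (by simp [h3]) h5).1
    simp at this; subst this
    exact (nd_split (t := []) (hA.1 _ h1).2.1).2.2.1 h3
  have key2 : ∀ {a b u}, a ∈ A → (∀ v, a.getLast? = some v → v ∉ Hd B) → b ∈ B → u ∈ a → u ∉ b := by grind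
  refine ⟨?_, ?_⟩
  · rintro l (⟨s, v, t, h1, h2, rfl⟩ | ⟨h1, h2⟩)
    · exact (hA.1 _ h1).glue (s' := []) (hB.1 _ h2) (fun u hu hu' => key h1 h2 hu h2 (by simp [hu']))
    · exact hA.1 _ h1
  · rintro l (⟨s, v, t, h1, h2, rfl⟩ | ⟨h1, h2⟩) m (⟨s', v', t', g1, g2, rfl⟩ | ⟨g1, g2⟩) u hu hu'
    · have e : v = v' := by
        rcases List.mem_append.1 hu with p | p <;> rcases List.mem_append.1 hu' with q | q
        · have := hA.2 _ h1 _ g1 u (by simp [p]) (by simp [q])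
          exact (List.append_inj' this rfl).2 |> List.singleton_inj.1
        · grind
        · grind
        · grind
      subst e
      have e1 := hA.2 _ h1 _ g1 v (by simp) (by simp)
      have e2 := hB.2 _ h2 _ g2 v (by simp) (by simp)
      simp at e1 e2; rw [e1, e2]
    · exfalso
      rcases List.mem_append.1 hu with p | p
      · have := hA.2 _ h1 _ g1 u (by simp [p]) hu'
        exact g2 v (by rw [← this]; simp) ⟨_, h2, rfl⟩
      · exact key2 g1 g2 h2 hu' p
    · exfalso
      rcases List.mem_append.1 hu' with p | p
      · have := hA.2 _ g1 _ h1 u (by simp [p]) hu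
        exact h2 v' (by rw [← this]; simp) ⟨_, g2, rfl⟩
      · exact key2 h1 h2 g2 hu p
    · grind

theorem last_form {l : List V} {v : V} (h : l.getLast? = some v) : ∃ s, l = s ++ [v] :=
  List.getLast?_eq_some_iff.1 h
theorem head_form {l : List V} {v : V} (h : l.head? = some v) : ∃ s, l = v :: s :=
  List.head?_eq_some_iff.1 h

theorem comp_Hd (A B : Set (List V)) : Hd (comp A B) = Hd A := by
  ext x; constructor
  · rintro ⟨l, ⟨s, v, t, h1, h2, rfl⟩ | ⟨h1, h2⟩, hx⟩
    · grind
    · exact ⟨_, h1, hx⟩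
  · rintro ⟨a, ha, hx⟩
    by_cases h : ∃ v, a.getLast? = some v ∧ v ∈ Hd B
    · obtain ⟨v, hv, b, hb, hbv⟩ := h
      obtain ⟨s, rfl⟩ := last_form hv
      obtain ⟨t, rfl⟩ := head_form hbv
      exact ⟨_, Or.inl ⟨s, v, t, ha, hb, rfl⟩, by rw [← hx]; exact head?_split _ _ _ _⟩
    · push Not at h
      exact ⟨a, Or.inr ⟨ha, h⟩, hx⟩

theorem comp_Lst {A B : Set (List V)} (h : Hd B ⊆ Lst A) (hne : ∀ b ∈ B, b ≠ []) :
    Lst (comp A B) = Lst B ∪ (Lst A \ Hd B) := by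
  ext x; constructor
  · rintro ⟨l, ⟨s, v, t, h1, h2, rfl⟩ | ⟨h1, h2⟩, hx⟩
    · grind
    · grind
  · rintro (⟨b, hb, hx⟩ | ⟨⟨a, ha, hx⟩, hx'⟩)
    · obtain ⟨v, hv⟩ := exists_head (hne b hb)
      obtain ⟨a, ha, hav⟩ := h ⟨b, hb, hv⟩
      obtain ⟨s, rfl⟩ := last_form hav
      obtain ⟨t, rfl⟩ := head_form hv
      exact ⟨_, Or.inl ⟨s, v, t, ha, hb, rfl⟩, by rw [← hx, List.getLast?_append_cons]⟩
    · refine ⟨a, Or.inr ⟨ha, fun v hv => ?_⟩, hx⟩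
      rw [hx] at hv; cases hv; exact hx'

theorem comp_Vs (A B : Set (List V)) : Vs (comp A B) ⊆ Vs A ∪ Vs B := by
  rintro x ⟨l, ⟨s, v, t, h1, h2, rfl⟩ | ⟨h1, h2⟩, hx⟩
  · grind
  · grind

theorem exit_last (hD : IsDimaze E B0) {l : List V} (hl : IsP E l)
    {b : V} (hb : b ∈ B0) (hbl : b ∈ l) : l.getLast? = some b := by
  obtain ⟨s, t, rfl⟩ := List.append_of_mem hbl
  cases t with
  | nil => simp
  | cons c t =>
    have := (List.isChain_append.1 hl.2.2).2.1
    rw [List.isChain_cons_cons] at this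
    exact (hD b hb c this.1).elim

theorem ext_triv (hD : IsDimaze E B0) {Q : Set (List V)}
    (hQ : Sys E Q) (hL : Lst Q ⊆ B0) : LinkableOnto E B0 (Hd Q ∪ (B0 \ Lst Q)) := by
  rw [linkableOnto_iff]
  refine ⟨Q ∪ {l | ∃ b ∈ B0 \ Lst Q, l = [b]}, ⟨?_, ?_⟩, ?_, ?_⟩
  · rintro l (h | ⟨b, hb, rfl⟩)
    · exact hQ.1 l h
    · exact ⟨by simp, by simp, by simp⟩
  · rintro l (h | ⟨b, hb, rfl⟩) m (g | ⟨c, hc, rfl⟩) v hv hw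
    · grind
    · simp at hw; subst hw
      exact (hc.2 ⟨l, h, exit_last hD (hQ.1 _ h) hc.1 hv⟩).elim
    · simp at hv; subst hv
      exact (hb.2 ⟨m, g, exit_last hD (hQ.1 _ g) hb.1 hw⟩).elim
    · grind
  · ext x; constructor
    · grind
    · intro hx
      by_cases h : x ∈ Lst Q
      · grind
      · exact ⟨[x], Or.inr ⟨x, ⟨hx, h⟩, rfl⟩, by simp⟩
  · ext x; constructor
    · rintro ⟨l, h | ⟨b, hb, rfl⟩, hx⟩
      · grind
      · grind
    · rintro (⟨l, h, hx⟩ | hx)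
      · grind
      · exact ⟨[x], Or.inr ⟨x, hx, rfl⟩, by simp⟩

theorem sys_head_eq (h : Sys E P) {l m : List V} {v : V}
    (hl : l ∈ P) (hm : m ∈ P) (h1 : l.head? = some v) (h2 : m.head? = some v) : l = m :=
  h.2 l hl m hm v (List.mem_of_head? h1) (List.mem_of_head? h2)
theorem sys_last_eq (h : Sys E P) {l m : List V} {v : V}
    (hl : l ∈ P) (hm : m ∈ P) (h1 : l.getLast? = some v) (h2 : m.getLast? = some v) : l = m :=
  h.2 l hl m hm v (List.mem_of_getLast? h1) (List.mem_of_getLast? h2)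

theorem b2 (hAC : ¬ ContainsAltComb E B0) {B1 B2 : Set V}
    (h1 : LinkableOnto E B0 B1) (h2 : LinkableOnto E B0 B2) {x : V} (hx : x ∈ B1 \ B2) :
    ∃ y ∈ B2 \ B1, LinkableOnto E B0 (insert y (B1 \ {x})) := by
  obtain ⟨P1, hP1, hL1, hH1⟩ := linkableOnto_iff.1 h1
  obtain ⟨Q, hQ, hLQ, hHQ⟩ := linkableOnto_iff.1 h2
  let P : Set (List V) := {l | l ∈ P1 ∧ l.head? ≠ some x}
  have hPP : P ⊆ P1 := fun l hl => hl.1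
  have hHP : Hd P = B1 \ {x} := by
    ext v; rw [← hH1]; constructor
    · rintro ⟨l, ⟨hl, hl'⟩, hv⟩
      exact ⟨⟨l, hl, hv⟩, fun e => hl' (by rw [hv, show v = x from e])⟩
    · rintro ⟨⟨l, hl, hv⟩, hv'⟩
      exact ⟨l, ⟨hl, by rw [hv]; intro e; exact hv' (Option.some.inj e)⟩, hv⟩
  obtain ⟨R, hR, r1, r2, r3, r4⟩ := pym (hP1.sub hPP) hQ
  have hLR : Lst R = B0 := by
    apply Set.Subset.antisymm
    · refine r4.trans (union_subset ?_ hLQ.le)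
      rw [← hL1]; rintro v ⟨l, hl, hv⟩; exact ⟨l, hPP hl, hv⟩
    · rw [← hLQ]; exact r3
  rw [hHP] at r1 r2
  rw [hHQ] at r2
  have hne : ∃ y ∈ Hd R, y ∉ B1 \ {x} := by
    by_contra hc
    push Not at hc
    refine hAC (lemmaC hP1 hR hLR.le ?_ (by rw [hL1, hLR]) (a0 := x) (hH1 ▸ hx.1) ?_)
    · grind
    · grind
  obtain ⟨y, hyR, hy⟩ := hne
  have hout : ∀ z ∈ Hd R, z ∉ B1 \ {x} → z ∈ B2 \ B1 := by grind
  let N : V → V → Prop := fun a a' => ∃ b, (∃ r ∈ R, r.head? = some a ∧ r.getLast? = some b) ∧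
    ∃ p ∈ P1, p.head? = some a' ∧ p.getLast? = some b
  have hreach : ∀ z ∈ Hd R, z ∉ B1 \ {x} → Relation.ReflTransGen N z x := by
    intro z hz hz'
    by_contra hc
    refine hAC (lemmaC (P := {r | r ∈ R ∧ ∃ a, r.head? = some a ∧ Relation.ReflTransGen N z a})
      (R := {p | p ∈ P1 ∧ ∃ a, p.head? = some a ∧ Relation.ReflTransGen N z a})
      (hR.sub fun l hl => hl.1) (hP1.sub fun l hl => hl.1) ?_ ?_ ?_ (a0 := z) ?_ ?_)
    · rintro v ⟨l, hl, hv⟩; rw [← hL1]; exact ⟨l, hl.1, hv⟩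
    · rintro v ⟨l, ⟨hl, a, ha, hza⟩, hv⟩
      rw [ha] at hv; cases hv
      have hvx : v ≠ x := by rintro rfl; exact hc hza
      obtain ⟨r, hr, hra⟩ := r1 ⟨hH1 ▸ ⟨l, hl, ha⟩, hvx⟩
      exact ⟨r, ⟨hr, v, hra, hza⟩, hra⟩
    · rintro b ⟨r, ⟨hr, a, ha, hza⟩, hb⟩
      have : b ∈ Lst P1 := by grind
      obtain ⟨p, hp, hpb⟩ := this
      obtain ⟨a', ha'⟩ := exists_head (hP1.1 p hp).1
      exact ⟨p, ⟨hp, a', ha', hza.tail ⟨b, ⟨r, hr, ha, hb⟩, p, hp, ha', hpb⟩⟩, hpb⟩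
    · obtain ⟨r, hr, hrz⟩ := hz
      exact ⟨r, ⟨hr, z, hrz, .refl⟩, hrz⟩
    · rintro ⟨p, ⟨hp, -⟩, hpz⟩
      exact (hout z hz hz').2 (hH1 ▸ ⟨p, hp, hpz⟩)
  have hNB : ∀ {a a'}, N a a' → a' ∈ B1 := by grind
  have hNu : ∀ {a a' c}, N a c → N a' c → a = a' := by
    rintro a a' c ⟨b, ⟨r, hr, hra, hrb⟩, p, hp, hpc, hpb⟩ ⟨b', ⟨r', hr', hra', hrb'⟩, p', hp', hpc', hpb'⟩
    have := sys_head_eq hP1 hp hp' hpc hpc'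
    subst this
    rw [hpb] at hpb'; cases hpb'
    have := sys_last_eq hR hr hr' hrb hrb'
    subst this
    rw [hra] at hra'; cases hra'; rfl
  have huniq : ∀ z ∈ Hd R, z ∉ B1 \ {x} → z = y := by
    intro z hz hz'
    have hzx := hreach z hz hz'
    have hyx := hreach y hyR hy
    have key : ∀ {u w}, Relation.ReflTransGen N u w → u = w ∨ w ∈ B1 := by grind
    have tot : ∀ {w}, Relation.ReflTransGen N z w → Relation.ReflTransGen N y w →
        Relation.ReflTransGen N z y ∨ Relation.ReflTransGen N y z := by
      intro w h
      induction h with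
      | refl => exact fun h => Or.inr h
      | tail h1 h2 ih =>
        intro h
        rcases Relation.ReflTransGen.cases_tail h with rfl | ⟨c, h3, h4⟩
        · exact Or.inl (h1.tail h2)
        · obtain rfl := hNu h2 h4; exact ih h3
    rcases tot hzx hyx with h | h
    · grind
    · grind
  refine ⟨y, hout y hyR hy, linkableOnto_iff.2 ⟨R, hR, hLR, ?_⟩⟩
  ext z; constructor
  · grind
  · grind

def seg (f : ℕ → V) (m k : ℕ) : List V := (List.range' m (k + 1 - m)).map f

theorem mem_seg {f : ℕ → V} {m k : ℕ} {v : V} : v ∈ seg f m k ↔ ∃ i, m ≤ i ∧ i ≤ k ∧ v = f i := by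
  simp only [seg, List.mem_map, List.mem_range'_1]
  constructor
  · grind
  · grind

theorem seg_isP {f : ℕ → V} (hf : Function.Injective f) {m k : ℕ} (h : m ≤ k)
    (hE : ∀ i, m ≤ i → i < k → E (f i) (f (i+1))) : IsP E (seg f m k) := by
  refine ⟨?_, ?_, ?_⟩
  · intro e
    have : f m ∈ seg f m k := mem_seg.2 ⟨m, le_rfl, h, rfl⟩
    rw [e] at this; simp at this
  · exact List.Nodup.map hf List.nodup_range'
  · obtain ⟨n, rfl⟩ := Nat.exists_eq_add_of_le h
    clear h
    have e : ∀ m, seg f m (m + n) = (List.range' m (n+1)).map f := by intro m; simp [seg]; congr 2; omega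
    rw [e]
    induction n generalizing m with
    | zero => simp
    | succ n ih =>
      rw [List.range'_succ, List.map_cons]
      have := ih (m := m + 1) (fun i h1 h2 => hE i (by omega) (by omega)) (by intro m; simp [seg]; congr 2; omega)
      rw [List.range'_succ, List.map_cons] at this ⊢
      exact List.isChain_cons_cons.2 ⟨hE m le_rfl (by omega), this⟩

theorem seg_head {f : ℕ → V} {m k : ℕ} (h : m ≤ k) : (seg f m k).head? = some (f m) := by
  rw [seg, show k + 1 - m = (k - m) + 1 by omega, List.range'_succ]; rfl
theorem seg_last {f : ℕ → V} {m k : ℕ} (h : m ≤ k) : (seg f m k).getLast? = some (f k) := by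
  rw [seg, show k + 1 - m = (k - m) + 1 by omega, List.range'_1_concat]; simp; congr 1; omega

theorem seg_sys {f : ℕ → V} (hf : Function.Injective f) (S : Set (ℕ × ℕ))
    (h1 : ∀ a ∈ S, a.1 ≤ a.2) (h2 : ∀ a ∈ S, ∀ i, a.1 ≤ i → i < a.2 → E (f i) (f (i+1)))
    (h3 : ∀ a ∈ S, ∀ b ∈ S, ∀ i, a.1 ≤ i → i ≤ a.2 → b.1 ≤ i → i ≤ b.2 → a.1 = b.1 ∧ a.2 = b.2) :
    Sys E {l | ∃ a ∈ S, l = seg f a.1 a.2} := by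
  refine ⟨?_, ?_⟩
  · rintro l ⟨a, ha, rfl⟩; exact seg_isP hf (h1 a ha) (h2 a ha)
  · rintro l ⟨a, ha, rfl⟩ m ⟨b, hb, rfl⟩ v hv hw
    obtain ⟨i, i1, i2, rfl⟩ := mem_seg.1 hv
    obtain ⟨j, j1, j2, e⟩ := mem_seg.1 hw
    obtain rfl := hf e
    obtain ⟨e1, e2⟩ := h3 a ha b hb i i1 i2 j1 j2
    rw [e1, e2]

theorem rev_sys (h : Sys (fun a b => E b a) P) :
    Sys E {l | l.reverse ∈ P} := by
  refine ⟨?_, ?_⟩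
  · intro l hl
    obtain ⟨h1, h2, h3⟩ := h.1 _ hl
    refine ⟨by simpa using h1, List.nodup_reverse.1 h2, ?_⟩
    rw [List.isChain_reverse] at h3; exact h3
  · intro l hl m hm v hv hw
    have := h.2 _ hl _ hm v (by simpa using hv) (by simpa using hw)
    exact List.reverse_injective this

theorem ac_not_b2 (hD : IsDimaze E B0) (hAC : ContainsAltComb E B0) :
    ∃ A B : Set V, LinkableOnto E B0 A ∧ LinkableOnto E B0 B ∧ B ⊆ A ∧ ∃ x, x ∈ A \ B := by
  obtain ⟨f, o, P0, hf, hfe, hinf, hlink, hini, hray⟩ := hAC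
  have hET : ∀ n, o n = true → E (f n) (f (n+1)) := by grind
  have hEF : ∀ n, o n = false → E (f (n+1)) (f n) := by grind
  let P := ofD P0
  have hP : Sys E P := ofD_sys hlink
  have hPL : Lst P ⊆ B0 := by
    rw [Lst_ofD]; rintro v ⟨p, hp, rfl⟩; exact hlink.1 p hp
  have hPH : Hd P = insert (f 0) {v | ∃ k, o k = true ∧ o (k+1) = false ∧ v = f (k+1)} := by
    rw [Hd_ofD]; exact hini
  have hPr : ∀ p ∈ P, ∀ i, f i ∈ p → p.head? = some (f i) := by
    rintro p ⟨q, hq, rfl⟩ i hi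
    rw [hray q hq (f i) hi ⟨i, rfl⟩]; exact q.head?_eq
  let src : ℕ → Prop := fun m => o m = true ∧ (m = 0 ∨ o (m-1) = false)
  let SR : Set (ℕ × ℕ) := {a | a.1 < a.2 ∧ src a.1 ∧ (∀ i, a.1 ≤ i → i < a.2 → o i = true) ∧ o a.2 = false}
  let SL : Set (ℕ × ℕ) := {a | a.1 ≤ a.2 ∧ src a.2 ∧ (∀ i, a.1 ≤ i → i < a.2 → o i = false) ∧
    (a.1 = 0 ∨ o (a.1 - 1) = true)}
  let R : Set (List V) := {l | ∃ a ∈ SR, l = seg f a.1 a.2}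
  let L' : Set (List V) := {l | ∃ a ∈ SL, l = seg f a.1 a.2}
  let L : Set (List V) := {l | l.reverse ∈ L'}
  have hR : Sys E R := by
    refine seg_sys hf SR (fun a ha => ha.1.le) (fun a ha i h1 h2 => hET i (ha.2.2.1 i h1 h2)) ?_
    rintro ⟨m, k⟩ ⟨a1, ⟨a2, a3⟩, a4, a5⟩ ⟨m', k'⟩ ⟨b1, ⟨b2, b3⟩, b4, b5⟩ i i1 i2 i3 i4
    dsimp only at *
    have c1 : ¬ m < m' := by grind
    have c2 : ¬ m' < m := by grind
    have c3 : ¬ k < k' := by grind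
    have c4 : ¬ k' < k := by grind
    omega
  have hL : Sys E L := by
    refine rev_sys (seg_sys hf SL (fun a ha => ha.1) (fun a ha i h1 h2 => hEF i (ha.2.2.1 i h1 h2)) ?_)
    rintro ⟨m, k⟩ ⟨a1, ⟨a2, a3⟩, a4, a5⟩ ⟨m', k'⟩ ⟨b1, ⟨b2, b3⟩, b4, b5⟩ i i1 i2 i3 i4
    dsimp only at *
    have c1 : ¬ m < m' := by grind
    have c2 : ¬ m' < m := by grind
    have c3 : ¬ k < k' := by grind
    have c4 : ¬ k' < k := by grind
    omega
  have up : ∀ b m, ∃ k ≥ m, o k = b ∧ ∀ i, m ≤ i → i < k → o i = !b := by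
    intro b m
    have : ∃ k, m ≤ k ∧ o k = b := by
      obtain ⟨k, hk, h1, h2⟩ := hinf m
      cases b
      · grind
      · exact ⟨k, hk, h1⟩
    classical
    refine ⟨Nat.find this, (Nat.find_spec this).1, (Nat.find_spec this).2, fun i h1 h2 => ?_⟩
    have := Nat.find_min this h2
    have h3 : o i ≠ b := fun e => this ⟨h1, e⟩
    cases b <;> simpa using h3
  have down : ∀ b k, o k = b → ∃ j ≤ k, (j = 0 ∨ o (j-1) = !b) ∧ ∀ i, j ≤ i → i ≤ k → o i = b := by
    intro b k
    induction k with
    | zero => intro h; exact ⟨0, le_rfl, Or.inl rfl, fun i _ h2 => by rw [Nat.le_zero.1 h2, h]⟩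
    | succ k ih =>
      intro h
      by_cases hk : o k = b
      · grind
      · refine ⟨k+1, le_rfl, Or.inr ?_, fun i i1 i2 => by rw [show i = k + 1 by omega, h]⟩
        cases b <;> simpa using hk
  have hRH : Hd R = {v | ∃ m, src m ∧ v = f m} := by
    ext v; constructor
    · rintro ⟨l, ⟨a, ha, rfl⟩, hv⟩
      rw [seg_head ha.1.le] at hv; exact ⟨a.1, ha.2.1, (Option.some.inj hv).symm⟩
    · rintro ⟨m, hm, rfl⟩
      obtain ⟨k, h1, h2, h3⟩ := up false m
      have hmk : m ≠ k := by grind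
      exact ⟨_, ⟨(m, k), ⟨by dsimp only; omega, hm, h3, h2⟩, rfl⟩, seg_head h1⟩
  have hLH : Hd L = {v | ∃ m, src m ∧ v = f m} := by
    ext v; constructor
    · rintro ⟨l, ⟨a, ha, e⟩, hv⟩
      rw [← List.reverse_reverse l, e, List.head?_reverse, seg_last ha.1] at hv
      exact ⟨a.2, ha.2.1, (Option.some.inj hv).symm⟩
    · rintro ⟨m, hm, rfl⟩
      have : ∃ j ≤ m, (j = 0 ∨ o (j-1) = true) ∧ ∀ i, j ≤ i → i < m → o i = false := by
        rcases hm.2 with h | h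
        · grind
        · obtain ⟨j, h1, h2, h3⟩ := down false _ h
          exact ⟨j, by omega, h2, fun i i1 i2 => h3 i i1 (by omega)⟩
      obtain ⟨j, h1, h2, h3⟩ := this
      exact ⟨(seg f j m).reverse, ⟨(j, m), ⟨h1, hm, h3, h2⟩, by simp⟩, by
        rw [List.head?_reverse, seg_last h1]⟩
  have hRL : Lst R = {v | ∃ k, o k = true ∧ o (k+1) = false ∧ v = f (k+1)} := by
    ext v; constructor
    · rintro ⟨l, ⟨a, ha, rfl⟩, hv⟩
      rw [seg_last ha.1.le] at hv
      have h1 := ha.1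
      refine ⟨a.2 - 1, ha.2.2.1 _ (by omega) (by omega), ?_⟩
      rw [show a.2 - 1 + 1 = a.2 by omega]
      exact ⟨ha.2.2.2, (Option.some.inj hv).symm⟩
    · rintro ⟨k, h1, h2, rfl⟩
      obtain ⟨j, j1, j2, j3⟩ := down true k h1
      exact ⟨_, ⟨(j, k+1), ⟨by dsimp only; omega, ⟨j3 j le_rfl j1, j2⟩,
        fun i i1 (i2 : i < k + 1) => j3 i i1 (by omega), h2⟩, rfl⟩, seg_last (by omega)⟩
  have hLL : Lst L = Hd P := by
    rw [hPH]
    ext v; constructor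
    · rintro ⟨l, ⟨a, ha, e⟩, hv⟩
      rw [← List.reverse_reverse l, e, List.getLast?_reverse, seg_head ha.1] at hv
      obtain ⟨a1, a2, a3, a4⟩ := ha
      cases hv
      by_cases h0 : a.1 = 0
      · left; rw [h0]
      · grind
    · intro hv
      have : ∃ j, v = f j ∧ (j = 0 ∨ (o (j-1) = true ∧ o j = false)) := by
        rcases hv with rfl | ⟨k, h1, h2, rfl⟩
        · grind
        · grind
      obtain ⟨j, rfl, hj⟩ := this
      obtain ⟨m, h1, h2, h3⟩ := up true j
      refine ⟨(seg f j m).reverse, ⟨(j, m), ⟨h1, ⟨h2, ?_⟩, h3, hj.imp id And.left⟩, by simp⟩, by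
        rw [List.getLast?_reverse, seg_head h1]⟩
      dsimp only
      by_cases e : j = m
      · grind
      · grind
  let P' : Set (List V) := {p | p ∈ P ∧ ∃ v, p.head? = some v ∧ v ∈ Lst R}
  have hP' : Sys E P' := hP.sub fun l hl => hl.1
  have hcL : Sys E (comp L P) := by
    refine comp_sys hL hP ?_
    rintro l ⟨a, ha, e⟩ p hp u hu hu'
    have hu2 : u ∈ seg f a.1 a.2 := by rw [← e]; simpa using hu
    obtain ⟨i, i1, i2, rfl⟩ := mem_seg.1 hu2
    have hh := hPr p hp i hu'
    refine ⟨?_, hh⟩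
    rw [← List.reverse_reverse l, e, List.getLast?_reverse, seg_head ha.1]
    have : f i ∈ Hd P := ⟨p, hp, hh⟩
    rw [hPH] at this
    rcases this with h | ⟨k, h1, h2, h3⟩
    · rw [hf h] at i1 ⊢; rw [Nat.le_zero.1 i1]
    · grind
  have hcR : Sys E (comp R P') := by
    refine comp_sys hR hP' ?_
    rintro l ⟨a, ha, rfl⟩ p ⟨hp, w, hw, hwR⟩ u hu hu'
    obtain ⟨i, i1, i2, rfl⟩ := mem_seg.1 hu
    have hh := hPr p hp i hu'
    refine ⟨?_, hh⟩
    rw [hh] at hw; cases hw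
    rw [hRL] at hwR
    obtain ⟨k, h1, h2, h3⟩ := hwR
    obtain rfl := hf h3
    rw [seg_last ha.1.le]
    by_cases hne : a.2 = k + 1
    · rw [hne]
    · grind
  have hHP' : Hd P' = Lst R := by
    ext v; constructor
    · rintro ⟨p, ⟨hp, w, hw, hwR⟩, hv⟩; rw [hw] at hv; cases hv; exact hwR
    · intro hv
      have : v ∈ Hd P := by grind
      obtain ⟨p, hp, hpv⟩ := this
      exact ⟨p, ⟨hp, v, hpv, hv⟩, hpv⟩
  have e1 : Lst (comp L P) = Lst P := by
    rw [comp_Lst hLL.ge (fun b hb => (hP.1 b hb).1), hLL, sdiff_self]; simp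
  have e2 : Lst (comp R P') = Lst P' := by
    rw [comp_Lst hHP'.le (fun b hb => (hP'.1 b hb).1), hHP', sdiff_self]; simp
  have hP'P : Lst P' ⊆ Lst P := by rintro v ⟨l, hl, hv⟩; exact ⟨l, hl.1, hv⟩
  have k1 := ext_triv hD hcL (by rw [e1]; exact hPL)
  have k2 := ext_triv hD hcR (by rw [e2]; exact hP'P.trans hPL)
  rw [e1, comp_Hd, hLH] at k1
  rw [e2, comp_Hd, hRH] at k2
  refine ⟨_, _, k2, k1, union_subset_union_right _ (fun v hv => ⟨hv.1, fun h => hv.2 (hP'P h)⟩), ?_⟩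
  have : f 0 ∈ Hd P := by rw [hPH]; exact Or.inl rfl
  obtain ⟨p, hp, hp0⟩ := this
  obtain ⟨b, hb⟩ := exists_last (hP.1 p hp).1
  have hbP : b ∈ Lst P := ⟨p, hp, hb⟩
  refine ⟨b, Or.inr ⟨hPL hbP, ?_⟩, ?_⟩
  · rintro ⟨q, ⟨hq, w, hw, hwR⟩, hqb⟩
    have := sys_last_eq hP hp hq hb hqb
    subst this
    rw [hp0] at hw; cases hw
    rw [hRL] at hwR
    obtain ⟨k, -, -, h⟩ := hwR
    exact absurd (hf h) (by omega)
  · rintro (⟨m, hm, e⟩ | h)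
    · exact hD b (hPL hbP) (f (m+1)) (by rw [e]; exact hET m hm.1)
    · exact h.2 hbP

theorem rtg_path {R : V → V → Prop} {a b : V} (h : Relation.ReflTransGen R a b) :
    ∃ l, IsP R l ∧ l.head? = some a ∧ l.getLast? = some b := by
  induction h with
  | refl => exact ⟨[a], ⟨by simp, by simp, by simp⟩, rfl, rfl⟩
  | @tail b c h1 h2 ih =>
    obtain ⟨l, hl, h3, h4⟩ := ih
    by_cases hc : c ∈ l
    · obtain ⟨s, t, rfl⟩ := List.append_of_mem hc
      refine ⟨s ++ [c], ?_, by rw [← h3]; exact head?_split _ _ _ _, by simp⟩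
      have : IsP R ((s ++ [c]) ++ t) := by simpa using hl
      exact this.prefix (by simp)
    · obtain ⟨s, rfl⟩ := last_form h4
      refine ⟨s ++ [b] ++ [c], ⟨by simp, ?_, ?_⟩, ?_, by simp⟩
      · rw [List.nodup_append]
        refine ⟨hl.2.1, by simp, ?_⟩
        rintro x hx y hy rfl
        simp at hy; subst hy; exact hc hx
      · rw [List.isChain_append]
        exact ⟨hl.2.2, by simp, by simpa using h2⟩
      · rw [← h3]; simp

def LocFin (β : V → V) : Prop := ∀ v, ∃ F : Set V, F.Finite ∧ v ∈ F ∧ ∀ u ∈ F, β u ∈ F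

theorem LocFin.periodic {β : V → V} (hi : Function.Injective β) (h : LocFin β) (v : V) :
    ∃ n, β^[n+1] v = v := by
  obtain ⟨F, hF, hv, hc⟩ := h v
  have hm : ∀ n, β^[n] v ∈ F := by
    intro n
    induction n with
    | zero => exact hv
    | succ n ih => rw [Function.iterate_succ_apply']; exact hc _ ih
  have key : ∀ a b, a < b → β^[a] v = β^[b] v → ∃ n, β^[n+1] v = v := by
    intro a b hab e
    obtain ⟨k, rfl⟩ := Nat.exists_eq_add_of_lt hab
    refine ⟨k, (hi.iterate a ?_).symm⟩
    rw [e, ← Function.iterate_add_apply]; congr 1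
  obtain ⟨a, -, b, -, hab, e⟩ := infinite_univ.exists_ne_map_eq_of_mapsTo
    (f := fun n => β^[n] v) (fun n _ => hm n) hF
  rcases Nat.lt_or_gt_of_ne hab with h | h
  · exact key a b h e
  · exact key b a h e.symm

structure St (E : V → V → Prop) (A : Set V) (β : Equiv.Perm V) (I J : Set V) : Prop where
  fin : LocFin β
  edge : ∀ v, v ∉ I → β v = v ∨ E (β v) v
  out : ∀ v, v ∉ A → β v = v
  img : ∀ v, v ∈ I ↔ β v ∈ J

theorem St.move [DecidableEq V] {A I J : Set V} {β : Equiv.Perm V} {y y' : V}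
    (h : St E A β (insert y I) J) (hy : y ∉ I) (hy' : y' ∉ I) (hyA : y ∈ A) (hyA' : y' ∈ A) (hne : y ≠ y')
    (he : β y' = y ∨ E (β y') y) : St E A (β * Equiv.swap y y') (insert y' I) J := by
  refine ⟨?_, ?_, ?_, ?_⟩
  · intro v
    obtain ⟨F1, a1, a2, a3⟩ := h.fin v
    obtain ⟨F2, b1, b2, b3⟩ := h.fin y
    obtain ⟨F3, c1, c2, c3⟩ := h.fin y'
    have hcl : ∀ u ∈ F1 ∪ F2 ∪ F3, β u ∈ F1 ∪ F2 ∪ F3 := by grind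
    refine ⟨F1 ∪ F2 ∪ F3, (a1.union b1).union c1, Or.inl (Or.inl a2), fun u hu => ?_⟩
    apply hcl
    by_cases e : u = y
    · grind
    · grind
  · intro v hv
    rw [mem_insert_iff, not_or] at hv
    rw [Equiv.Perm.mul_apply]
    by_cases e : v = y
    · grind
    · rw [Equiv.swap_apply_of_ne_of_ne e hv.1]
      exact h.edge v (by simp [e, hv.2])
  · intro v hv
    rw [Equiv.Perm.mul_apply, Equiv.swap_apply_of_ne_of_ne (a := y) (b := y') (x := v) (by rintro rfl; exact hv hyA) (by rintro rfl; exact hv hyA')]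
    exact h.out v hv
  · intro v
    rw [Equiv.Perm.mul_apply]
    by_cases e : v = y
    · subst e; rw [Equiv.swap_apply_left, ← h.img]; simp [hne, hne.symm, hy, hy']
    · by_cases e' : v = y'
      · subst e'; rw [Equiv.swap_apply_right, ← h.img]; simp
      · rw [Equiv.swap_apply_of_ne_of_ne e e', ← h.img]; simp [e, e']

def itl (σ : V → V) : ℕ → V → List V
  | 0, v => [v]
  | n + 1, v => v :: itl σ n (σ v)

theorem mem_itl {σ : V → V} {n : ℕ} {v u : V} : u ∈ itl σ n v ↔ ∃ k ≤ n, u = σ^[k] v := by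
  induction n generalizing v with
  | zero => simp [itl]
  | succ n ih =>
    rw [itl, List.mem_cons, ih]
    constructor
    · rintro (rfl | ⟨k, hk, rfl⟩)
      · exact ⟨0, by omega, rfl⟩
      · exact ⟨k+1, by omega, rfl⟩
    · rintro ⟨k, hk, rfl⟩
      cases k with
      | zero => exact Or.inl rfl
      | succ k => exact Or.inr ⟨k, by omega, rfl⟩

theorem itl_head (σ : V → V) (n : ℕ) (v : V) : (itl σ n v).head? = some v := by
  cases n <;> rfl
theorem itl_last (σ : V → V) (n : ℕ) (v : V) : (itl σ n v).getLast? = some (σ^[n] v) := by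
  induction n generalizing v with
  | zero => rfl
  | succ n ih =>
    have h := ih (σ v)
    obtain ⟨s, hs⟩ := last_form h
    rw [itl, hs, ← List.cons_append, List.getLast?_append_cons]; rfl

theorem itl_isP {σ : V → V} {n : ℕ} {v : V}
    (h1 : ∀ a b, a < b → b ≤ n → σ^[a] v ≠ σ^[b] v) (h2 : ∀ a < n, E (σ^[a] v) (σ^[a+1] v)) :
    IsP E (itl σ n v) := by
  refine ⟨by cases n <;> simp [itl], ?_, ?_⟩
  · induction n generalizing v with
    | zero => simp [itl]
    | succ n ih =>
      rw [itl, List.nodup_cons]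
      refine ⟨?_, ih (fun a b h h' => h1 (a+1) (b+1) (by omega) (by omega)) (fun a h => h2 (a+1) (by omega))⟩
      rw [mem_itl]
      rintro ⟨k, hk, e⟩
      exact h1 0 (k+1) (by omega) (by omega) e
  · induction n generalizing v with
    | zero => simp [itl]
    | succ n ih =>
      have := ih (v := σ v) (fun a b h h' => h1 (a+1) (b+1) (by omega) (by omega)) (fun a h => h2 (a+1) (by omega))
      obtain ⟨s, hs⟩ := head_form (itl_head σ n (σ v))
      rw [itl, hs]; rw [hs] at this
      exact List.isChain_cons_cons.2 ⟨h2 0 (by omega), this⟩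

theorem St.extract {A I J : Set V} {β : Equiv.Perm V}
    (h : St E A β I J) (hI : I ⊆ A) : ∃ P, Sys E P ∧ Hd P = I ∧ Lst P = J ∧ Vs P ⊆ A := by
  classical
  obtain ⟨σ, hσ⟩ : ∃ σ : V → V, σ = β.symm := ⟨_, rfl⟩
  have hσi : Function.Injective σ := by rw [hσ]; exact β.symm.injective
  have σβ : ∀ v, σ (β v) = v := by intro v; rw [hσ]; simp
  have βσ : ∀ v, β (σ v) = v := by intro v; rw [hσ]; simp
  have itσ : ∀ n v, σ^[n] (β^[n] v) = v := fun n v => Function.LeftInverse.iterate σβ n v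
  have itβ : ∀ n v, β^[n] (σ^[n] v) = v := fun n v => Function.LeftInverse.iterate βσ n v
  have hit : ∀ i, i ∈ I → ∃ n, σ^[n] i ∈ J := by
    intro i hi
    obtain ⟨n, hn⟩ := h.fin.periodic β.injective i
    refine ⟨n, ?_⟩
    have : σ^[n] i = β i := by
      have e := itσ n (β i)
      rw [← Function.iterate_succ_apply, hn] at e; exact e
    rw [this]; exact (h.img i).1 hi
  choose! N0 hN0 using hit
  let N : V → ℕ := fun i => if hi : ∃ n, σ^[n] i ∈ J then Nat.find hi else 0
  have hN : ∀ i ∈ I, σ^[N i] i ∈ J := by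
    intro i hi
    have hx : ∃ n, σ^[n] i ∈ J := ⟨_, hN0 i hi⟩
    simp only [N, dif_pos hx]; exact Nat.find_spec hx
  have hNm : ∀ i ∈ I, ∀ n < N i, σ^[n] i ∉ J := by
    intro i hi n hn
    have hx : ∃ n, σ^[n] i ∈ J := ⟨_, hN0 i hi⟩
    simp only [N, dif_pos hx] at hn; exact Nat.find_min hx hn
  have land : ∀ i ∈ I, ∀ n, n < N i → σ^[n+1] i ∉ I := by
    intro i hi n hn hc
    rw [h.img, Function.iterate_succ_apply', βσ] at hc
    exact hNm i hi n hn hc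
  have hdis : ∀ i ∈ I, ∀ j ∈ I, ∀ a b, a ≤ b → b ≤ N j → σ^[a] i = σ^[b] j → a = b ∧ i = j := by
    intro i hi j hj a b hab hb e
    obtain ⟨k, rfl⟩ := Nat.exists_eq_add_of_le hab
    rw [Function.iterate_add_apply] at e
    have e := hσi.iterate a e
    cases k with
    | zero => exact ⟨rfl, e⟩
    | succ k => exact (land j hj k (by omega) (e ▸ hi)).elim
  refine ⟨{l | ∃ i ∈ I, l = itl σ (N i) i}, ⟨?_, ?_⟩, ?_, ?_, ?_⟩
  · rintro l ⟨i, hi, rfl⟩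
    refine itl_isP ?_ ?_
    · grind
    · intro a ha
      have := h.edge _ (land i hi a ha)
      rw [Function.iterate_succ_apply', βσ] at this
      rw [Function.iterate_succ_apply']
      rcases this with e | e
      · exfalso
        rw [← Function.iterate_succ_apply' σ] at e
        have := hdis i hi i hi a (a+1) (by omega) (by omega) e; omega
      · exact e
  · rintro l ⟨i, hi, rfl⟩ m ⟨j, hj, rfl⟩ v hv hw
    obtain ⟨a, ha, rfl⟩ := mem_itl.1 hv
    obtain ⟨b, hb, e⟩ := mem_itl.1 hw
    rcases Nat.le_total a b with hab | hab
    · rw [(hdis i hi j hj a b hab hb e).2]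
    · rw [(hdis j hj i hi b a hab ha e.symm).2]
  · ext v; constructor
    · rintro ⟨l, ⟨i, hi, rfl⟩, hv⟩; rw [itl_head] at hv; cases hv; exact hi
    · intro hv; exact ⟨_, ⟨v, hv, rfl⟩, itl_head _ _ _⟩
  · ext v; constructor
    · rintro ⟨l, ⟨i, hi, rfl⟩, hv⟩; rw [itl_last] at hv; cases hv; exact hN i hi
    · intro hv
      have hx : ∃ k, β^[k] v ∈ I := by
        obtain ⟨n, hn⟩ := h.fin.periodic β.injective v
        refine ⟨n, ?_⟩
        rw [h.img, ← Function.iterate_succ_apply' β, hn]; exact hv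
      obtain ⟨k, hk, hmin⟩ : ∃ k, β^[k] v ∈ I ∧ ∀ m < k, β^[m] v ∉ I :=
        ⟨Nat.find hx, Nat.find_spec hx, fun m hm => Nat.find_min hx hm⟩
      have hkN : N (β^[k] v) = k := by
        have h1 : σ^[k] (β^[k] v) ∈ J := by rw [itσ]; exact hv
        apply le_antisymm
        · grind
        · by_contra hc
          push Not at hc
          obtain ⟨m, hm⟩ := Nat.exists_eq_add_of_lt hc
          have h2 := hN _ hk
          obtain ⟨i, hi⟩ : ∃ i, β i = σ^[N (β^[k] v)] (β^[k] v) := ⟨_, βσ _⟩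
          rw [← hi, ← h.img] at h2
          have : i = β^[m] v := by
            apply β.injective
            rw [hi, ← Function.iterate_succ_apply' β]
            generalize N (β^[k] v) = n at hm
            rw [hm, show n + m + 1 = n + (m + 1) by omega, Function.iterate_add_apply, itσ]
          rw [this] at h2
          exact hmin m (by omega) h2
      refine ⟨_, ⟨_, hk, rfl⟩, ?_⟩
      rw [itl_last, hkN, itσ]
  · rintro v ⟨l, ⟨i, hi, rfl⟩, hv⟩
    obtain ⟨k, hk, rfl⟩ := mem_itl.1 hv
    clear hv hk
    induction k with
    | zero => exact hI hi
    | succ k ih =>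
      by_contra hc
      have := h.out _ hc
      rw [Function.iterate_succ_apply', βσ] at this
      rw [Function.iterate_succ_apply', ← this] at hc
      exact hc ih

def bd (E : V → V → Prop) (X U : Set V) : Set V := {v | v ∈ X ∧ v ∉ U ∧ ∃ u ∈ U, E v u}

structure Wave (E : V → V → Prop) (X S T U : Set V) (W : Set (List V)) : Prop where
  sub : U ⊆ X
  dis : ∀ v ∈ U, v ∉ S
  sys : Sys E W
  hd : Hd W = bd E X U
  tl : ∀ v s, v :: s ∈ W → ∀ x ∈ s, x ∈ U
  lst : Lst W ⊆ T

theorem sys_perm (hP : Sys E P) :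
    ∃ σ : Equiv.Perm V, (∀ s v w t, s ++ v :: w :: t ∈ P → σ v = w) ∧
      (∀ l ∈ P, ∀ h e, l.head? = some h → l.getLast? = some e → σ e = h) ∧
      (∀ v, v ∉ Vs P → σ v = v) ∧ LocFin σ.symm := by
  classical
  have hch : ∀ v, ∃ l : List V, (v ∈ Vs P → l ∈ P ∧ v ∈ l) ∧ (v ∉ Vs P → l = []) := by
    intro v
    by_cases h : v ∈ Vs P
    · grind
    · exact ⟨[], fun h' => (h h').elim, fun _ => rfl⟩
  choose c hc1 hc2 using hch
  have hcl : ∀ l ∈ P, ∀ v ∈ l, c v = l := by grind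
  have hmem : ∀ l ∈ P, ∀ v ∈ l, l.formPerm.symm v ∈ l := by
    intro l hl v hv
    have : l.formPerm (l.formPerm.symm v) ∈ l := by simpa using hv
    exact List.mem_of_formPerm_apply_mem this
  have f1 : ∀ v, c ((c v).formPerm v) = c v := by
    intro v
    by_cases h : v ∈ Vs P
    · exact hcl _ (hc1 v h).1 _ (List.formPerm_apply_mem_of_mem (hc1 v h).2)
    · simp [hc2 v h]
  have f2 : ∀ v, c ((c v).formPerm.symm v) = c v := by
    intro v
    by_cases h : v ∈ Vs P
    · grind
    · rw [hc2 v h, List.formPerm_nil]; change c v = []; exact hc2 v h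
  refine ⟨⟨fun v => (c v).formPerm v, fun v => (c v).formPerm.symm v, ?_, ?_⟩, ?_, ?_, ?_, ?_⟩
  · intro v; simp [f1]
  · grind
  · intro s v w t h
    change (c v).formPerm v = w
    rw [hcl _ h v (by simp)]
    have := List.formPerm_apply_lt_getElem _ (hP.1 _ h).2.1 s.length (by simp)
    simpa using this
  · intro l hl h e h1 h2
    change (c e).formPerm e = h
    rw [hcl _ hl e (List.mem_of_getLast? h2)]
    obtain ⟨t, rfl⟩ := head_form h1
    have := List.formPerm_apply_getLast h t
    rw [List.getLast?_eq_some_getLast (by simp)] at h2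
    rw [← Option.some.inj h2]; exact this
  · intro v hv
    change (c v).formPerm v = v
    simp [hc2 v hv]
  · intro v
    refine ⟨insert v {u | u ∈ c v}, (List.finite_toSet (c v)).insert v, by simp, ?_⟩
    change ∀ u ∈ _, (c u).formPerm.symm u ∈ _
    rintro u (rfl | hu)
    · by_cases h : u ∈ Vs P
      · grind
      · rw [hc2 u h]; left; rfl
    · right
      by_cases h : v ∈ Vs P
      · grind
      · grind

theorem mem_cases {l : List V} {v : V} (h : v ∈ l) :
    l.head? = some v ∨ ∃ s u t, l = s ++ u :: v :: t := by
  obtain ⟨s, t, rfl⟩ := List.append_of_mem h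
  rcases List.eq_nil_or_concat s with rfl | ⟨s, u, rfl⟩
  · left; rfl
  · grind

theorem moves [DecidableEq V] {A I J : Set V} {β0 : Equiv.Perm V} (l : List V) :
    ∀ (y : V) (β : Equiv.Perm V), (y :: l).Nodup → y ∈ A → y ∉ I →
    (y :: l).IsChain (fun y y' => y' ∉ I ∧ y' ∈ A ∧ (β0 y' = y ∨ E (β0 y') y)) →
    (∀ v ∈ l, β v = β0 v) → St E A β (insert y I) J →
    ∀ z, (y :: l).getLast? = some z → ∃ β', St E A β' (insert z I) J := by
  induction l with
  | nil => intro y β _ _ _ _ _ h z hz; simp at hz; subst hz; exact ⟨β, h⟩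
  | cons y' l ih =>
    intro y β hn hyA hyI hc hb h z hz
    rw [List.isChain_cons_cons] at hc
    obtain ⟨⟨h1, h2, h3⟩, h4⟩ := hc
    rw [List.nodup_cons] at hn
    have hne : y ≠ y' := fun e => hn.1 (by simp [e])
    rw [← hb y' (by simp)] at h3
    refine ih y' _ hn.2 h2 h1 h4 ?_ (h.move hyI h1 hyA h2 hne h3) z (by simpa using hz)
    intro v hv
    have hv1 : v ≠ y := by grind
    have hv2 : v ≠ y' := by grind
    rw [Equiv.Perm.mul_apply, Equiv.swap_apply_of_ne_of_ne hv1 hv2]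
    exact hb v (by simp [hv])

theorem aug {T A S : Set V} {t : V}
    (hP : Sys E P) (hA : Vs P ⊆ A) (hT : Lst P ⊆ T) (ht : t ∈ A)
    (htP : t ∉ Vs P) :
    (∃ P' s, Sys E P' ∧ Vs P' ⊆ A ∧ s ∈ S ∧ s ∉ Hd P ∧ Hd P' = insert s (Hd P) ∧
      Lst P' = insert t (Lst P)) ∨
    ∃ U W, Wave E A S T U W ∧ t ∈ U ∧ t ∉ Vs W ∧ Vs W ⊆ Vs P := by
  classical
  obtain ⟨σ, s1, s2, s3, s4⟩ := sys_perm hP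
  let β := σ.symm
  have βσ : ∀ v, β (σ v) = v := fun v => by simp [β]
  have σβ : ∀ v, σ (β v) = v := fun v => by simp [β]
  have hout : ∀ v, v ∉ Vs P → β v = v := fun v hv => by
    have := s3 v hv; rw [← this, βσ, this]
  have htH : t ∉ Hd P := fun h => htP (Hd_sub_Vs _ h)
  have hst : St E A β (insert t (Hd P)) (insert t (Lst P)) := by
    refine ⟨s4, ?_, fun v hv => hout v (fun h => hv (hA h)), ?_⟩
    · intro v hv
      by_cases h : v ∈ Vs P
      · obtain ⟨l, hl, hvl⟩ := h
        rcases mem_cases hvl with h | ⟨s, u, t', rfl⟩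
        · grind
        · right
          rw [← s1 _ _ _ _ hl, βσ, s1 _ _ _ _ hl]
          have := (hP.1 _ hl).2.2
          rw [List.isChain_append, List.isChain_cons_cons] at this
          exact this.2.1.1
      · exact Or.inl (hout v h)
    · intro v
      constructor
      · rintro (rfl | ⟨l, hl, h⟩)
        · left; exact hout _ htP
        · right
          obtain ⟨e, he⟩ := exists_last (hP.1 l hl).1
          rw [← s2 l hl v e h he, βσ]; exact ⟨l, hl, he⟩
      · rintro (h | ⟨l, hl, h⟩)
        · grind
        · right
          obtain ⟨e, he⟩ := exists_head (hP.1 l hl).1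
          rw [← σβ v, s2 l hl e _ he h]; exact ⟨l, hl, he⟩
  let R : V → V → Prop := fun y y' => y' ∉ Hd P ∧ y' ∈ A ∧ (β y' = y ∨ E (β y') y)
  by_cases hr : ∃ s ∈ S, Relation.ReflTransGen R t s
  · left
    obtain ⟨s, hs, hr⟩ := hr
    have hsH : s ∉ Hd P ∧ s ∈ A := by grind
    obtain ⟨l, hl, h1, h2⟩ := rtg_path hr
    obtain ⟨m, rfl⟩ := head_form h1
    obtain ⟨β', hβ⟩ := moves (β0 := β) m t β hl.2.1 ht htH hl.2.2 (fun _ _ => rfl) hst s h2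
    obtain ⟨P', a, b, c, d⟩ := hβ.extract (by
      rintro v (rfl | h); exacts [hsH.2, hA (Hd_sub_Vs _ h)])
    exact ⟨P', s, a, d, hs, hsH.1, b, c⟩
  · right
    push Not at hr
    let U : Set V := {v | Relation.ReflTransGen R t v}
    have hUA : U ⊆ A := by grind
    have hfw : ∀ s v w t', s ++ v :: w :: t' ∈ P → (v ∈ U ∨ ∃ u ∈ U, E v u) → w ∈ U := by
      intro s v w t' hl hv
      have hw : w ∉ Hd P := by
        rintro ⟨m, hm, hw⟩
        have := hP.2 _ hl _ hm w (by simp) (List.mem_of_head? hw)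
        subst this
        have hn := nd_split (hP.1 _ hl).2.1
        cases s with
        | nil => simp at hw; subst hw; exact hn.2.2.2.1 (by simp)
        | cons a s => simp at hw; subst hw; exact hn.2.2.2.2 a (by simp) (by simp)
      have hwA : w ∈ A := hA ⟨_, hl, by simp⟩
      have hb : β w = v := by grind
      rcases hv with hv | ⟨u, hu, hv⟩
      · grind
      · grind
    have htail : ∀ t' s v, s ++ v :: t' ∈ P → (v ∈ U ∨ ∃ u ∈ U, E v u) → ∀ x ∈ t', x ∈ U := by
      intro t'
      induction t' with
      | nil => simp
      | cons w t' ih =>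
        intro s v hl hv x hx
        have hw := hfw s v w t' hl hv
        rcases List.mem_cons.1 hx with rfl | hx
        · exact hw
        · exact ih (s ++ [v]) w (by simpa using hl) (Or.inl hw) x hx
    refine ⟨U, {l | ∃ s v t', s ++ v :: t' ∈ P ∧ v ∈ bd E A U ∧ l = v :: t'}, ⟨hUA, ?_, ⟨?_, ?_⟩, ?_, ?_, ?_⟩,
      Relation.ReflTransGen.refl, ?_, ?_⟩
    · intro v hv hvS; exact hr v hvS hv
    · rintro l ⟨s, v, t', hl, -, rfl⟩; exact (hP.1 _ hl).suffix (by simp)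
    · rintro l ⟨s, v, t', hl, hv, rfl⟩ m ⟨s', v', t'', hm, hv', rfl⟩ x hx hx'
      have e := hP.2 _ hl _ hm x (by simp at hx ⊢; tauto) (by simp at hx' ⊢; tauto)
      obtain ⟨-, e1, e2⟩ := split_last (X := Uᶜ) e hv.2.1 hv'.2.1
        (fun u hu h => h (htail _ _ _ hl (Or.inr hv.2.2) u hu))
        (fun u hu h => h (htail _ _ _ hm (Or.inr hv'.2.2) u hu))
      rw [e1, e2]
    · ext v; constructor
      · rintro ⟨l, ⟨s, v', t', hl, hv, rfl⟩, h⟩; simp at h; subst h; exact hv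
      · intro hv
        have hvP : v ∈ Vs P := by
          by_contra h
          obtain ⟨u, hu, huv⟩ := hv.2.2
          exact hv.2.1 (Relation.ReflTransGen.tail hu
            ⟨fun h' => h (Hd_sub_Vs _ h'), hv.1, Or.inr (by rw [hout v h]; exact huv)⟩)
        obtain ⟨l, hl, hvl⟩ := hvP
        obtain ⟨s, t', rfl⟩ := List.append_of_mem hvl
        exact ⟨v :: t', ⟨s, v, t', hl, hv, rfl⟩, rfl⟩
    · rintro v s ⟨s', v', t', hl, hv, e⟩
      cases e
      exact htail _ _ _ hl (Or.inr hv.2.2)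
    · rintro v ⟨l, ⟨s, v', t', hl, hv, rfl⟩, h⟩
      exact hT ⟨_, hl, by rw [← h]; exact last?_split s [] t' v'⟩
    · rintro ⟨l, ⟨s, v', t', hl, hv, rfl⟩, h⟩; exact htP ⟨_, hl, by simp at h ⊢; tauto⟩
    · rintro x ⟨l, ⟨s, v', t', hl, hv, rfl⟩, h⟩; exact ⟨_, hl, by simp at h ⊢; tauto⟩

section
variable {X S T : Set V}

def Loose (E : V → V → Prop) (X S T : Set V) : Prop := ∀ U W, Wave E X S T U W → U = ∅
def Col (E : V → V → Prop) (A S F : Set V) : Prop :=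
  ∃ P, Sys E P ∧ Vs P ⊆ A ∧ Hd P ⊆ S ∧ Lst P = F
def Near (E : V → V → Prop) (S T R : Set V) : Prop := ∃ H : Set V, H.Finite ∧ Col E R S ((T ∩ R) \ H)

theorem aug_many (hD : IsDimaze E T) (hL : Loose E X S T) (H : Finset V) :
    ∀ P, Sys E P → Vs P ⊆ X → Lst P ⊆ T → (∀ t ∈ H, t ∈ T ∧ t ∈ X ∧ t ∉ Lst P) →
    ∃ (P' : Set (List V)) (G : Finset V), Sys E P' ∧ Vs P' ⊆ X ∧ Lst P' = Lst P ∪ ↑H ∧ Hd P' = Hd P ∪ ↑G ∧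
      G.card = H.card ∧ ∀ s ∈ G, s ∈ S ∧ s ∉ Hd P := by
  classical
  induction H using Finset.induction_on with
  | empty => intro P h1 h2 h3 _; exact ⟨P, ∅, h1, h2, by simp, by simp, rfl, by simp⟩
  | insert t H ht ih =>
    intro P h1 h2 h3 h4
    obtain ⟨P', G, a, b, c, d, e, f⟩ := ih P h1 h2 h3 (fun t ht => h4 t (by simp [ht]))
    have htT := h4 t (by simp)
    have hl : Lst P' ⊆ T := by grind
    have htL : t ∉ Lst P' := by grind
    rcases aug (S := S) a b hl htT.2.1 (by
      rintro ⟨l, hl, htl⟩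
      exact htL ⟨l, hl, exit_last hD (a.1 l hl) htT.1 htl⟩) with ⟨Q, s, q1, q2, q3, q4, q5, q6⟩ | ⟨U, W, hW, ht', -⟩
    · refine ⟨Q, insert s G, q1, q2, ?_, ?_, ?_, ?_⟩
      · grind
      · rw [q5, d]; ext v; simp
      · grind
      · grind
    · rw [hL U W hW] at ht'; exact ht'.elim

theorem col_loose (hD : IsDimaze E T) (hL : Loose E X S T) {F H : Set V} (hF : F ⊆ T) (hH : H.Finite)
    (hHT : H ⊆ T ∩ X) (hC : Col E X S F) : Col E X S (F ∪ H) := by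
  classical
  obtain ⟨P, h1, h2, h3, h4⟩ := hC
  obtain ⟨Q, G, a, b, c, d, -, f⟩ := aug_many hD hL (hH.subset (sdiff_subset (t := F))).toFinset P h1 h2 (h4 ▸ hF)
    (by intro t ht; simp at ht; rw [h4]; exact ⟨(hHT ht.1).1, (hHT ht.1).2, ht.2⟩)
  refine ⟨Q, a, b, ?_, by rw [c, h4]; simp⟩
  rw [d]; rintro v (hv | hv)
  exacts [h3 hv, (f v (by simpa using hv)).1]

theorem loose_sub (hL : Loose E X S T) {R K : Set V} (hR : R ⊆ X) (hK : K ⊆ X) (hb : bd E X R ⊆ K) :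
    Loose E (R ∪ K) (S ∪ K) T := by
  intro U W hW
  have hUR : U ⊆ R := fun v hv => (hW.sub hv).resolve_right (fun h => hW.dis v hv (Or.inr h))
  refine hL U W ⟨hUR.trans hR, fun v hv h => hW.dis v hv (Or.inl h), hW.sys, ?_, hW.tl, hW.lst⟩
  rw [hW.hd]; ext v; constructor
  · rintro ⟨h1, h2, h3⟩; exact ⟨union_subset hR hK h1, h2, h3⟩
  · rintro ⟨h1, h2, u, h3, h4⟩
    refine ⟨?_, h2, u, h3, h4⟩
    by_cases h : v ∈ R
    · exact Or.inl h
    · exact Or.inr (hb ⟨h1, h, u, hUR h3, h4⟩)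

theorem Col.mono {A A' S' F : Set V} (h : Col E A S F) (hA : A ⊆ A') (hS : S ⊆ S') :
    Col E A' S' F := by
  obtain ⟨P, a, b, c, d⟩ := h; exact ⟨P, a, b.trans hA, c.trans hS, d⟩

theorem fix (hD : IsDimaze E T) (hL : Loose E X S T) {R K : Set V} (hR : R ⊆ X) (hK : K ⊆ X)
    (hb : bd E X R ⊆ K) (hN : Near E S T R) : Col E (R ∪ K) (S ∪ K) (T ∩ R) := by
  obtain ⟨H, hH, hC⟩ := hN
  have := col_loose hD (loose_sub hL hR hK hb) (F := (T ∩ R) \ H) (H := H ∩ (T ∩ R)) (fun v h => h.1.1)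
    (hH.subset inter_subset_left) (fun v h => ⟨h.2.1, Or.inl h.2.2⟩)
    (hC.mono subset_union_left subset_union_left)
  convert this using 1
  ext v; simp; tauto

theorem fix0 (hD : IsDimaze E T) (hL : Loose E X S T) {R : Set V} (hR : R ⊆ X)
    (hb : bd E X R = ∅) (hN : Near E S T R) : Col E R S (T ∩ R) := by
  have := fix hD hL hR (K := ∅) (by simp) (by simp [hb]) hN
  simpa using this

theorem drop (hD : IsDimaze E T) (hL : Loose E X S T) {R : Set V} {y : V} (hR : R ⊆ X)
    (hy : y ∉ R) (hb : bd E X R ⊆ {y}) (hN : Near E S T R) : Col E R S (T ∩ R) := by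
  by_cases hyX : y ∈ X
  swap
  · refine fix0 hD hL hR ?_ hN
    ext v; simp only [mem_empty_iff_false, iff_false]
    intro hv; have := hb hv; rw [mem_singleton_iff] at this; subst this; exact hyX hv.1
  obtain ⟨P, p1, p2, p3, p4⟩ := fix hD hL hR (K := {y}) (by simpa using hyX) hb hN
  by_cases hyP : y ∈ Vs P
  swap
  · refine ⟨P, p1, ?_, ?_, p4⟩
    · grind
    · intro v hv; exact (p3 hv).resolve_right (by rintro rfl; exact hyP (Hd_sub_Vs _ hv))
  obtain ⟨l, hl, hyl⟩ := hyP
  obtain ⟨s, t', e⟩ := List.append_of_mem hyl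
  obtain ⟨t, ht⟩ := exists_last (p1.1 l hl).1
  have htT : t ∈ T ∩ R := by grind
  have hoff : ∀ m ∈ P, m ≠ l → ∀ v ∈ m, v ∉ l := fun m hm hne v hv hv' => hne (p1.2 m hm l hl v hv hv')
  have q1 : Sys E (P \ {l}) := p1.sub sdiff_subset
  have q2 : Vs (P \ {l}) ⊆ R := by
    rintro v ⟨m, hm, hv⟩
    refine (p2 ⟨m, hm.1, hv⟩).resolve_right ?_
    rintro rfl; exact hoff m hm.1 hm.2 _ hv hyl
  have q4 : Lst (P \ {l}) = (T ∩ R) \ {t} := by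
    rw [← p4]; ext v; constructor
    · rintro ⟨m, hm, hv⟩
      refine ⟨⟨m, hm.1, hv⟩, ?_⟩
      rintro rfl; exact hm.2 (sys_last_eq p1 hm.1 hl hv ht)
    · grind
  have htl : t ∈ l := List.mem_of_getLast? ht
  rcases aug (T := T) (S := S) (t := t) q1 q2 (by rw [q4]; exact fun v h => h.1.1) htT.2 (by
      rintro ⟨m, hm, hv⟩; exact hoff m hm.1 hm.2 _ hv htl) with ⟨Q, s, r1, r2, r3, r4, r5, r6⟩ | ⟨U, W, hW, h1, h2, h3⟩
  · refine ⟨Q, r1, r2, ?_, ?_⟩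
    · rw [r5]; rintro v (rfl | ⟨m, hm, hv⟩)
      · exact r3
      · exact (p3 ⟨m, hm.1, hv⟩).resolve_right (by
          rintro rfl; exact hoff m hm.1 hm.2 _ (List.mem_of_head? hv) hyl)
    · grind
  · exfalso
    have hyU : y ∉ U := fun h => hy (hW.sub h)
    have hlW : ∀ v ∈ l, v ∉ Vs W := by grind
    have htt : (y :: t').getLast? = some t := by grind
    obtain ⟨a, v, b, e1, hv, hb'⟩ := last_hit (l := y :: t') (X := Uᶜ) ⟨y, by simp, hyU⟩
    have hvl : v ∈ l := by rw [e, e1]; simp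
    obtain ⟨w, c, rfl⟩ : ∃ w c, b = w :: c := by
      cases b with
      | nil =>
        rw [e1] at htt; simp at htt; subst htt; exact (hv h1).elim
      | cons w c => exact ⟨w, c, rfl⟩
    have hch : IsP E (s ++ (a ++ v :: w :: c)) := by grind
    have hvw : E v w := by
      have := (hch.suffix (by simp)).2.2
      rw [List.isChain_append, List.isChain_cons_cons] at this
      exact this.2.1.1
    have hwU : w ∈ U := not_not.1 (hb' w (by simp))
    have hva : v = y := by
      refine ((p2 ⟨l, hl, hvl⟩).resolve_left fun h => hlW v hvl (Hd_sub_Vs _ ?_))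
      rw [hW.hd]; exact ⟨h, hv, w, hwU, hvw⟩
    subst hva
    have hlt : v :: w :: c = v :: t' := by
      have hn := (p1.1 l hl).2.1
      rw [e] at hn
      have := (split_uniq (s := []) (s' := a) (show [] ++ v :: t' = a ++ v :: w :: c from e1)
        (nd_split hn |>.2.1 |> fun h => by simp [h, (nd_split hn).2.2.2.1])).2
      rw [this]
    have hsuf : IsP E (v :: w :: c) := by
      rw [hlt]; exact (e ▸ p1.1 l hl : IsP E (s ++ v :: t')).suffix (by simp)
    have := hL U (insert (v :: w :: c) W) ⟨hW.sub.trans hR, hW.dis, ⟨?_, ?_⟩, ?_, ?_, ?_⟩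
    · rw [this] at h1; exact h1
    · rintro m (rfl | hm)
      exacts [hsuf, hW.sys.1 m hm]
    · have hmix : ∀ m ∈ W, ∀ x, x ∈ v :: w :: c → x ∉ m := by
        intro m hm x hx hx'
        exact hlW x (by rw [e, ← hlt]; simp at hx ⊢; tauto) ⟨m, hm, hx'⟩
      rintro m (rfl | hm) m' (rfl | hm') x hx hx'
      · rfl
      · grind
      · grind
      · exact hW.sys.2 m hm m' hm' x hx hx'
    · have : Hd (insert (v :: w :: c) W) = insert v (Hd W) := by
        ext x; constructor
        · rintro ⟨m, rfl | hm, hx⟩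
          · simp at hx; left; exact hx.symm
          · grind
        · rintro (rfl | ⟨m, hm, hx⟩)
          · exact ⟨_, Or.inl rfl, rfl⟩
          · grind
      rw [this, hW.hd]; ext x; constructor
      · rintro (rfl | ⟨x1, x2, x3⟩)
        · exact ⟨hyX, hyU, w, hwU, hvw⟩
        · exact ⟨hR x1, x2, x3⟩
      · rintro ⟨x1, x2, u, x3, x4⟩
        by_cases h : x ∈ R
        · exact Or.inr ⟨h, x2, u, x3, x4⟩
        · exact Or.inl (hb ⟨x1, h, u, hW.sub x3, x4⟩)
    · rintro x z (h | h)
      · grind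
      · exact hW.tl x z h
    · rintro x ⟨m, rfl | hm, hx⟩
      · grind
      · exact hW.lst ⟨m, hm, hx⟩

theorem stay {l : List V} {R K : Set V} (hl : l.IsChain E) (hX : ∀ v ∈ l, v ∈ X) (hb : bd E X R ⊆ K)
    {t : V} (ht : l.getLast? = some t) (htR : t ∈ R) (hK : ∀ v ∈ l, v ∉ K) : ∀ v ∈ l, v ∈ R := by
  induction l with
  | nil => simp
  | cons a l ih =>
    cases l with
    | nil => simp at ht; subst ht; simpa using htR
    | cons b l =>
      rw [List.isChain_cons_cons] at hl
      have := ih hl.2 (fun v hv => hX v (by simp [List.mem_cons.1 hv])) (by simpa using ht) (fun v hv => hK v (by simp [List.mem_cons.1 hv]))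
      intro v hv
      rcases List.mem_cons.1 hv with rfl | hv
      · by_contra h
        exact hK v (by simp) (hb ⟨hX v (by simp), h, b, this b (by simp), hl.1⟩)
      · exact this v hv

theorem col_union {𝒞 : Set (Set V)} {f : Set V → Set V} (hd : ∀ a ∈ 𝒞, ∀ b ∈ 𝒞, ∀ v, v ∈ a → v ∈ b → a = b)
    (h : ∀ c ∈ 𝒞, Col E c S (f c)) : Col E (⋃₀ 𝒞) S (⋃ c ∈ 𝒞, f c) := by
  choose! P p1 p2 p3 p4 using h
  refine ⟨{l | ∃ c ∈ 𝒞, l ∈ P c}, ⟨?_, ?_⟩, ?_, ?_, ?_⟩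
  · grind
  · rintro l ⟨c, hc, hl⟩ m ⟨c', hc', hm⟩ v hv hv'
    have := hd c hc c' hc' v (p2 c hc ⟨l, hl, hv⟩) (p2 c' hc' ⟨m, hm, hv'⟩)
    subst this; exact (p1 c hc).2 l hl m hm v hv hv'
  · rintro v ⟨l, ⟨c, hc, hl⟩, hv⟩; exact ⟨c, hc, p2 c hc ⟨l, hl, hv⟩⟩
  · rintro v ⟨l, ⟨c, hc, hl⟩, hv⟩; exact p3 c hc ⟨l, hl, hv⟩
  · ext v; simp only [mem_iUnion]; constructor
    · rintro ⟨l, ⟨c, hc, hl⟩, hv⟩; exact ⟨c, hc, by rw [← p4 c hc]; exact ⟨l, hl, hv⟩⟩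
    · rintro ⟨c, hc, hv⟩; rw [← p4 c hc] at hv; obtain ⟨l, hl, hv⟩ := hv; exact ⟨l, ⟨c, hc, hl⟩, hv⟩

theorem m5 (hD : IsDimaze E T) (hL : Loose E X S T) {𝒞 : Set (Set V)} {K : Set V}
    (hd : ∀ a ∈ 𝒞, ∀ b ∈ 𝒞, ∀ v, v ∈ a → v ∈ b → a = b) (hK : K.Finite) (hKX : K ⊆ X)
    (hsub : ∀ c ∈ 𝒞, c ⊆ X) (hb : ∀ c ∈ 𝒞, bd E X c ⊆ K) (hN : ∀ c ∈ 𝒞, Near E S T c) :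
    Near E S T (⋃₀ 𝒞) := by
  classical
  have near_of : ∀ 𝒟 ⊆ 𝒞, 𝒟.Finite → ∃ H : Set V, H.Finite ∧ ∀ c ∈ 𝒟, Col E c S ((T ∩ c) \ H) := by
    intro 𝒟 h𝒟 hf
    choose! H h1 h2 using hN
    refine ⟨⋃ c ∈ 𝒟, H c, hf.biUnion fun c hc => h1 c (h𝒟 hc), fun c hc => ?_⟩
    obtain ⟨P, a, b, c1, d⟩ := h2 c (h𝒟 hc)
    refine ⟨{l ∈ P | ∃ v, l.getLast? = some v ∧ v ∉ ⋃ c ∈ 𝒟, H c}, a.sub (sep_subset _ _), ?_, ?_, ?_⟩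
    · rintro v ⟨l, hl, hv⟩; exact b ⟨l, hl.1, hv⟩
    · grind
    · ext v; constructor
      · rintro ⟨l, ⟨hl, w, hw, hw'⟩, hv⟩
        have : v = w := Option.some.inj (hv.symm.trans hw)
        subst this
        have : v ∈ Lst P := ⟨l, hl, hv⟩
        rw [d] at this; exact ⟨this.1, hw'⟩
      · rintro ⟨h3, h4⟩
        have : v ∈ Lst P := by
          rw [d]; exact ⟨h3, fun h => h4 (mem_biUnion hc h)⟩
        obtain ⟨l, hl, hv⟩ := this
        exact ⟨l, ⟨hl, v, hv, h4⟩, hv⟩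
  have key : {c ∈ 𝒞 | ¬ Col E c S (T ∩ c)}.Finite := by
    by_contra hinf
    obtain ⟨F, hF, hFc⟩ := Set.Infinite.exists_subset_card_eq hinf (hK.toFinset.card + 1)
    obtain ⟨H, hH, hcol⟩ := near_of F (fun c hc => (hF hc).1) F.finite_toSet
    have hu := col_union (fun a ha b hb => hd a (hF ha).1 b (hF hb).1) hcol
    have hR : ⋃₀ (F : Set (Set V)) ⊆ X := sUnion_subset fun c hc => hsub c (hF hc).1
    obtain ⟨P, p1, p2, p3, p4⟩ := fix hD hL hR hKX (by
      rintro v ⟨v1, v2, u, ⟨c, hc, hu⟩, v3⟩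
      exact hb c (hF hc).1 ⟨v1, fun h => v2 ⟨c, hc, h⟩, u, hu, v3⟩) ⟨H, hH, by
        convert hu using 1
        ext v; simp only [mem_sUnion, mem_sdiff, mem_inter_iff, mem_iUnion]
        constructor
        · grind
        · rintro ⟨c, hc, ⟨a, b⟩, d⟩; exact ⟨⟨a, c, hc, b⟩, d⟩⟩
    have hcr : ∀ c ∈ F, ∃ k ∈ K, ∃ l ∈ P, k ∈ l ∧ ∃ t ∈ c, l.getLast? = some t := by
      intro c hc
      by_contra hno
      push Not at hno
      have hst : ∀ l ∈ P, ∀ t ∈ c, l.getLast? = some t → ∀ v ∈ l, v ∉ K ∧ v ∈ c := by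
        intro l hl t ht hlt v hv
        have hk : ∀ v ∈ l, v ∉ K := fun v hv hvK => hno v hvK l hl hv t ht hlt
        exact ⟨hk v hv, stay (p1.1 l hl).2.2 (fun v hv => union_subset hR hKX (p2 ⟨l, hl, hv⟩))
          (hb c (hF hc).1) hlt ht hk v hv⟩
      refine (hF hc).2 ⟨{l ∈ P | ∃ t ∈ c, l.getLast? = some t}, p1.sub (sep_subset _ _), ?_, ?_, ?_⟩
      · rintro v ⟨l, ⟨hl, t, ht, hlt⟩, hv⟩; exact (hst l hl t ht hlt v hv).2
      · rintro v ⟨l, ⟨hl, t, ht, hlt⟩, hv⟩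
        exact (p3 ⟨l, hl, hv⟩).resolve_right (hst l hl t ht hlt v (List.mem_of_head? hv)).1
      · ext v; constructor
        · rintro ⟨l, ⟨hl, t, ht, hlt⟩, hv⟩
          have : v = t := Option.some.inj (hv.symm.trans hlt)
          subst this
          have : v ∈ Lst P := ⟨l, hl, hv⟩
          rw [p4] at this; exact ⟨this.1, ht⟩
        · rintro ⟨h1, h2⟩
          have : v ∈ Lst P := by grind
          obtain ⟨l, hl, hv⟩ := this
          exact ⟨l, ⟨hl, v, h2, hv⟩, hv⟩
    have : Nonempty V := by
      obtain ⟨c, hc⟩ := Finset.card_pos.1 (show 0 < F.card by omega)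
      exact ⟨(hcr c hc).choose⟩
    choose! k k1 l l1 l2 t t1 t2 using hcr
    have := Finset.card_le_card_of_injOn k (s := F) (t := hK.toFinset) (fun c hc => by simpa using k1 c hc) (by
      intro c hc c' hc' e
      have hll := p1.2 _ (l1 c hc) _ (l1 c' hc') (k c) (l2 c hc) (e ▸ l2 c' hc')
      have h2 := t2 c hc
      rw [hll, t2 c' hc'] at h2
      exact hd c (hF hc).1 c' (hF hc').1 _ (t1 c hc) (Option.some.inj h2 ▸ t1 c' hc'))
    omega
  obtain ⟨H, hH, hc⟩ := near_of _ (sep_subset _ _) key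
  refine ⟨H ∩ ⋃₀ {c ∈ 𝒞 | ¬ Col E c S (T ∩ c)}, hH.subset inter_subset_left, ?_⟩
  have := col_union (E := E) (S := S) (f := fun c => if Col E c S (T ∩ c) then T ∩ c else (T ∩ c) \ H) hd (by
    intro c hcc
    split_ifs with h
    · exact h
    · exact hc c ⟨hcc, h⟩)
  convert this using 1
  ext v; simp only [mem_sdiff, mem_inter_iff, mem_sUnion, mem_iUnion]
  constructor
  · rintro ⟨⟨h1, c, hc, h2⟩, h3⟩
    refine ⟨c, hc, ?_⟩
    split_ifs with h
    · exact ⟨h1, h2⟩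
    · grind
  · grind
end

section
variable {E : V → V → Prop} {X S T A B C : Set V} {u v w : V}

def Rs (E : V → V → Prop) (A : Set V) (a b : V) : Prop := E a b ∧ a ∈ A ∧ b ∈ A
def Ru (E : V → V → Prop) (A : Set V) (a b : V) : Prop := (E a b ∨ E b a) ∧ a ∈ A ∧ b ∈ A
abbrev Dr (E : V → V → Prop) (A : Set V) : V → V → Prop := Relation.ReflTransGen (Rs E A)
abbrev Cn (E : V → V → Prop) (A : Set V) : V → V → Prop := Relation.ReflTransGen (Ru E A)
def pr (E : V → V → Prop) (T A : Set V) : Set V := {v | v ∈ A ∧ ∃ t ∈ T, t ∈ A ∧ Dr E A v t}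
def cpt (E : V → V → Prop) (A : Set V) (v : V) : Set V := {u | u ∈ A ∧ Cn E A v u}
def Comp (E : V → V → Prop) (A C : Set V) : Prop := ∃ v ∈ A, C = cpt E A v
def Conn (E : V → V → Prop) (A : Set V) : Prop := ∀ u ∈ A, ∀ v ∈ A, Cn E A u v
def Prd (E : V → V → Prop) (T A : Set V) : Prop := A ⊆ pr E T A

theorem Dr.mono (h : Dr E A u v) (hA : A ⊆ B) : Dr E B u v :=
  h.lift id (fun _ _ h => ⟨h.1, hA h.2.1, hA h.2.2⟩)
theorem Cn.mono (h : Cn E A u v) (hA : A ⊆ B) : Cn E B u v :=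
  h.lift id (fun _ _ h => ⟨h.1, hA h.2.1, hA h.2.2⟩)
theorem Cn.symm (h : Cn E A u v) : Cn E A v u := by
  induction h with
  | refl => exact .refl
  | tail _ h ih => exact Relation.ReflTransGen.head ⟨h.1.symm, h.2.2, h.2.1⟩ ih
theorem Dr.cn (h : Dr E A u v) : Cn E A u v :=
  h.lift id (fun _ _ h => ⟨Or.inl h.1, h.2⟩)

theorem pr_sub : pr E T A ⊆ A := fun _ h => h.1
theorem pr_mono (h : A ⊆ B) : pr E T A ⊆ pr E T B := by
  rintro v ⟨h1, t, h2, h3, h4⟩; exact ⟨h h1, t, h2, h h3, Dr.mono h4 h⟩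
theorem pr_T (h : v ∈ T) (h' : v ∈ A) : v ∈ pr E T A := ⟨h', v, h, h', .refl⟩
theorem pr_in (h : v ∈ pr E T A) (hu : u ∈ A) (he : E u v) : u ∈ pr E T A := by
  obtain ⟨h1, t, h2, h3, h4⟩ := h
  exact ⟨hu, t, h2, h3, Relation.ReflTransGen.head ⟨he, hu, h1⟩ h4⟩
theorem pr_prd : Prd E T (pr E T A) := by
  rintro v ⟨h1, t, h2, h3, h4⟩
  have key : v ∈ pr E T A ∧ Dr E (pr E T A) v t := by
    induction h4 using Relation.ReflTransGen.head_induction_on with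
    | refl => exact ⟨pr_T h2 h3, .refl⟩
    | head h _ ih =>
      have ih := ih h.2.2
      have := pr_in ih.1 h.2.1 h.1
      exact ⟨this, Relation.ReflTransGen.head ⟨h.1, this, ih.1⟩ ih.2⟩
  exact ⟨key.1, t, h2, pr_T h2 h3, key.2⟩

theorem self_cpt (h : v ∈ A) : v ∈ cpt E A v := ⟨h, .refl⟩
theorem Comp.sub (h : Comp E A C) : C ⊆ A := by obtain ⟨v, -, rfl⟩ := h; exact fun _ h => h.1
theorem Comp.ne (h : Comp E A C) : C.Nonempty := by
  obtain ⟨v, h, rfl⟩ := h; exact ⟨v, self_cpt h⟩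
theorem comp_cpt (h : v ∈ A) : Comp E A (cpt E A v) := ⟨v, h, rfl⟩
theorem Comp.eq (h : Comp E A C) (hv : v ∈ C) : C = cpt E A v := by
  obtain ⟨w, h, rfl⟩ := h
  ext u; constructor
  · intro hu; exact ⟨hu.1, (Cn.symm hv.2).trans hu.2⟩
  · intro hu; exact ⟨hu.1, hv.2.trans hu.2⟩
theorem Comp.dis (h : Comp E A C) (h' : Comp E A B) (hv : v ∈ C) (hv' : v ∈ B) : C = B := by
  rw [h.eq hv, h'.eq hv']
theorem Comp.adj (h : Comp E A C) (hv : v ∈ C) (hu : u ∈ A) (he : E u v ∨ E v u) : u ∈ C := by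
  have h1 := h.sub hv
  rw [h.eq hv]; exact ⟨hu, .single ⟨he.symm, h1, hu⟩⟩
theorem rtg_closed {R R' : V → V → Prop} (h : Relation.ReflTransGen R u v) (hu : u ∈ C)
    (hc : ∀ a b, a ∈ C → R a b → b ∈ C ∧ R' a b) : v ∈ C ∧ Relation.ReflTransGen R' u v := by
  induction h with
  | refl => exact ⟨hu, .refl⟩
  | tail _ h ih => have := hc _ _ ih.1 h; exact ⟨this.1, ih.2.tail this.2⟩
theorem Comp.conn (h : Comp E A C) : Conn E C := by
  intro u hu v hv
  have : v ∈ cpt E A u := by rw [← h.eq hu]; exact hv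
  exact (rtg_closed (R' := Ru E C) this.2 hu fun a b ha hab =>
    have := h.adj ha hab.2.2 hab.1.symm
    ⟨this, hab.1, ha, this⟩).2
theorem Comp.prd (h : Comp E A C) (hA : Prd E T A) : Prd E T C := by
  intro v hv
  obtain ⟨h1, t, h2, h3, h4⟩ := hA (h.sub hv)
  have := rtg_closed (R' := Rs E C) h4 hv fun a b ha hab =>
    have := h.adj ha hab.2.2 (Or.inr hab.1)
    ⟨this, hab.1, ha, this⟩
  exact ⟨hv, t, h2, this.1, this.2⟩
theorem Conn.sub_cpt (h : Conn E B) (hA : B ⊆ A) (hv : v ∈ B) : B ⊆ cpt E A v :=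
  fun u hu => ⟨hA hu, Cn.mono (h v hv u hu) hA⟩
theorem comp_in {C B : Set V} (hC : Comp E (pr E T B) C) (hu : u ∈ B) (hv : v ∈ C) (he : E u v) : u ∈ C :=
  hC.adj hv (pr_in (hC.sub hv) hu he) (Or.inl he)
theorem Conn.sub_comp (h : Conn E B) (hA : B ⊆ A) (hC : Comp E A C) (hv : v ∈ B) (hv' : v ∈ C) : B ⊆ C := by
  rw [hC.eq hv']; exact h.sub_cpt hA hv

def Ex (E : V → V → Prop) (X S T W : Set V) : Prop :=
  W ⊆ X ∧ (∀ w ∈ W, ∀ v ∈ X, E w v → v ∈ W) ∧ Col E W S (T ∩ W)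
def U2 (E : V → V → Prop) (X S T : Set V) : Set V := ⋃₀ {W | Ex E X S T W}

theorem exit_mem (hD : IsDimaze E T) {P : Set (List V)} (hP : Sys E P) {l : List V} (hl : l ∈ P)
    (hv : v ∈ l) (hT : v ∈ T) : v ∈ Lst P := ⟨l, hl, exit_last hD (hP.1 l hl) hT hv⟩

theorem chain_out {l : List V} (hl : l.IsChain E) {W : Set V} (hX : ∀ v ∈ l, v ∈ X)
    (hW : ∀ w ∈ W, ∀ v ∈ X, E w v → v ∈ W) (hv : v ∈ l) (hvW : v ∈ W) {t : V} (ht : l.getLast? = some t) :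
    t ∈ W := by
  induction l generalizing v with
  | nil => simp at hv
  | cons a l ih =>
    cases l with
    | nil => simp at ht hv; subst ht; subst hv; exact hvW
    | cons b l =>
      rw [List.isChain_cons_cons] at hl
      have hX' : ∀ v ∈ b :: l, v ∈ X := fun v hv => hX v (by simp [List.mem_cons.1 hv])
      rcases List.mem_cons.1 hv with rfl | hv
      · exact ih hl.2 hX' (v := b) (by simp) (hW v hvW b (hX b (by simp)) hl.1) (by simpa using ht)
      · exact ih hl.2 hX' hv hvW (by simpa using ht)

theorem U2_ex : Ex E X S T (U2 E X S T) := by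
  classical
  refine ⟨sUnion_subset fun W hW => hW.1, ?_, ?_⟩
  · rintro w ⟨W, hW, hw⟩ v hv he; exact ⟨W, hW, hW.2.1 w hw v hv he⟩
  let r : Set V → Set V → Prop := WellOrderingRel
  have wf : WellFounded r := IsWellFounded.wf
  let m : V → Set V := fun v => if h : ({W | Ex E X S T W ∧ v ∈ W} : Set (Set V)).Nonempty then wf.min _ h else ∅
  have hm : ∀ v ∈ U2 E X S T, Ex E X S T (m v) ∧ v ∈ m v := by
    rintro v ⟨W, hW, hv⟩
    have h : ({W | Ex E X S T W ∧ v ∈ W} : Set (Set V)).Nonempty := ⟨W, hW, hv⟩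
    simp only [m, dif_pos h]; exact wf.min_mem _ h
  have hm' : ∀ v W, Ex E X S T W → v ∈ W → ¬ r W (m v) := by
    intro v W hW hv
    have h : ({W | Ex E X S T W ∧ v ∈ W} : Set (Set V)).Nonempty := ⟨W, hW, hv⟩
    simp only [m, dif_pos h]; exact wf.not_lt_min _ (show W ∈ {W | Ex E X S T W ∧ v ∈ W} from ⟨hW, hv⟩)
  have hc : ∀ W, Ex E X S T W → ∃ P, Sys E P ∧ Vs P ⊆ W ∧ Hd P ⊆ S ∧ Lst P = T ∩ W := fun W h => h.2.2
  choose! P p1 p2 p3 p4 using hc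
  have key : ∀ W, Ex E X S T W → ∀ l ∈ P W, ∀ t, l.getLast? = some t → m t = W → ∀ v ∈ l, m v = W := by
    intro W hW l hl t ht hmt v hv
    have hvW := p2 W hW ⟨l, hl, hv⟩
    have hmv := hm v ⟨W, hW, hvW⟩
    have htm : t ∈ m v := chain_out ((p1 W hW).1 l hl).2.2 (fun u hu => hW.1 (p2 W hW ⟨l, hl, hu⟩)) hmv.1.2.1 hv hmv.2 ht
    rcases trichotomous_of r (m v) W with h | h | h
    · exact (hm' t _ hmv.1 htm (hmt ▸ h)).elim
    · exact h
    · exact (hm' v _ hW hvW h).elim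
  refine ⟨{l | ∃ W, Ex E X S T W ∧ l ∈ P W ∧ ∃ t, l.getLast? = some t ∧ m t = W}, ⟨?_, ?_⟩, ?_, ?_, ?_⟩
  · rintro l ⟨W, hW, hl, -⟩; exact (p1 W hW).1 l hl
  · rintro l ⟨W, hW, hl, t, h1, h2⟩ l' ⟨W', hW', hl', t', h1', h2'⟩ v hv hv'
    have e1 := key W hW l hl t h1 h2 v hv
    have e2 := key W' hW' l' hl' t' h1' h2' v hv'
    have e : W = W' := e1.symm.trans e2
    subst e; exact (p1 W hW).2 l hl l' hl' v hv hv'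
  · rintro v ⟨l, ⟨W, hW, hl, -⟩, hv⟩; exact ⟨W, hW, p2 W hW ⟨l, hl, hv⟩⟩
  · rintro v ⟨l, ⟨W, hW, hl, -⟩, hv⟩; exact p3 W hW ⟨l, hl, hv⟩
  · ext v; constructor
    · rintro ⟨l, ⟨W, hW, hl, -⟩, hv⟩
      have : v ∈ Lst (P W) := ⟨l, hl, hv⟩
      rw [p4 W hW] at this; exact ⟨this.1, W, hW, this.2⟩
    · rintro ⟨h1, h2⟩
      have := hm v h2
      have h3 : v ∈ Lst (P (m v)) := by rw [p4 _ this.1]; exact ⟨h1, this.2⟩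
      obtain ⟨l, hl, hv⟩ := h3
      exact ⟨l, ⟨_, this.1, hl, v, hv, rfl⟩, hv⟩

theorem col_two {F G : Set V} (hA : Col E A S F) (hB : Col E B S G) (hd : ∀ v ∈ A, v ∉ B) :
    Col E (A ∪ B) S (F ∪ G) := by
  obtain ⟨P, a1, a2, a3, a4⟩ := hA
  obtain ⟨Q, b1, b2, b3, b4⟩ := hB
  refine ⟨P ∪ Q, ⟨?_, ?_⟩, ?_, ?_, ?_⟩
  · rintro l (h | h); exacts [a1.1 l h, b1.1 l h]
  · rintro l (h | h) m (h' | h') v hv hv'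
    · exact a1.2 l h m h' v hv hv'
    · exact (hd v (a2 ⟨l, h, hv⟩) (b2 ⟨m, h', hv'⟩)).elim
    · exact (hd v (a2 ⟨m, h', hv'⟩) (b2 ⟨l, h, hv⟩)).elim
    · exact b1.2 l h m h' v hv hv'
  · rintro v ⟨l, h | h, hv⟩; exacts [Or.inl (a2 ⟨l, h, hv⟩), Or.inr (b2 ⟨l, h, hv⟩)]
  · rintro v ⟨l, h | h, hv⟩; exacts [a3 ⟨l, h, hv⟩, b3 ⟨l, h, hv⟩]
  · rw [← a4, ← b4]; ext v; constructor
    · rintro ⟨l, h | h, hv⟩; exacts [Or.inl ⟨l, h, hv⟩, Or.inr ⟨l, h, hv⟩]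
    · rintro (⟨l, h, hv⟩ | ⟨l, h, hv⟩); exacts [⟨l, Or.inl h, hv⟩, ⟨l, Or.inr h, hv⟩]

theorem U2_max {W : Set V} (hW : W ⊆ X \ U2 E X S T)
    (ho : ∀ w ∈ W, ∀ v ∈ X \ U2 E X S T, E w v → v ∈ W) (hc : Col E W S (T ∩ W)) : W = ∅ := by
  have h := U2_ex (E := E) (X := X) (S := S) (T := T)
  have : Ex E X S T (U2 E X S T ∪ W) := by
    refine ⟨union_subset h.1 (hW.trans sdiff_subset), ?_, ?_⟩
    · rintro w (hw | hw) v hv he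
      · exact Or.inl (h.2.1 w hw v hv he)
      · by_cases hvU : v ∈ U2 E X S T
        exacts [Or.inl hvU, Or.inr (ho w hw v ⟨hv, hvU⟩ he)]
    · rw [inter_union_distrib_left]
      exact col_two h.2.2 hc (fun v hv hv' => (hW hv').2 hv)
  ext v; constructor
  · intro hv; exact ((hW hv).2 ⟨_, this, Or.inr hv⟩).elim
  · exact fun h => h.elim

theorem core {X1 : Set V} (hD : IsDimaze E T) (hL : Loose E X S T) (h1 : X1 ⊆ X)
    (hin : ∀ v ∈ X, ∀ u ∈ X1, E v u → v ∈ X1) {Y : Set V} (hY : Y = X1 \ U2 E X1 S T) :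
    (∀ v ∈ X, ∀ u ∈ Y, E v u → v ∈ Y) ∧ Prd E T Y ∧ (∀ C, Comp E Y C → ¬ Near E S T C) ∧
    ∀ y ∈ Y, y ∉ T → ∃ N, Comp E (pr E T (Y \ {y})) N ∧ ¬ Near E S T N ∧ ∃ n ∈ N, E y n := by
  have hU := U2_ex (E := E) (X := X1) (S := S) (T := T)
  have hYin : ∀ v ∈ X, ∀ u ∈ Y, E v u → v ∈ Y := by
    intro v hv u hu he
    rw [hY] at hu ⊢
    have := hin v hv u hu.1 he
    exact ⟨this, fun h => hu.2 (hU.2.1 v h u hu.1 he)⟩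
  have hYX : Y ⊆ X := by rw [hY]; exact fun v h => h1 h.1
  refine ⟨hYin, ?_, ?_, ?_⟩
  · have := U2_max (E := E) (X := X1) (S := S) (T := T) (W := Y \ pr E T Y) (by rw [← hY]; exact sdiff_subset)
      (by
        rw [← hY]; intro w hw v hv he
        exact ⟨hv, fun h => hw.2 (pr_in h hw.1 he)⟩)
      (by
        refine ⟨∅, ⟨by simp, by simp⟩, by rintro v ⟨l, h, -⟩; exact h.elim, by rintro v ⟨l, h, -⟩; exact h.elim, ?_⟩
        ext v; constructor
        · rintro ⟨l, h, -⟩; exact h.elim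
        · rintro ⟨h1, h2, h3⟩; exact (h3 (pr_T h1 h2)).elim)
    intro v hv
    by_contra h
    have : v ∈ Y \ pr E T Y := ⟨hv, h⟩
    simp_all
  · intro C hC hN
    have hCX := hC.sub.trans hYX
    have := U2_max (E := E) (X := X1) (S := S) (T := T) (W := C) (by rw [← hY]; exact hC.sub)
      (by rw [← hY]; intro w hw v hv he; exact hC.adj hw hv (Or.inr he))
      (fix0 hD hL hCX (by
        ext v; simp only [mem_empty_iff_false, iff_false]
        rintro ⟨v1, v2, u, v3, v4⟩
        exact v2 (hC.adj v3 (hYin v v1 u (hC.sub v3) v4) (Or.inl v4))) hN)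
    exact hC.ne.ne_empty this
  · intro y hy hyT
    by_contra hno
    push Not at hno
    let Q := pr E T (Y \ {y})
    let 𝒞 : Set (Set V) := {N | Comp E Q N ∧ ∃ n ∈ N, E y n}
    have hex : ∀ N ∈ 𝒞, Col E N S (T ∩ N) := by
      rintro N ⟨hN, n, hn, he⟩
      have hnear : Near E S T N := by
        by_contra h; exact hno N hN h n hn he
      have hNY : N ⊆ Y \ {y} := hN.sub.trans pr_sub
      refine drop hD hL (y := y) (fun v hv => hYX (hNY hv).1) (fun h => (hNY h).2 rfl) ?_ hnear
      rintro v ⟨v1, v2, u, v3, v4⟩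
      by_contra hvy
      exact v2 (comp_in hN ⟨hYin v v1 u (hNY v3).1 v4, hvy⟩ v3 v4)
    have hcu := col_union (fun a ha b hb v hv hv' => ha.1.dis hb.1 hv hv') hex
    have := U2_max (E := E) (X := X1) (S := S) (T := T) (W := ⋃₀ 𝒞 ∪ (Y \ Q)) (by
        rw [← hY]; rintro v (⟨N, hN, hv⟩ | hv)
        exacts [(pr_sub (hN.1.sub hv)).1, hv.1])
      (by
        rw [← hY]
        have hq : ∀ v ∈ Y, E y v → v ∈ ⋃₀ 𝒞 ∪ (Y \ Q) := by
          intro v hv he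
          by_cases hvQ : v ∈ Q
          · exact Or.inl ⟨cpt E Q v, ⟨comp_cpt hvQ, v, self_cpt hvQ, he⟩, self_cpt hvQ⟩
          · exact Or.inr ⟨hv, hvQ⟩
        rintro w (⟨N, hN, hw⟩ | hw) v hv he
        · by_cases hvQ : v ∈ Q
          · exact Or.inl ⟨N, hN, hN.1.adj hw hvQ (Or.inr he)⟩
          · exact Or.inr ⟨hv, hvQ⟩
        · by_cases hwy : w = y
          · subst hwy; exact hq v hv he
          · refine Or.inr ⟨hv, fun h => hw.2 (pr_in h ⟨hw.1, hwy⟩ he)⟩)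
      (by
        refine Col.mono (A := ⋃₀ 𝒞) (S := S) ?_ subset_union_left le_rfl
        convert hcu using 1
        ext v; simp only [mem_iUnion]; constructor
        · rintro ⟨h1, ⟨N, hN, hv⟩ | ⟨hv, hv'⟩⟩
          · exact ⟨N, hN, h1, hv⟩
          · exact (hv' (pr_T h1 ⟨hv, fun e => hyT (by rw [← show v = y from e]; exact h1)⟩)).elim
        · rintro ⟨N, hN, h1, h2⟩; exact ⟨h1, Or.inl ⟨N, hN, h2⟩⟩)
    have hyW : y ∈ ⋃₀ 𝒞 ∪ (Y \ Q) := Or.inr ⟨hy, fun h => (pr_sub h).2 rfl⟩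
    rw [this] at hyW; exact hyW
end

section
variable {E : V → V → Prop} {X S T U : Set V} {W : Set (List V)} {u v w : V}

theorem Wave.mem (h : Wave E X S T U W) {l : List V} (hl : l ∈ W) (hv : v ∈ l) :
    (l.head? = some v ∧ v ∈ bd E X U) ∨ v ∈ U := by
  obtain ⟨a, ha⟩ := exists_head (h.sys.1 l hl).1
  obtain ⟨s, rfl⟩ := head_form ha
  rcases List.mem_cons.1 hv with rfl | hv
  · left; exact ⟨rfl, by rw [← h.hd]; exact ⟨_, hl, rfl⟩⟩
  · right; exact h.tl a s hl v hv

theorem near_of {R : Set V} {P : Set (List V)} (h1 : Sys E P) (h2 : Vs P ⊆ R) (h3 : Hd P ⊆ S)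
    (h4 : ((T ∩ R) \ Lst P).Finite) : Near E S T R := by
  refine ⟨_, h4, {l ∈ P | ∃ t ∈ T, l.getLast? = some t}, h1.sub (sep_subset _ _), ?_, ?_, ?_⟩
  · rintro v ⟨l, hl, hv⟩; exact h2 ⟨l, hl.1, hv⟩
  · rintro v ⟨l, hl, hv⟩; exact h3 ⟨l, hl.1, hv⟩
  · ext v; constructor
    · rintro ⟨l, ⟨hl, t, ht, hlt⟩, hv⟩
      have : v = t := Option.some.inj (hv.symm.trans hlt)
      subst this
      exact ⟨⟨ht, h2 ⟨l, hl, List.mem_of_getLast? hv⟩⟩, fun h => h.2 ⟨l, hl, hv⟩⟩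
    · rintro ⟨a, b⟩
      have : v ∈ Lst P := by by_contra h; exact b ⟨a, h⟩
      obtain ⟨l, hl, hv⟩ := this
      exact ⟨l, ⟨hl, v, a.1, hv⟩, hv⟩

theorem max_wave (E : V → V → Prop) (X S T : Set V) : ∃ U W, Wave E X S T U W ∧
    ∀ U' W', Wave E X S T U' W' → U ⊆ U' →
      (∀ l ∈ W, ∀ v, l.head? = some v → v ∈ bd E X U' → l ∈ W') → U' ⊆ U := by
  let α := {p : Set V × Set (List V) // Wave E X S T p.1 p.2}
  let r : α → α → Prop := fun p q => p.1.1 ⊆ q.1.1 ∧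
    ∀ l ∈ p.1.2, ∀ v, l.head? = some v → v ∈ bd E X q.1.1 → l ∈ q.1.2
  have hbd : ∀ {p : α} {l : List V} {v : V} {U : Set V}, l ∈ p.1.2 → l.head? = some v → v ∉ U → p.1.1 ⊆ U →
      v ∈ bd E X U := by
    intro p l v U hl hv hvU hp
    have : v ∈ Hd p.1.2 := ⟨l, hl, hv⟩
    rw [p.2.hd] at this
    obtain ⟨a, -, u, b, c⟩ := this
    exact ⟨a, hvU, u, hp b, c⟩
  obtain ⟨m, hm⟩ := exists_maximal_of_chains_bounded (r := r) (by
    intro c hc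
    let U : Set V := ⋃ p ∈ c, p.1.1
    have hUs : ∀ p ∈ c, p.1.1 ⊆ U := fun p hp v hv => mem_biUnion hp hv
    have hcc : ∀ p ∈ c, ∀ q ∈ c, r p q ∨ r q p := by
      intro p hp q hq
      by_cases e : p = q
      · grind
      · exact hc hp hq e
    let W : Set (List V) := {l | ∃ p ∈ c, l ∈ p.1.2 ∧ ∃ v, l.head? = some v ∧ v ∈ bd E X U}
    have hup : ∀ p ∈ c, ∀ q ∈ c, r p q → ∀ l ∈ p.1.2, ∀ v, l.head? = some v → v ∈ bd E X U → l ∈ q.1.2 := by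
      intro p hp q hq hpq l hl v hv hvU
      exact hpq.2 l hl v hv (hbd hl hv (fun h => hvU.2.1 (hUs q hq h)) hpq.1)
    have hW : Wave E X S T U W := by
      refine ⟨?_, ?_, ⟨?_, ?_⟩, ?_, ?_, ?_⟩
      · exact iUnion₂_subset fun p _ => p.2.sub
      · intro v hv
        obtain ⟨p, hp, hv⟩ := mem_iUnion₂.1 hv
        exact p.2.dis v hv
      · rintro l ⟨p, hp, hl, -⟩; exact p.2.sys.1 l hl
      · rintro l ⟨p, hp, hl, v, h1, h2⟩ m ⟨q, hq, hm, w, h3, h4⟩ x hx hx'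
        rcases hcc p hp q hq with h | h
        · exact q.2.sys.2 l (hup p hp q hq h l hl v h1 h2) m hm x hx hx'
        · exact p.2.sys.2 l hl m (hup q hq p hp h m hm w h3 h4) x hx hx'
      · ext v; constructor
        · grind
        · intro hv
          obtain ⟨h1, h2, u, hu, h3⟩ := hv
          obtain ⟨p, hp, hu⟩ := mem_iUnion₂.1 hu
          have : v ∈ Hd p.1.2 := by
            rw [p.2.hd]; exact ⟨h1, fun h => h2 (hUs p hp h), u, hu, h3⟩
          obtain ⟨l, hl, hlv⟩ := this
          exact ⟨l, ⟨p, hp, hl, v, hlv, h1, h2, u, hUs p hp hu, h3⟩, hlv⟩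
      · rintro v s ⟨p, hp, hl, -⟩ x hx; exact hUs p hp (p.2.tl v s hl x hx)
      · rintro v ⟨l, ⟨p, hp, hl, -⟩, hv⟩; exact p.2.lst ⟨l, hl, hv⟩
    refine ⟨⟨(U, W), hW⟩, fun p hp => ⟨hUs p hp, fun l hl v h1 h2 => ⟨p, hp, hl, v, h1, h2⟩⟩⟩) (by
    rintro a b c ⟨h1, h2⟩ ⟨h3, h4⟩
    refine ⟨h1.trans h3, fun l hl v hv hvc => ?_⟩
    exact h4 l (h2 l hl v hv (hbd hl hv (fun h => hvc.2.1 (h3 h)) h1)) v hv hvc)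
  exact ⟨m.1.1, m.1.2, m.2, fun U' W' h' h1 h2 => (hm ⟨(U', W'), h'⟩ ⟨h1, h2⟩).1⟩

def rE (E : V → V → Prop) (X U : Set V) (a b : V) : Prop := E a b ∧ a ∈ X \ U ∧ b ∈ X \ U ∧ a ∉ bd E X U
def rT (E : V → V → Prop) (X T U : Set V) : Set V := bd E X U ∪ (T ∩ (X \ U))

theorem Sys.mono {E' : V → V → Prop} {P : Set (List V)} (h : Sys E P) (hE : ∀ a b, E a b → E' a b) : Sys E' P :=
  ⟨fun l hl => (h.1 l hl).mono hE, h.2⟩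

theorem r_dimaze (hD : IsDimaze E T) : IsDimaze (rE E X U) (rT E X T U) := by
  rintro b (hb | hb) v hv
  exacts [hv.2.2.2 hb, hD b hb.1 v hv.1]
theorem bd_dimaze : IsDimaze (rE E X U) (bd E X U) := fun b hb v hv => hv.2.2.2 hb

theorem glue_sys (hW : Wave E X S T U W) {P W' : Set (List V)} (hP : Sys (rE E X U) P)
    (hPX : Vs P ⊆ X \ U) (hW' : W' ⊆ W) : Sys E (comp P W') := by
  refine comp_sys (hP.mono fun _ _ h => h.1) (hW.sys.sub hW') ?_
  intro a ha b hb u hu hu'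
  rcases hW.mem (hW' hb) hu' with h | h
  · exact ⟨exit_last bd_dimaze (hP.1 a ha) h.2 hu, h.1⟩
  · exact ((hPX ⟨a, ha, hu⟩).2 h).elim

theorem res_loose (hW : Wave E X S T U W) (hmax : ∀ U' W', Wave E X S T U' W' → U ⊆ U' →
      (∀ l ∈ W, ∀ v, l.head? = some v → v ∈ bd E X U' → l ∈ W') → U' ⊆ U) :
    Loose (rE E X U) (X \ U) S (rT E X T U) := by
  intro U' W' hW'
  have hV : Vs W' ⊆ X \ U := by
    rintro v ⟨l, hl, hv⟩
    rcases hW'.mem hl hv with h | h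
    exacts [h.2.1, hW'.sub h]
  let A0 : Set (List V) := W' ∪ {l | ∃ v ∈ bd E X U, v ∉ U' ∧ l = [v]}
  have hVA : Vs A0 ⊆ X \ U := by
    rintro v ⟨l, hl | ⟨w, hw, -, rfl⟩, hv⟩
    · exact hV ⟨l, hl, hv⟩
    · simp at hv; subst hv; exact ⟨hw.1, hw.2.1⟩
  have hnm : ∀ l ∈ W', ∀ v ∈ l, v ∈ bd E X U → v ∈ U' := by
    intro l hl v hv hvb
    rcases hW'.mem hl hv with h | h
    · obtain ⟨-, -, u, -, hu⟩ := h.2; exact (hu.2.2.2 hvb).elim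
    · exact h
  have hA : Sys (rE E X U) A0 := by
    refine ⟨?_, ?_⟩
    · rintro l (hl | ⟨w, hw, -, rfl⟩)
      exacts [hW'.sys.1 l hl, ⟨by simp, by simp, by simp⟩]
    · rintro l (hl | ⟨w, hw, hw', rfl⟩) m (hm | ⟨z, hz, hz', rfl⟩) x hx hx'
      · exact hW'.sys.2 l hl m hm x hx hx'
      · grind
      · grind
      · grind
  have hHd : Hd A0 = bd E X (U ∪ U') := by
    have e : Hd A0 = Hd W' ∪ (bd E X U \ U') := by
      ext v; constructor
      · rintro ⟨l, hl | ⟨w, hw, hw', rfl⟩, hv⟩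
        · grind
        · grind
      · rintro (⟨l, hl, hv⟩ | ⟨h1, h2⟩)
        · grind
        · exact ⟨[v], Or.inr ⟨v, h1, h2, rfl⟩, rfl⟩
    rw [e, hW'.hd]; ext v; constructor
    · rintro (⟨⟨h1, h1'⟩, h2, u, h3, h4⟩ | ⟨⟨h1, h2, u, h3, h4⟩, h5⟩)
      · exact ⟨h1, by rintro (h | h); exacts [h1' h, h2 h], u, Or.inr h3, h4.1⟩
      · exact ⟨h1, by rintro (h | h); exacts [h2 h, h5 h], u, Or.inl h3, h4⟩
    · rintro ⟨h1, h2, u, h3, h4⟩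
      have hU : v ∉ U := fun h => h2 (Or.inl h)
      have hU' : v ∉ U' := fun h => h2 (Or.inr h)
      by_cases hb : v ∈ bd E X U
      · exact Or.inr ⟨hb, hU'⟩
      · rcases h3 with h3 | h3
        · exact (hb ⟨h1, hU, u, h3, h4⟩).elim
        · exact Or.inl ⟨⟨h1, hU⟩, hU', u, h3, h4, ⟨h1, hU⟩, hW'.sub h3, hb⟩
  have hnew : Wave E X S T (U ∪ U') (comp A0 W) := by
    refine ⟨?_, ?_, glue_sys hW hA hVA le_rfl, by rw [comp_Hd, hHd], ?_, ?_⟩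
    · exact union_subset hW.sub fun v hv => (hW'.sub hv).1
    · rintro v (hv | hv); exacts [hW.dis v hv, hW'.dis v hv]
    · intro v s h x hx
      have htl : ∀ v s, v :: s ∈ A0 → ∀ x ∈ s, x ∈ U' := by
        rintro v s (h | ⟨w, -, -, e⟩)
        · exact hW'.tl v s h
        · cases e; simp
      rcases h with ⟨a, z, t, h1, h2, e⟩ | ⟨h1, -⟩
      · cases a with
        | nil =>
          simp at e; obtain ⟨rfl, rfl⟩ := e
          exact Or.inl (hW.tl v s h2 x hx)
        | cons a0 a =>
          simp at e; obtain ⟨rfl, rfl⟩ := e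
          simp at hx
          rcases hx with hx | rfl | hx
          · grind
          · exact Or.inr (htl v _ h1 x (by simp))
          · exact Or.inl (hW.tl z t h2 x hx)
      · grind
    · rintro x ⟨l, ⟨s, z, t, h1, h2, rfl⟩ | ⟨h1, h2⟩, hx⟩
      · rw [List.getLast?_append_cons] at hx; exact hW.lst ⟨_, h2, hx⟩
      · have hxT : x ∈ rT E X T U := by
          rcases h1 with h1 | ⟨w, hw, -, rfl⟩
          · exact hW'.lst ⟨l, h1, hx⟩
          · simp at hx; subst hx; exact Or.inl hw
        rcases hxT with h | h
        · exact (h2 x hx (by rw [hW.hd]; exact h)).elim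
        · exact h.1
  have := hmax _ _ hnew subset_union_left (by
    intro l hl v hv hvb
    obtain ⟨s, rfl⟩ := head_form hv
    have hb : v ∈ bd E X U := by rw [← hW.hd]; exact ⟨_, hl, rfl⟩
    exact Or.inl ⟨[], v, s, Or.inr ⟨v, hb, fun h => hvb.2.1 (Or.inr h), rfl⟩, hl, rfl⟩)
  ext v; constructor
  · intro hv; exact ((hW'.sub hv).2 (this (Or.inr hv))).elim
  · exact fun h => h.elim

theorem wave_miss (hD : IsDimaze E T) (hL : Loose E X S T) {Z K : Set V} (hZ : Z ⊆ X) (hK : K.Finite)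
    (hKX : K ⊆ X) (hb : bd E X Z ⊆ K) (hW : Wave E Z S T U W) : ((T ∩ U) \ Lst W).Finite := by
  classical
  by_contra hinf
  obtain ⟨F, hF, hFc⟩ := Set.Infinite.exists_subset_card_eq hinf (hK.toFinset.card + 1)
  have hL' := loose_sub (R := U) (K := bd E Z U ∪ K) hL (hW.sub.trans hZ)
    (union_subset (fun v h => hZ h.1) hKX) (by
      rintro v ⟨h1, h2, u, h3, h4⟩
      by_cases hv : v ∈ Z
      · exact Or.inl ⟨hv, h2, u, h3, h4⟩
      · exact Or.inr (hb ⟨h1, hv, u, hW.sub h3, h4⟩))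
  obtain ⟨P, G, p1, p2, p3, p4, p5, p6⟩ := aug_many hD hL' F W hW.sys (by
      rintro v ⟨l, hl, hv⟩
      rcases hW.mem hl hv with h | h
      exacts [Or.inr (Or.inl h.2), Or.inl h]) hW.lst
      (fun t ht => ⟨(hF ht).1.1, Or.inl (hF ht).1.2, (hF ht).2⟩)
  have : G ⊆ hK.toFinset := by
    intro s hs
    have h1 : s ∈ Hd P := by grind
    have h2 := p6 s hs
    rw [hW.hd] at h2
    simp only [Set.Finite.mem_toFinset]
    rcases p2 (Hd_sub_Vs _ h1) with h | h | h
    · rcases h2.1 with h' | h' | h'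
      exacts [(hW.dis s h h').elim, (h2.2 h').elim, h']
    · exact (h2.2 h).elim
    · exact h
  have := Finset.card_le_card this
  omega

theorem res_bad (hD : IsDimaze E T) (hW : Wave E X S T U W) (hm : ((T ∩ U) \ Lst W).Finite) {A : Set V}
    (hA : A ⊆ X \ U) (h : Near (rE E X U) S (rT E X T U) A) (hrest : Near E S T X → False)
    (hAX : rT E X T U ⊆ A) : False := by
  obtain ⟨H, hH, P, p1, p2, p3, p4⟩ := h
  apply hrest
  let W' : Set (List V) := {l ∈ W | ∀ v, l.head? = some v → v ∉ H}
  have hW' : W' ⊆ W := sep_subset _ _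
  have hHW : Hd W' ⊆ Lst P := by
    rintro v ⟨l, hl, hv⟩
    have : v ∈ bd E X U := by rw [← hW.hd]; exact ⟨l, hl.1, hv⟩
    rw [p4]; exact ⟨⟨Or.inl this, hAX (Or.inl this)⟩, hl.2 v hv⟩
  refine near_of (P := comp P W') (glue_sys hW p1 (p2.trans hA) hW') ?_ (by rw [comp_Hd]; exact p3) ?_
  · refine (comp_Vs _ _).trans (union_subset (p2.trans (hA.trans sdiff_subset)) ?_)
    rintro v ⟨l, hl, hv⟩
    rcases hW.mem hl.1 hv with h | h
    exacts [h.2.1, hW.sub h]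
  · rw [comp_Lst hHW fun b hb => (hW.sys.1 b hb.1).1]
    refine ((hm.union hH).union (hH.biUnion (t := fun h => {t | ∃ l ∈ W, l.head? = some h ∧ l.getLast? = some t})
      fun h _ => Set.Subsingleton.finite ?_)).subset ?_
    · rintro t ⟨l, hl, a, b⟩ t' ⟨l', hl', a', b'⟩
      have := sys_head_eq hW.sys hl hl' a a'
      subst this; exact Option.some.inj (b.symm.trans b')
    · rintro t ⟨⟨h1, h2⟩, h3⟩
      by_cases hU : t ∈ U
      · by_cases hl : t ∈ Lst W
        · right
          obtain ⟨l, hl, ht⟩ := hl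
          obtain ⟨v, hv⟩ := exists_head (hW.sys.1 l hl).1
          have : v ∈ H := by grind
          exact mem_biUnion this ⟨l, hl, hv, ht⟩
        · grind
      · left; right
        by_contra hH
        have hT : t ∈ rT E X T U := Or.inr ⟨h1, h2, hU⟩
        refine h3 (Or.inr ⟨by rw [p4]; exact ⟨⟨hT, hAX hT⟩, hH⟩, ?_⟩)
        rintro ⟨l, hl, hv⟩
        have : t ∈ bd E X U := by rw [← hW.hd]; exact ⟨l, hl.1, hv⟩
        obtain ⟨-, -, u, -, hu⟩ := this
        exact hD t h1 u hu
end

section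
variable {E : V → V → Prop} {X S T A B C : Set V} {u v w x y m : V} {d d' : Bool}

def Fat (E : V → V → Prop) (T A : Set V) : Prop := A.Finite ∧ Conn E A ∧ Prd E T A

theorem ZW.nil : ZW E T A d x [] d x :=
  ⟨rfl, rfl, by simp, by simp, fun _ => [], by simp [sinks], by simp [sinks]⟩

theorem ZW.one {L : List V} (h : Ed E d' x w) (hL : PTo E T A x L) (hA : x ∈ A) :
    ZW E T A d x [(x, d')] d' w := by
  have hs : ∀ v ∈ sinks d [(x, d')], v = x := by
    intro v hv; simp only [sinks] at hv; rcases hv with hv | hv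
    · exact hv.1
    · exact hv.elim
  refine ⟨⟨rfl, w, h, rfl⟩, rfl, by simp, by simpa using hA, fun _ => L, ?_, ?_⟩
  · grind
  · grind

theorem PTo.tail {p q : List V} (h : PTo E T A x (p ++ m :: q)) : PTo E T {v | v ∈ m :: q} m (m :: q) := by
  obtain ⟨h1, -, ⟨t, ht, h3⟩, -⟩ := h
  refine ⟨h1.suffix (by simp), rfl, ⟨t, ht, ?_⟩, fun u hu => hu⟩
  rw [← h3]; exact (List.getLast?_append_cons _ _ _).symm

theorem fat_tree {p q q' : List V} (hP : PTo E T A x (p ++ m :: q)) (hQ : IsP E (q' ++ [m]))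
    (hy : (q' ++ [m]).head? = some y) (hA : ∀ v ∈ q', v ∈ A) (hd : ∀ v ∈ q', v ∉ p ++ m :: q)
    (he : Ed E d' y w) : ∃ l, ZW E T A d x l d' w := by
  have hPd := hP.1.2.1
  have hPs := hP.2.2.2
  have hPt := hP.tail
  obtain ⟨l, e, hl⟩ : ∃ l e, ZW E T {v | v ∈ p} d x l e m := by
    cases p with
    | nil =>
      have : x = m := by simpa using hP.2.1.symm
      subst this; exact ⟨[], d, ZW.nil⟩
    | cons a p =>
      have : a = x := by simpa using hP.2.1
      subst this
      have hc : ((a :: (p ++ [m])) ++ q).IsChain E := by simpa using hP.1.2.2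
      refine ⟨_, true, ZW.fwd (l := p) hc.left_of_append ?_ (fun v hv => hv)⟩
      exact (List.nodup_append.1 hPd).1
  have hdis : ∀ v ∈ p, v ∉ m :: q := fun v hv hv' => (List.nodup_append.1 hPd).2.2 v hv v hv' rfl
  obtain ⟨k, hk⟩ : ∃ k, ZW E T ({v | v ∈ m :: q} ∪ {v | v ∈ q'}) e m k d' w := by
    cases q' with
    | nil =>
      have : m = y := by simpa using hy
      subst this
      exact ⟨_, (ZW.one he hPt (by simp)).mono subset_union_left⟩
    | cons a q' =>
      have : a = y := by simpa using hy
      subst this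
      have hc : (a :: (q' ++ [m])).IsChain E := by simpa using hQ.2.2
      have hn : (a :: (q' ++ [m])).Nodup := by simpa using hQ.2.1
      have h1 : ZW E T ({v | v ∈ m :: q} ∪ {v | v ∈ q'}) e m ((m :: q'.reverse).map (fun v => (v, false))) false a := by
        refine ZW.bwd hc (List.nodup_cons.1 hn).2 ?_ ?_
        · grind
        · intro _
          refine ⟨m :: q, hPt.mono subset_union_left, fun u hu hu' => ?_⟩
          rcases List.mem_append.1 hu' with h | h
          · grind
          · simpa using h
      have h2 : ZW E T {a} false a [(a, d')] d' w := ZW.single he (Or.inl rfl)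
      refine ⟨_, (h1.append h2 ?_).mono ?_⟩
      · grind
      · grind
  refine ⟨_, (hl.append hk ?_).mono ?_⟩
  · grind
  · grind

theorem dr_path (h : Dr E A u v) (hu : u ∈ A) :
    ∃ l, IsP E l ∧ l.head? = some u ∧ l.getLast? = some v ∧ ∀ z ∈ l, z ∈ A := by
  obtain ⟨l, h1, h2, h3⟩ := rtg_path h
  refine ⟨l, h1.mono fun _ _ h => h.1, h2, h3, ?_⟩
  intro z hz
  have key : ∀ (l : List V) a, (a :: l).IsChain (Rs E A) → a ∈ A → ∀ z ∈ a :: l, z ∈ A := by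
    intro l
    induction l with
    | nil => intro a _ ha z hz; simp at hz; rwa [hz]
    | cons b l ih =>
      intro a hc ha z hz
      rw [List.isChain_cons_cons] at hc
      rcases List.mem_cons.1 hz with rfl | hz
      · exact ha
      · exact ih b hc.2 hc.1.2.2 z hz
  cases l with
  | nil => simp at hz
  | cons a l =>
    simp at h2; subst h2
    exact key l a h1.2.2 hu z hz

theorem pto_of_pr (h : v ∈ pr E T A) : ∃ l, PTo E T A v l := by
  obtain ⟨hA, t, ht, -, hd⟩ := h
  obtain ⟨l, h1, h2, h3, h4⟩ := dr_path hd hA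
  exact ⟨l, h1, h2, ⟨t, ht, h3⟩, h4⟩

theorem cn_cross (h : Cn E A u v) (hu : u ∉ B) (hv : v ∈ B) :
    ∃ a c, a ∉ B ∧ c ∈ B ∧ (E a c ∨ E c a) ∧ a ∈ A ∧ c ∈ A := by
  by_contra hc
  push Not at hc
  have : ∀ z, Cn E A u z → z ∉ B := by
    intro z hz
    induction hz with
    | refl => exact hu
    | tail _ h2 ih => intro hb; exact hc _ _ ih hb h2.1 h2.2.1 h2.2.2
  exact this v h hv

theorem chain_pr {l : List V} (h : l.IsChain E) (hA : ∀ v ∈ l, v ∈ A)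
    (hv : ∃ v ∈ l.getLast?, v ∈ pr E T A) : ∀ v ∈ l, v ∈ pr E T A := by
  induction l with
  | nil => simp
  | cons a l ih =>
    intro v hv'
    cases l with
    | nil => simp at hv hv'; rw [hv']; exact hv
    | cons b l =>
      rw [List.isChain_cons_cons] at h
      have := ih h.2 (fun v hv => hA v (by simp at hv ⊢; tauto)) (by simpa using hv)
      rcases List.mem_cons.1 hv' with rfl | hv'
      · exact pr_in (this b (by simp)) (hA _ (by simp)) h.1
      · exact this v hv'

theorem fat_zw_aux (n : ℕ) : ∀ (A : Set V) (d : Bool) (x : V), A.ncard ≤ n → Fat E T A → x ∈ A → y ∈ A →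
    Ed E d' y w → ∃ l, ZW E T A d x l d' w := by
  induction n with
  | zero =>
    intro A d x hn hF hx
    rw [Nat.le_zero, ncard_eq_zero hF.1] at hn; simp [hn] at hx
  | succ n ih =>
    intro A d x hn hF hx hy he
    obtain ⟨hfin, hC, hPr⟩ := hF
    obtain ⟨P, hP⟩ := pto_of_pr (hPr hx)
    have hxP : x ∈ P := List.mem_of_mem_head? hP.2.1
    set R := pr E T (A \ {v | v ∈ P}) with hR
    have hxR : x ∉ R := fun h => h.1.2 hxP
    have tree : ∀ (d' : Bool) (y w : V), y ∈ A → y ∉ R → Ed E d' y w →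
        ∃ l, ZW E T (A \ R) d x l d' w := by
      intro d' y w hy hyR he
      obtain ⟨Q, hQ⟩ := pto_of_pr (hPr hy)
      have hPA : PTo E T (A \ R) x P := ⟨hP.1, hP.2.1, hP.2.2.1, fun u hu =>
        ⟨hP.2.2.2 u hu, fun h => h.1.2 hu⟩⟩
      have hit : ∃ v ∈ Q, v ∈ P := by
        by_contra hc
        push Not at hc
        refine hyR ?_
        obtain ⟨t, ht, htl⟩ := hQ.2.2.1
        refine chain_pr (A := A \ {v | v ∈ P}) hQ.1.2.2 (fun v hv => ⟨hQ.2.2.2 v hv, hc v hv⟩) ⟨t, htl, pr_T ht (?_ : t ∈ A \ {v | v ∈ P})⟩ y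
          (List.mem_of_mem_head? hQ.2.1)
        have := List.mem_of_getLast? htl
        exact ⟨hQ.2.2.2 t this, hc t this⟩
      obtain ⟨s, m, q, rfl, hm, hs⟩ := first_hit (X := {v | v ∈ P}) hit
      obtain ⟨p, r, rfl⟩ := List.append_of_mem hm
      have hQc : (s ++ [m]).IsChain E := by
        have : ((s ++ [m]) ++ q).IsChain E := by simpa using hQ.1.2.2
        exact this.left_of_append
      refine fat_tree hPA (q' := s) (y := y) ⟨by simp, ?_, hQc⟩ ?_ ?_ hs he
      · have := hQ.1.2.1
        have : ((s ++ [m]) ++ q).Nodup := by simpa using this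
        exact (List.nodup_append.1 this).1
      · rw [← hQ.2.1]; exact head?_split _ _ _ _
      · intro v hv
        refine ⟨hQ.2.2.2 v (by simp [hv]), fun hvR => hyR ?_⟩
        obtain ⟨s1, s2, rfl⟩ := List.append_of_mem hv
        have h1 : ((s1 ++ [v]) ++ (s2 ++ [m])).IsChain E := by simpa using hQc
        refine chain_pr h1.left_of_append ?_ ⟨v, by simp, hvR⟩ y ?_
        · intro z hz
          refine ⟨hQ.2.2.2 z (by simp at hz ⊢; tauto), hs z (by simp at hz ⊢; tauto)⟩
        · have h2 := hQ.2.1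
          cases s1 with
          | nil => simp at h2; simp [h2]
          | cons a s1 => simp at h2; simp [h2]
    by_cases hyR : y ∈ R
    · set C := cpt E R y with hCd
      have hCc : Comp E R C := comp_cpt hyR
      have hyC : y ∈ C := self_cpt hyR
      obtain ⟨a, c, ha, hc, hac, haA, -⟩ := cn_cross (B := C) (hC x hx y hy) (fun h => hxR (hCc.sub h)) hyC
      have haR : a ∉ R := fun h => ha (hCc.adj hc h hac)
      obtain ⟨e, hee⟩ : ∃ e, Ed E e a c := by
        rcases hac with h | h
        · exact ⟨true, h⟩
        · exact ⟨false, h⟩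
      obtain ⟨l, hl⟩ := tree e a c haA haR hee
      have hCA : C ⊆ A := fun z hz => (hCc.sub hz).1.1
      obtain ⟨k, hk⟩ := ih C e c (by
        have : C.ncard < A.ncard := ncard_lt_ncard ⟨hCA, fun h => hxR (hCc.sub (h hx))⟩ hfin
        omega) ⟨hfin.subset hCA, hCc.conn, hCc.prd pr_prd⟩ hc hyC he
      refine ⟨_, (hl.append hk ?_).mono ?_⟩
      · rw [disjoint_left]; exact fun z hz hz' => hz.2 (hCc.sub hz')
      · grind
    · obtain ⟨l, hl⟩ := tree d' y w hy hyR he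
      exact ⟨l, hl.mono fun z hz => hz.1⟩

theorem Fat.zw (hF : Fat E T A) (d : Bool) (hx : x ∈ A) (hy : y ∈ A) (he : Ed E d' y w) :
    ∃ l, ZW E T A d x l d' w := fat_zw_aux _ A d x le_rfl hF hx hy he

theorem ZW.hasF {l : List (V × Bool)} (h : ZW E T A true x l false w) : ∃ a ∈ l, a.2 = false := by
  have : ∀ (l : List (V × Bool)) d, lf d l = false → d = true → ∃ a ∈ l, a.2 = false := by
    intro l
    induction l with
    | nil => intro d h1 h2; simp [lf] at h1; simp_all
    | cons a l ih =>
      intro d h1 _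
      cases h : a.2 with
      | false => exact ⟨a, by simp, h⟩
      | true => obtain ⟨b, hb, h'⟩ := ih a.2 h1 h; exact ⟨b, by simp [hb], h'⟩
  exact this l true h.lfe rfl
end

section
variable {E : V → V → Prop} {X S T A B C Z D : Set V} {u v w x y q : V} {H : Set (Set V)}

theorem Cn.symm' (h : Cn E A u v) : Cn E A v u := h.symm

theorem Prd.union (hA : Prd E T A) (hB : Prd E T B) : Prd E T (A ∪ B) :=
  union_subset (fun _ h => pr_mono subset_union_left (hA h)) fun _ h => pr_mono subset_union_right (hB h)

theorem Conn.union {a b : V} (hA : Conn E A) (hB : Conn E B) (ha : a ∈ A) (hb : b ∈ B)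
    (h : a = b ∨ E a b ∨ E b a) : Conn E (A ∪ B) := by
  have hab : Cn E (A ∪ B) a b := by
    rcases h with rfl | h
    · exact .refl
    · exact .single ⟨h, Or.inl ha, Or.inr hb⟩
  have key : ∀ u ∈ A ∪ B, Cn E (A ∪ B) a u := by
    rintro u (hu | hu)
    · exact (hA a ha u hu).mono subset_union_left
    · exact hab.trans ((hB b hb u hu).mono subset_union_right)
  exact fun u hu v hv => (key u hu).symm.trans (key v hv)

theorem Fat.union {a b : V} (hA : Fat E T A) (hB : Fat E T B) (ha : a ∈ A) (hb : b ∈ B)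
    (h : a = b ∨ E a b ∨ E b a) : Fat E T (A ∪ B) :=
  ⟨hA.1.union hB.1, hA.2.1.union hB.2.1 ha hb h, hA.2.2.union hB.2.2⟩

theorem chain_dr {l : List V} (h : (u :: l).IsChain E) (hA : ∀ z ∈ u :: l, z ∈ A) :
    ∀ z ∈ u :: l, Dr E A u z := by
  induction l generalizing u with
  | nil => intro z hz; simp at hz; rw [hz]
  | cons b l ih =>
    rw [List.isChain_cons_cons] at h
    intro z hz
    rcases List.mem_cons.1 hz with rfl | hz
    · exact .refl
    · exact .head ⟨h.1, hA _ (by simp), hA _ (by simp)⟩ (ih h.2 (fun z hz => hA z (by simp at hz ⊢; tauto)) z hz)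

theorem fat_path {l : List V} (h : PTo E T A v l) : Fat E T {u | u ∈ l} := by
  obtain ⟨h1, h2, ⟨t, ht, h3⟩, -⟩ := h
  refine ⟨l.finite_toSet, ?_, ?_⟩
  · cases l with
    | nil => simp at h2
    | cons a l =>
      have := chain_dr (A := {u | u ∈ a :: l}) h1.2.2 (fun z hz => hz)
      exact fun u hu v hv => (this u hu).cn.symm.trans (this v hv).cn
  · exact fun u hu => chain_pr h1.2.2 (fun _ h => h) ⟨t, h3, pr_T ht (List.mem_of_getLast? h3)⟩ u hu

theorem fat_hull1 (hC : Conn E C) (hP : Prd E T C) (hu : u ∈ C) (hv : v ∈ C) :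
    ∃ F, Fat E T F ∧ F ⊆ C ∧ u ∈ F ∧ v ∈ F := by
  have h := hC u hu v hv
  have hp : ∀ z ∈ C, ∃ F, Fat E T F ∧ F ⊆ C ∧ z ∈ F := fun z hz => by
    obtain ⟨l, hl⟩ := pto_of_pr (hP hz)
    exact ⟨_, fat_path hl, fun z hz => hl.2.2.2 z hz, List.mem_of_mem_head? hl.2.1⟩
  clear hv
  induction h with
  | refl => obtain ⟨F, h1, h2, h3⟩ := hp u hu; exact ⟨F, h1, h2, h3, h3⟩
  | tail _ h2 ih =>
    obtain ⟨F, h3, h4, h5, h6⟩ := ih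
    obtain ⟨G, h7, h8, h9⟩ := hp _ h2.2.2
    exact ⟨F ∪ G, h3.union h7 h6 h9 (Or.inr h2.1), union_subset h4 h8, Or.inl h5, Or.inr h9⟩

theorem fat_hull (hC : Conn E C) (hP : Prd E T C) (hu : u ∈ C) (hD : D.Finite) (hDC : D ⊆ C) :
    ∃ F, Fat E T F ∧ F ⊆ C ∧ u ∈ F ∧ D ⊆ F := by
  induction D, hD using Set.Finite.induction_on with
  | empty =>
    obtain ⟨F, h1, h2, h3, _⟩ := fat_hull1 hC hP hu hu; exact ⟨F, h1, h2, h3, by simp⟩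
  | @insert a s _ _ ih =>
    obtain ⟨F, h3, h4, h5, h6⟩ := ih fun z hz => hDC (Or.inr hz)
    obtain ⟨G, h7, h8, h9, h10⟩ := fat_hull1 hC hP hu (hDC (Or.inl rfl))
    refine ⟨F ∪ G, h3.union h7 h5 h9 (Or.inl rfl), union_subset h4 h8, Or.inl h5, ?_⟩
    rintro z (rfl | hz)
    · exact Or.inr h10
    · exact Or.inl (h6 hz)

structure Nd (E : V → V → Prop) (T Z : Set V) (q : V) (H : Set (Set V)) (C : Set V) : Prop where
  hfin : H.Finite
  fin : (⋃₀ H).Finite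
  sub : ⋃₀ H ⊆ Z
  csub : C ⊆ Z
  dis : ∀ v ∈ C, v ∉ ⋃₀ H
  out : ∀ c ∈ C, ∀ w ∈ Z, E c w → w ∈ C
  inn : ∀ u ∈ Z, ∀ v ∈ C, E u v → u ∈ C ∨ u ∈ ⋃₀ H
  conn : Conn E C
  prd : Prd E T C
  ne : C.Nonempty
  fat : ∀ F, Fat E T F → F ⊆ C → (∀ f ∈ H, (∃ a ∈ f, ∃ c ∈ C, E a c) → ∃ a ∈ f, ∃ c ∈ F, E a c) →
    (q ∈ C → q ∈ F) → Fat E T (⋃₀ H ∪ F) ∧ q ∈ ⋃₀ H ∪ F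

def Fs (E : V → V → Prop) (T Z : Set V) (q : V) (F : Set (Set V) → Set V → Set V) : Prop :=
  ∀ H C, Nd E T Z q H C → Fat E T (F H C) ∧ F H C ⊆ C ∧ (F H C).Nonempty ∧
    (∀ f ∈ H, (∃ a ∈ f, ∃ c ∈ C, E a c) → ∃ a ∈ f, ∃ c ∈ F H C, E a c) ∧ (q ∈ C → q ∈ F H C)

theorem exists_Fs (E : V → V → Prop) (T Z : Set V) (q : V) : ∃ F, Fs E T Z q F := by
  have : ∀ H C, ∃ F, Nd E T Z q H C → Fat E T F ∧ F ⊆ C ∧ F.Nonempty ∧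
    (∀ f ∈ H, (∃ a ∈ f, ∃ c ∈ C, E a c) → ∃ a ∈ f, ∃ c ∈ F, E a c) ∧ (q ∈ C → q ∈ F) := by
    intro H C
    by_cases h : Nd E T Z q H C
    · obtain ⟨x, hx⟩ := h.ne
      have : ∀ f : Set V, ∃ c, c ∈ C ∧ ((∃ a ∈ f, ∃ c ∈ C, E a c) → ∃ a ∈ f, E a c) := by grind
      choose g hg hg' using this
      obtain ⟨F, h1, h2, h3, h4⟩ := fat_hull h.conn h.prd hx (D := g '' H ∪ (C ∩ {q}))
        ((h.hfin.image g).union ((finite_singleton q).subset inter_subset_right)) (by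
          rintro z (⟨f, _, rfl⟩ | hz)
          · exact hg f
          · exact hz.1)
      refine ⟨F, fun _ => ⟨h1, h2, ⟨x, h3⟩, ?_, fun hq => h4 (Or.inr ⟨hq, rfl⟩)⟩⟩
      intro f hf hf'
      obtain ⟨a, ha, he⟩ := hg' f hf'
      exact ⟨a, ha, g f, h4 (Or.inl ⟨f, hf, rfl⟩), he⟩
    · exact ⟨∅, fun h' => (h h').elim⟩
  choose F hF using this
  exact ⟨F, fun H C => hF H C⟩

def chd (E : V → V → Prop) (S T Z : Set V) (F : Set (Set V) → Set V → Set V) (H : Set (Set V))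
    (C : Set V) : Set (Set V) := {c | Comp E (pr E T (Z \ (⋃₀ H ∪ F H C))) c ∧ ¬ Near E S T c ∧ c ⊆ C}

def lay (E : V → V → Prop) (S T Z : Set V) (F : Set (Set V) → Set V → Set V) (H : Set (Set V))
    (C : Set V) : Set V := C \ ⋃₀ chd E S T Z F H C

def Wm (E : V → V → Prop) (S T Z : Set V) (F : Set (Set V) → Set V → Set V) :
    ℕ → Set (Set V) → Set V → Set V
  | 0, _, _ => ∅
  | m+1, H, C => lay E S T Z F H C ∪ ⋃ c ∈ chd E S T Z F H C, Wm E S T Z F m (insert (F H C) H) c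

def Stuck (E : V → V → Prop) (S T Z : Set V) (q : V) : Prop :=
  ∀ K, Fat E T K → K ⊆ Z → q ∈ K → ∀ C, Comp E (pr E T (Z \ K)) C → ¬ Near E S T C →
    ∀ c ∈ C, ∀ w ∈ Z, E c w → w ∈ C

variable {F : Set (Set V) → Set V → Set V}

theorem Nd.root (hC : Conn E Z) (hP : Prd E T Z) (hq : q ∈ Z) : Nd E T Z q ∅ Z where
  hfin := by simp
  fin := by simp
  sub := by simp
  csub := subset_rfl
  dis := by simp
  out := fun _ _ _ h _ => h
  inn := fun _ h _ _ _ => Or.inl h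
  conn := hC
  prd := hP
  ne := ⟨q, hq⟩
  fat := fun F h1 _ _ h4 => by simpa using ⟨h1, h4 hq⟩

theorem sU : ⋃₀ insert (F H C) H = ⋃₀ H ∪ F H C := by rw [sUnion_insert, union_comm]

theorem Nd.child (hZ : Conn E Z) (hS : Stuck E S T Z q) (hF : Fs E T Z q F) (h : Nd E T Z q H C)
    {c : Set V} (hc : c ∈ chd E S T Z F H C) : Nd E T Z q (insert (F H C) H) c := by
  obtain ⟨f1, f2, f3, f4, f5⟩ := hF H C h
  obtain ⟨k1, k2⟩ := h.fat _ f1 f2 f4 f5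
  obtain ⟨c1, c2, c3⟩ := hc
  have hK : ⋃₀ H ∪ F H C ⊆ Z := union_subset h.sub (f2.trans h.csub)
  have hcZ : c ⊆ Z := c3.trans h.csub
  have hout := hS _ k1 hK k2 c c1 c2
  have hdis : ∀ v ∈ c, v ∉ ⋃₀ H ∪ F H C := fun v hv => (c1.sub hv).1.2
  have hinn : ∀ u ∈ Z, ∀ v ∈ c, E u v → u ∈ c ∨ u ∈ ⋃₀ H ∪ F H C := by
    intro u hu v hv he
    by_cases hk : u ∈ ⋃₀ H ∪ F H C
    · exact Or.inr hk
    · exact Or.inl (comp_in c1 ⟨hu, hk⟩ hv he)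
  have hqc : q ∉ c := fun h => hdis q h k2
  refine ⟨h.hfin.insert _, by rw [sU]; exact h.fin.union f1.1, by rw [sU]; exact hK, hcZ,
    by rw [sU]; exact hdis, hout, by rw [sU]; exact hinn, c1.conn, c1.prd pr_prd, c1.ne, ?_⟩
  intro G g1 g2 g3 _
  rw [sU]
  refine ⟨?_, Or.inl k2⟩
  obtain ⟨z, hz⟩ := c1.ne
  obtain ⟨a, b, ha, hb, hab, haZ, -⟩ := cn_cross (B := c) (hZ q (hK k2) z (hcZ hz)) hqc hz
  have hab : E a b := hab.resolve_right fun h => ha (hout b hb a haZ h)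
  have haK := (hinn a haZ b hb hab).resolve_left ha
  rw [← sU] at haK
  obtain ⟨f, hf, haf⟩ := haK
  obtain ⟨a', ha', c', hc', he⟩ := g3 f hf ⟨a, haf, b, hb, hab⟩
  refine k1.union g1 (a := a') (b := c') ?_ hc' (Or.inr (Or.inl he))
  rw [← sU]; exact ⟨f, hf, ha'⟩

theorem chd_dis {c c' : Set V} (hc : c ∈ chd E S T Z F H C) (hc' : c' ∈ chd E S T Z F H C)
    (hv : v ∈ c) (hv' : v ∈ c') : c = c' := hc.1.dis hc'.1 hv hv'

theorem F_lay (hF : Fs E T Z q F) (h : Nd E T Z q H C) : F H C ⊆ lay E S T Z F H C := by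
  intro v hv
  refine ⟨(hF H C h).2.1 hv, ?_⟩
  rintro ⟨c, hc, hvc⟩
  exact (hc.1.sub hvc).1.2 (Or.inr hv)

theorem Wm_sub : ∀ (m : ℕ) (H : Set (Set V)) (C : Set V), Wm E S T Z F m H C ⊆ C := by
  intro m
  induction m with
  | zero => intro H C v hv; exact hv.elim
  | succ m ih =>
    rintro H C v (hv | hv)
    · exact hv.1
    · simp only [mem_iUnion] at hv
      obtain ⟨c, hc, hv⟩ := hv
      exact hc.2.2 (ih _ _ hv)

theorem lay_bd (hZX : Z ⊆ X) (hZ : Conn E Z) (hS : Stuck E S T Z q) (hF : Fs E T Z q F) (h : Nd E T Z q H C) :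
    bd E X (lay E S T Z F H C) ⊆ bd E X Z ∪ ⋃₀ H := by
  rintro v ⟨hvX, hvL, u, hu, he⟩
  by_cases hvZ : v ∈ Z
  · rcases h.inn v hvZ u hu.1 he with hv | hv
    · obtain ⟨c, hc, hvc⟩ : v ∈ ⋃₀ chd E S T Z F H C := by
        by_contra hn; exact hvL ⟨hv, hn⟩
      exact (hu.2 ⟨c, hc, (h.child hZ hS hF hc).out v hvc u (h.csub hu.1) he⟩).elim
    · exact Or.inr hv
  · exact Or.inl ⟨hvX, hvZ, u, h.csub hu.1, he⟩

theorem Wm_bd (hZX : Z ⊆ X) (hZ : Conn E Z) (hS : Stuck E S T Z q) (hF : Fs E T Z q F) : ∀ (m : ℕ) (H : Set (Set V)) (C : Set V),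
    Nd E T Z q H C → bd E X (Wm E S T Z F m H C) ⊆ bd E X Z ∪ ⋃₀ H := by
  intro m
  induction m with
  | zero => rintro H C h v ⟨_, _, u, hu, _⟩; exact hu.elim
  | succ m ih =>
    rintro H C h v ⟨hvX, hv, u, hu, he⟩
    have hvL : v ∉ lay E S T Z F H C := fun h => hv (Or.inl h)
    rcases hu with hu | hu
    · exact lay_bd hZX hZ hS hF h ⟨hvX, hvL, u, hu, he⟩
    · simp only [mem_iUnion] at hu
      obtain ⟨c, hc, hu⟩ := hu
      have := ih _ _ (h.child hZ hS hF hc) ⟨hvX, fun hv' => hv (Or.inr ?_), u, hu, he⟩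
      · rw [sU] at this
        rcases this with h1 | h1 | h1
        · exact Or.inl h1
        · exact Or.inr h1
        · exact (hvL (F_lay hF h h1)).elim
      · simp only [mem_iUnion]; exact ⟨c, hc, hv'⟩

theorem near_sup {H : Set V} (h : Near E S T A) (hAB : A ⊆ B) (hH : H.Finite) (hT : T ∩ B ⊆ A ∪ H) : Near E S T B := by
  obtain ⟨G, hG, P, h1, h2, h3, h4⟩ := h
  refine near_of h1 (h2.trans hAB) h3 ((hG.union hH).subset ?_)
  rintro t ⟨ht, htP⟩
  rw [h4] at htP
  rcases hT ht with h | h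
  · grind
  · exact Or.inr h

theorem lay_near (hD : IsDimaze E T) (hL : Loose E X S T) (hZX : Z ⊆ X) (hK : (bd E X Z).Finite) (hZ : Conn E Z) (hS : Stuck E S T Z q)
    (hF : Fs E T Z q F) (h : Nd E T Z q H C) : Near E S T (lay E S T Z F H C) := by
  obtain ⟨f1, f2, -⟩ := hF H C h
  set R := pr E T (Z \ (⋃₀ H ∪ F H C)) with hR
  have hg : Near E S T (⋃₀ {c | Comp E R c ∧ Near E S T c ∧ c ⊆ C}) := by
    refine m5 hD hL (K := bd E X Z ∪ (⋃₀ H ∪ F H C)) ?_ (hK.union (h.fin.union f1.1)) ?_ ?_ ?_ ?_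
    · intro c hc c' hc' v hv hv'; exact hc.1.dis hc'.1 hv hv'
    · exact union_subset (fun v h => h.1) (union_subset (h.sub.trans hZX) ((f2.trans h.csub).trans hZX))
    · rintro c hc; exact hc.2.2.trans (h.csub.trans hZX)
    · rintro c hc v ⟨hvX, hvc, u, hu, he⟩
      by_cases hvZ : v ∈ Z
      · right; by_contra hn; exact hvc (comp_in hc.1 ⟨hvZ, hn⟩ hu he)
      · exact Or.inl ⟨hvX, hvZ, u, h.csub (hc.2.2 hu), he⟩
    · grind
  refine near_sup hg ?_ f1.1 ?_
  · rintro v ⟨c, hc, hv⟩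
    refine ⟨hc.2.2 hv, ?_⟩
    rintro ⟨c', hc', hv'⟩
    exact hc'.2.1 (hc.1.dis hc'.1 hv hv' ▸ hc.2.1)
  · rintro t ⟨htT, htC, htn⟩
    by_cases htF : t ∈ F H C
    · exact Or.inr htF
    · left
      have htR : t ∈ R := pr_T htT ⟨h.csub htC, fun h' => h'.elim (h.dis t htC) htF⟩
      have hc : Comp E R (cpt E R t) := comp_cpt htR
      have hcC : cpt E R t ⊆ C := by
        rintro v ⟨_, hv⟩
        have : ∀ v, Cn E R t v → v ∈ C := by
          intro v hv
          induction hv with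
          | refl => exact htC
          | tail _ h2 ih =>
            obtain ⟨h3, h4, h5⟩ := h2
            rcases h3 with h3 | h3
            · exact h.out _ ih _ h5.1.1 h3
            · exact (h.inn _ h5.1.1 _ ih h3).resolve_right fun h6 => h5.1.2 (Or.inl h6)
        exact this v hv
      refine ⟨_, ⟨hc, ?_, hcC⟩, self_cpt htR⟩
      by_contra hn
      exact htn ⟨_, ⟨hc, hn, hcC⟩, self_cpt htR⟩

theorem Wm_near (hD : IsDimaze E T) (hL : Loose E X S T) (hZX : Z ⊆ X) (hK : (bd E X Z).Finite) (hZ : Conn E Z) (hS : Stuck E S T Z q)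
    (hF : Fs E T Z q F) : ∀ (m : ℕ) (H : Set (Set V)) (C : Set V),
    Nd E T Z q H C → Near E S T (Wm E S T Z F m H C) := by
  intro m
  induction m with
  | zero =>
    intro H C _
    exact near_of (P := ∅) ⟨by simp, by simp⟩ (by rintro v ⟨l, hl, _⟩; exact hl.elim)
      (by rintro v ⟨l, hl, _⟩; exact hl.elim) (by simp [Wm])
  | succ m ih =>
    intro H C h
    obtain ⟨f1, f2, -⟩ := hF H C h
    have : Wm E S T Z F (m+1) H C = ⋃₀ (insert (lay E S T Z F H C)
      ((fun c => Wm E S T Z F m (insert (F H C) H) c) '' chd E S T Z F H C)) := by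
      rw [sUnion_insert, sUnion_image]; rfl
    rw [this]
    refine m5 hD hL (K := bd E X Z ∪ (⋃₀ H ∪ F H C)) ?_ (hK.union (h.fin.union f1.1)) ?_ ?_ ?_ ?_
    · rintro c (rfl | ⟨c, hc, rfl⟩) c' (rfl | ⟨c', hc', rfl⟩) v hv hv'
      · rfl
      · exact (hv.2 ⟨c', hc', Wm_sub _ _ _ hv'⟩).elim
      · exact (hv'.2 ⟨c, hc, Wm_sub _ _ _ hv⟩).elim
      · rw [chd_dis hc hc' (Wm_sub _ _ _ hv) (Wm_sub _ _ _ hv')]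
    · exact union_subset (fun v h => h.1) (union_subset (h.sub.trans hZX) ((f2.trans h.csub).trans hZX))
    · rintro c (rfl | ⟨c, hc, rfl⟩)
      · exact fun v hv => hZX (h.csub hv.1)
      · exact (Wm_sub _ _ _).trans (hc.2.2.trans (h.csub.trans hZX))
    · rintro c (rfl | ⟨c, hc, rfl⟩)
      · exact (lay_bd hZX hZ hS hF h).trans (union_subset_union_right _ subset_union_left)
      · have := Wm_bd hZX hZ hS hF m _ _ (h.child hZ hS hF hc)
        rwa [sU] at this
    · rintro c (rfl | ⟨c, hc, rfl⟩)
      · exact lay_near hD hL hZX hK hZ hS hF h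
      · exact ih _ _ (h.child hZ hS hF hc)
end

section
variable {E : V → V → Prop} {X S T A B C Z D W W' I L : Set V} {u v w x y q : V} {H : Set (Set V)}

def At (E : V → V → Prop) (S T W I : Set V) (Q : Set (List V)) : Prop :=
  Sys E Q ∧ (∀ v s, v :: s ∈ Q → ∀ x ∈ s, x ∈ W) ∧ Hd Q ⊆ (S ∩ W) ∪ I ∧ Lst Q = T ∩ W

theorem At.mono {Q : Set (List V)} (h : At E S T W I Q) (hI : I ⊆ D) : At E S T W D Q :=
  ⟨h.1, h.2.1, h.2.2.1.trans (union_subset_union_right _ hI), h.2.2.2⟩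

theorem tail_in {l : List V} (hl : (v :: l).IsChain E) (hW : ∀ z ∈ l, z ∈ W)
    (hin : ∀ a ∈ W, ∀ b ∈ W', E a b → a ∈ W') {t : V} (ht : (v :: l).getLast? = some t) (htW : t ∈ W') :
    (∀ z ∈ l, z ∈ W') ∧ (v ∈ W → v ∈ W') := by
  induction l generalizing v with
  | nil => simp at ht; subst ht; exact ⟨by simp, fun _ => htW⟩
  | cons b l ih =>
    rw [List.isChain_cons_cons] at hl
    obtain ⟨h1, h2⟩ := ih hl.2 (fun z hz => hW z (by simp [hz])) (by simpa using ht)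
    have hb := h2 (hW b (by simp))
    exact ⟨fun z hz => (List.mem_cons.1 hz).elim (fun h => h ▸ hb) (h1 z), fun h => hin v h b hb hl.1⟩

theorem At.restrict {Q : Set (List V)} (h : At E S T W I Q) (hs : W' ⊆ W)
    (hin : ∀ a ∈ W, ∀ b ∈ W', E a b → a ∈ W') : ∃ Q, At E S T W' I Q := by
  obtain ⟨h1, h2, h3, h4⟩ := h
  have key : ∀ v s, v :: s ∈ Q → ∀ t, (v :: s).getLast? = some t → t ∈ W' → (∀ z ∈ s, z ∈ W') ∧ (v ∈ W → v ∈ W') :=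
    fun v s hl t ht htW => tail_in (h1.1 _ hl).2.2 (h2 v s hl) hin ht htW
  refine ⟨{l ∈ Q | ∃ t ∈ W', l.getLast? = some t}, h1.sub (sep_subset _ _), ?_, ?_, ?_⟩
  · grind
  · rintro v ⟨l, ⟨hl, t, ht, htl⟩, hv⟩
    rcases h3 ⟨l, hl, hv⟩ with hv' | hv'
    · left
      obtain ⟨s, rfl⟩ := head_form hv
      exact ⟨hv'.1, (key v s hl t htl ht).2 hv'.2⟩
    · exact Or.inr hv'
  · ext t; constructor
    · rintro ⟨l, ⟨hl, t', ht, htl⟩, h⟩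
      have : t ∈ T ∩ W := h4 ▸ ⟨l, hl, h⟩
      rw [htl] at h; cases h; exact ⟨this.1, ht⟩
    · rintro ⟨ht, htW⟩
      have : t ∈ Lst Q := by grind
      obtain ⟨l, hl, h⟩ := this
      exact ⟨l, ⟨hl, t, htW, h⟩, h⟩

theorem sys_seg {Q P : Set (List V)} (hQ : Sys E Q) (h : ∀ l ∈ P, l ≠ [] ∧ ∃ a b, a ++ l ++ b ∈ Q)
    (hu : ∀ l ∈ P, ∀ l' ∈ P, ∀ a b a' b', a ++ l ++ b ∈ Q → a ++ l ++ b = a' ++ l' ++ b' →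
      (∃ z ∈ l, z ∈ l') → l = l') : Sys E P := by
  constructor
  · intro l hl
    obtain ⟨h1, a, b, h2⟩ := h l hl
    have h3 := (hQ.1 _ h2)
    rw [List.append_assoc] at h3
    exact (h3.suffix (by simp [h1])).prefix h1
  · grind

theorem split_mem {G : Set V} {a b a' b' : List V} (h : a ++ b = a' ++ b') (ha : ∀ v ∈ a, v ∈ G)
    (hb : ∀ v ∈ b, v ∉ G) (ha' : ∀ v ∈ a', v ∈ G) (hb' : ∀ v ∈ b', v ∉ G) : a = a' ∧ b = b' := by
  induction a generalizing a' with
  | nil =>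
    cases a' with
    | nil => simpa using h
    | cons x a' => simp at h; exact (hb x (by simp [h]) (ha' x (by simp))).elim
  | cons x a ih =>
    cases a' with
    | nil => simp at h; exact (hb' x (by simp [← h]) (ha x (by simp))).elim
    | cons y a' =>
      simp at h
      obtain ⟨rfl, h⟩ := h
      obtain ⟨h1, h2⟩ := ih h (fun v hv => ha v (by simp [hv])) (fun v hv => ha' v (by simp [hv]))
      exact ⟨by rw [h1], h2⟩

theorem first_split {G : Set V} {𝒸 : Set (Set V)} {l : List V} (hl : l.IsChain E)
    (hin : ∀ z ∈ l, z ∈ G ∨ ∃ c ∈ 𝒸, z ∈ c)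
    (hout : ∀ c ∈ 𝒸, ∀ a ∈ c, ∀ v s, l = v :: s → ∀ b ∈ s, E a b → b ∈ c) :
    ∃ p s, l = p ++ s ∧ (∀ v ∈ p, v ∈ G) ∧ (s = [] ∨ ∃ c ∈ 𝒸, ∀ v ∈ s, v ∈ c) := by
  have key : ∀ (l : List V) (a : V) (c : Set V), c ∈ 𝒸 → a ∈ c → (a :: l).IsChain E →
      (∀ a ∈ c, ∀ b ∈ l, E a b → b ∈ c) → ∀ z ∈ a :: l, z ∈ c := by
    intro l
    induction l with
    | nil => intro a c _ ha _ _ z hz; simp at hz; rwa [hz]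
    | cons b l ih =>
      intro a c hc ha hch ho z hz
      rw [List.isChain_cons_cons] at hch
      rcases List.mem_cons.1 hz with rfl | hz
      · exact ha
      · grind
  induction l with
  | nil => exact ⟨[], [], rfl, by simp, Or.inl rfl⟩
  | cons a l ih =>
    by_cases ha : a ∈ G
    · obtain ⟨p, s, h1, h2, h3⟩ := ih hl.tail (fun z hz => hin z (by simp [hz])) (by
        intro c hc x hx v s hs b hb he
        exact hout c hc x hx a l rfl b (by rw [hs]; simp [hb]) he)
      refine ⟨a :: p, s, by rw [h1]; rfl, ?_, h3⟩
      intro v hv; rcases List.mem_cons.1 hv with rfl | hv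
      · exact ha
      · exact h2 v hv
    · obtain ⟨c, hc, hac⟩ := (hin a (by simp)).resolve_left ha
      exact ⟨[], a :: l, rfl, by simp, Or.inr ⟨c, hc, key l a c hc hac hl (fun x hx b hb he =>
        hout c hc x hx a l rfl b hb he)⟩⟩

theorem step1 {𝒸 : Set (Set V)} {f : Set V → Set V} {Q : Set (List V)}
    (hQ : At E S T (L ∪ ⋃ c ∈ 𝒸, f c) I Q) (hf : ∀ c ∈ 𝒸, f c ⊆ c)
    (hdis : ∀ c ∈ 𝒸, ∀ c' ∈ 𝒸, ∀ v, v ∈ c → v ∈ c' → c = c') (hcL : ∀ c ∈ 𝒸, ∀ v ∈ c, v ∉ L ∪ I)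
    (hout : ∀ c ∈ 𝒸, ∀ a ∈ c, ∀ b ∈ L ∪ ⋃ c ∈ 𝒸, f c, E a b → b ∈ c) :
    ∃ (J : Set V → Set V) (P : Set (List V)), (∀ c ∈ 𝒸, ∃ Q', At E S T (f c) (J c) Q') ∧
      (∀ c ∈ 𝒸, ∀ c' ∈ 𝒸, ∀ v, v ∈ J c → v ∈ J c' → c = c') ∧
      (∀ c ∈ 𝒸, ∀ v ∈ J c, v ∈ L ∪ I ∧ ∃ u ∈ c, E v u) ∧
      Sys E P ∧ (∀ v s, v :: s ∈ P → ∀ x ∈ s, x ∈ L) ∧ Hd P ⊆ (S ∩ L) ∪ I ∧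
      (T ∩ L) ∪ (⋃ c ∈ 𝒸, J c) ⊆ Lst P := by
  obtain ⟨q1, q2, q3, q4⟩ := hQ
  set G := L ∪ I with hG
  set WW := L ∪ ⋃ c ∈ 𝒸, f c with hWW
  have hWc : ∀ z ∈ WW, ∀ c ∈ 𝒸, z ∈ c → z ∈ f c := by
    rintro z (hz | hz) c hc hzc
    · grind
    · simp only [mem_iUnion] at hz
      obtain ⟨c', hc', hz⟩ := hz
      rwa [hdis c hc c' hc' z hzc (hf c' hc' hz)]
  have hGW : ∀ z ∈ WW, z ∈ L ∨ ∃ c ∈ 𝒸, z ∈ c := by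
    rintro z (hz | hz)
    · exact Or.inl hz
    · simp only [mem_iUnion] at hz
      obtain ⟨c', hc', hz⟩ := hz
      exact Or.inr ⟨c', hc', hf c' hc' hz⟩
  have hV : ∀ l ∈ Q, ∀ z ∈ l, z ∈ WW ∨ (z ∈ I ∧ l.head? = some z) := by
    intro l hl z hz
    cases l with
    | nil => simp at hz
    | cons a l =>
      rcases List.mem_cons.1 hz with rfl | hz
      · rcases q3 ⟨_, hl, rfl⟩ with h | h
        · exact Or.inl h.2
        · exact Or.inr ⟨h, rfl⟩
      · grind
  have hsp : ∀ l ∈ Q, ∃ p s, l = p ++ s ∧ (∀ v ∈ p, v ∈ G) ∧ (s = [] ∨ ∃ c ∈ 𝒸, ∀ v ∈ s, v ∈ c) := by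
    intro l hl
    refine first_split (E := E) (q1.1 l hl).2.2 ?_ ?_
    · intro z hz
      rcases hV l hl z hz with h | h
      · grind
      · grind
    · grind
  have hcG : ∀ c ∈ 𝒸, ∀ v ∈ c, v ∉ G := hcL
  have hkey : ∀ p v s c, p ++ v :: s ∈ Q → c ∈ 𝒸 → v ∉ c → s ≠ [] → (∀ u ∈ s, u ∈ c) → ∀ z ∈ p ++ [v], z ∈ G := by
    intro p v s c hl hc hv hs hsc
    obtain ⟨p', s', e, hp', hs'⟩ := hsp _ hl
    obtain ⟨b, s, rfl⟩ := List.exists_cons_of_ne_nil hs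
    have hvG : v ∈ G := by
      by_contra hvG
      have hvs : v ∈ s' := by grind
      have hbs : b ∈ s' := by grind
      rcases hs' with rfl | ⟨c', hc', hs'⟩
      · simp at hvs
      · exact hv (hdis c hc c' hc' b (hsc b (by simp)) (hs' b hbs) ▸ hs' v hvs)
    have hp : ∀ z ∈ p, z ∈ G := by
      intro z hz
      by_contra hzG
      obtain ⟨p1, p2, rfl⟩ := List.append_of_mem hz
      have h1 : v ∈ s' := by
        have e2 : p1 ++ (z :: (p2 ++ v :: b :: s)) = p' ++ s' := by rw [← e]; simp
        rcases List.append_eq_append_iff.1 e2 with ⟨k, h1, h2⟩ | ⟨k, h1, h2⟩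
        · cases k with
          | nil => simp at h2; rw [← h2]; simp
          | cons y k =>
            simp at h2
            exact (hzG (hp' z (by rw [h1, h2.1]; simp))).elim
        · rw [h2]; simp
      rcases hs' with rfl | ⟨c', hc', hs'⟩
      · simp at h1
      · grind
    intro z hz
    rcases List.mem_append.1 hz with hz | hz
    · exact hp z hz
    · simp at hz; rwa [hz]
  set J : Set V → Set V := fun c => {v | ∃ p s, p ++ v :: s ∈ Q ∧ v ∉ c ∧ s ≠ [] ∧ ∀ u ∈ s, u ∈ c} with hJ
  set P : Set (List V) := {p | p ≠ [] ∧ (∀ v ∈ p, v ∈ G) ∧ ∃ s, p ++ s ∈ Q ∧ ∀ v ∈ s, v ∉ G} with hP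
  refine ⟨J, P, ?_, ?_, ?_, ?_, ?_, ?_, ?_⟩
  · intro c hc
    refine ⟨{l | (∃ p v s, l = v :: s ∧ p ++ v :: s ∈ Q ∧ v ∉ c ∧ s ≠ [] ∧ ∀ u ∈ s, u ∈ c) ∨
      (l ∈ Q ∧ ∀ u ∈ l, u ∈ c)}, ?_, ?_, ?_, ?_⟩
    · refine sys_seg (Q := Q) q1 ?_ ?_
      · rintro l (⟨p, v, s, rfl, h1, h2⟩ | ⟨h1, h2⟩)
        · exact ⟨by simp, p, [], by simpa using h1⟩
        · exact ⟨(q1.1 l h1).1, [], [], by simpa using h1⟩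
      · have main : ∀ l ∈ {l | (∃ p v s, l = v :: s ∧ p ++ v :: s ∈ Q ∧ v ∉ c ∧ s ≠ [] ∧ ∀ u ∈ s, u ∈ c) ∨
          (l ∈ Q ∧ ∀ u ∈ l, u ∈ c)}, ∀ a b, a ++ l ++ b ∈ Q → ∃ p, p ++ l = a ++ l ++ b ∧
            ((∃ v s, l = v :: s ∧ (∀ z ∈ p ++ [v], z ∉ c) ∧ s ≠ [] ∧ ∀ u ∈ s, u ∈ c) ∨ (p = [] ∧ ∀ u ∈ l, u ∈ c)) := by
          rintro l (⟨p, v, s, rfl, h1, h2, h3, h4⟩ | ⟨h1, h2⟩) a b hab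
          · refine ⟨p, q1.2 _ h1 _ hab v (by simp) (by simp), Or.inl ⟨v, s, rfl, ?_, h3, h4⟩⟩
            intro z hz hzc
            exact hcG c hc z hzc (hkey p v s c h1 hc h2 h3 h4 z hz)
          · obtain ⟨z, hz⟩ := List.exists_mem_of_ne_nil _ (q1.1 l h1).1
            exact ⟨[], q1.2 _ h1 _ hab z hz (by simp [hz]), Or.inr ⟨rfl, h2⟩⟩
        intro l hl l' hl' a b a' b' hab e _
        obtain ⟨p, hp, h⟩ := main l hl a b hab
        obtain ⟨p', hp', h'⟩ := main l' hl' a' b' (e ▸ hab)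
        have e2 : p ++ l = p' ++ l' := by rw [hp, hp', e]
        rcases h with ⟨v, s, rfl, h1, h2, h3⟩ | ⟨rfl, h1⟩ <;> rcases h' with ⟨v', s', rfl, h1', h2', h3'⟩ | ⟨rfl, h1'⟩
        · have e3 : (p ++ [v]) ++ s = (p' ++ [v']) ++ s' := by simpa using e2
          obtain ⟨e4, e5⟩ := split_mem (G := cᶜ) e3 h1 (fun z hz h => h (h3 z hz)) h1' (fun z hz h => h (h3' z hz))
          have := List.append_inj_right' e4 rfl
          simp at this; rw [this, e5]
        · exact (h1 v (by simp) (h1' v (by simp at e2; rw [← e2]; simp))).elim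
        · exact (h1' v' (by simp) (h1 v' (by simp at e2; rw [e2]; simp))).elim
        · simpa using e2
    · rintro v s (⟨p, v', s', e, h1, h2, h3, h4⟩ | ⟨h1, h2⟩) x hx
      · grind
      · grind
    · rintro v ⟨l, (⟨p, v', s', rfl, h1, h2, h3, h4⟩ | ⟨h1, h2⟩), hv⟩
      · grind
      · left
        have hvc := h2 v (List.mem_of_mem_head? hv)
        rcases q3 ⟨l, h1, hv⟩ with h | h
        · grind
        · grind
    · ext t; constructor
      · rintro ⟨l, (⟨p, v', s', rfl, h1, h2, h3, h4⟩ | ⟨h1, h2⟩), ht⟩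
        · have : t ∈ T ∩ WW := by
            rw [← q4]; exact ⟨_, h1, by rw [← ht]; exact List.getLast?_append_cons _ _ _⟩
          refine ⟨this.1, hWc t this.2 c hc (h4 t ?_)⟩
          obtain ⟨b, s', rfl⟩ := List.exists_cons_of_ne_nil h3
          rw [List.getLast?_cons_cons] at ht
          exact List.mem_of_getLast? ht
        · have : t ∈ T ∩ WW := by rw [← q4]; exact ⟨_, h1, ht⟩
          exact ⟨this.1, hWc t this.2 c hc (h2 t (List.mem_of_getLast? ht))⟩
      · rintro ⟨htT, htc⟩
        have : t ∈ Lst Q := by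
          rw [q4]; refine ⟨htT, Or.inr ?_⟩; simp only [mem_iUnion]; exact ⟨c, hc, htc⟩
        obtain ⟨l, hl, hlt⟩ := this
        obtain ⟨p, s, rfl, hp, hs⟩ := hsp l hl
        have hts : t ∈ s := by grind
        obtain ⟨c', hc', hs'⟩ := hs.resolve_left (fun h => by simp [h] at hts)
        cases hdis c hc c' hc' t (hf c hc htc) (hs' t hts)
        have hsn : s ≠ [] := fun h => by simp [h] at hts
        rcases List.eq_nil_or_concat p with rfl | ⟨p, v, rfl⟩
        · exact ⟨s, Or.inr ⟨by simpa using hl, hs'⟩, by simpa using hlt⟩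
        · refine ⟨v :: s, Or.inl ⟨p, v, s, rfl, by simpa using hl, fun h => hcG c hc v h (hp v (by simp)), hsn, hs'⟩, ?_⟩
          rw [← hlt]; simp only [List.concat_eq_append, List.append_assoc, List.singleton_append]
          exact (List.getLast?_append_cons _ _ _).symm
  · rintro c hc c' hc' v ⟨p, s, h1, h2, h3, h4⟩ ⟨p', s', h1', h2', h3', h4'⟩
    have e := q1.2 _ h1 _ h1' v (by simp) (by simp)
    have hn := (q1.1 _ h1).2.1
    obtain ⟨-, e⟩ := split_uniq e hn
    subst e
    obtain ⟨b, s, rfl⟩ := List.exists_cons_of_ne_nil h3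
    exact hdis c hc c' hc' b (h4 b (by simp)) (h4' b (by simp))
  · rintro c hc v ⟨p, s, h1, h2, h3, h4⟩
    refine ⟨hkey p v s c h1 hc h2 h3 h4 v (by simp), ?_⟩
    obtain ⟨b, s, rfl⟩ := List.exists_cons_of_ne_nil h3
    have := (q1.1 _ h1).2.2
    exact ⟨b, h4 b (by simp), (List.isChain_cons_cons.1 this.right_of_append).1⟩
  · refine sys_seg (Q := Q) q1 ?_ ?_
    · rintro p ⟨h1, h2, s, h3, _⟩; exact ⟨h1, [], s, by simpa using h3⟩
    · rintro p ⟨h1, h2, s, h3, h4⟩ p' ⟨h1', h2', s', h3', h4'⟩ a b a' b' _ _ ⟨z, hz, hz'⟩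
      exact (split_mem (q1.2 _ h3 _ h3' z (by simp [hz]) (by simp [hz'])) h2 h4 h2' h4').1
  · rintro v s ⟨h1, h2, s', h3, h4⟩ x hx
    have h5 := q2 v (s ++ s') h3 x (by simp [hx])
    rcases h2 x (by simp [hx]) with h | h
    · exact h
    · refine (hGW x h5).resolve_right ?_
      rintro ⟨c, hc, hxc⟩; exact hcG c hc x hxc (Or.inr h)
  · rintro v ⟨p, ⟨h1, h2, s', h3, h4⟩, hv⟩
    obtain ⟨s, rfl⟩ := head_form hv
    rcases q3 ⟨_, h3, rfl⟩ with h | h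
    · grind
    · exact Or.inr h
  · rintro t (ht | ht)
    · have : t ∈ Lst Q := by rw [q4]; exact ⟨ht.1, Or.inl ht.2⟩
      obtain ⟨l, hl, hlt⟩ := this
      obtain ⟨p, s, rfl, hp, hs⟩ := hsp l hl
      have hs0 : s = [] := by
        rcases hs with h | ⟨c, hc, hs⟩
        · exact h
        · by_contra hn
          obtain ⟨b, s, rfl⟩ := List.exists_cons_of_ne_nil hn
          rw [List.getLast?_append_cons] at hlt
          exact hcG c hc t (hs t (List.mem_of_getLast? hlt)) (Or.inl ht.2)
      subst hs0
      exact ⟨p, ⟨by simpa using (q1.1 _ hl).1, hp, [], hl, by simp⟩, by simpa using hlt⟩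
    · simp only [mem_iUnion] at ht
      obtain ⟨c, hc, p, s, h1, h2, h3, h4⟩ := ht
      refine ⟨p ++ [t], ⟨by simp, hkey p t s c h1 hc h2 h3 h4, s, by simpa using h1, fun v hv => hcG c hc v (h4 v hv)⟩, by simp⟩
end

section
variable {E : V → V → Prop} {X S T A B C Z D W W' I L : Set V} {u v w x y q : V} {H : Set (Set V)}
  {F : Set (Set V) → Set V → Set V}

theorem Wm_mono {m : ℕ} : ∀ (n : ℕ) (H : Set (Set V)) (C : Set V), m ≤ n → Wm E S T Z F m H C ⊆ Wm E S T Z F n H C := by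
  induction m with
  | zero => intro n H C _ v hv; exact hv.elim
  | succ m ih =>
    intro n H C h
    obtain ⟨n, rfl⟩ : ∃ k, n = k + 1 := ⟨n - 1, by omega⟩
    exact union_subset_union_right _ (iUnion₂_mono fun c _ => ih n _ c (by omega))

theorem Nd.step (hZX : Z ⊆ X) (hZ : Conn E Z) (hS : Stuck E S T Z q) (hF : Fs E T Z q F) (h : Nd E T Z q H C)
    (hA : ∀ m, ∃ Q, At E S T (Wm E S T Z F m H C) I Q) (hIC : ∀ v ∈ I, v ∉ C) (hI : I.Finite) :
    ∃ (J : Set V → Set V) (P : Set (List V)),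
      (∀ c ∈ chd E S T Z F H C, (∀ m, ∃ Q, At E S T (Wm E S T Z F m (insert (F H C) H) c) (J c) Q) ∧ (J c).Finite) ∧
      (∀ c ∈ chd E S T Z F H C, ∀ c' ∈ chd E S T Z F H C, ∀ v, v ∈ J c → v ∈ J c' → c = c') ∧
      (∀ c ∈ chd E S T Z F H C, ∀ v ∈ J c, v ∈ lay E S T Z F H C ∪ I ∧ ∃ u ∈ c, E v u) ∧
      Sys E P ∧ (∀ v s, v :: s ∈ P → ∀ x ∈ s, x ∈ lay E S T Z F H C) ∧ Hd P ⊆ (S ∩ lay E S T Z F H C) ∪ I ∧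
      Lst P = (T ∩ lay E S T Z F H C) ∪ (⋃ c ∈ chd E S T Z F H C, J c) := by
  set L := lay E S T Z F H C with hLd
  set 𝒸 := chd E S T Z F H C with h𝒸
  have hcL : ∀ c ∈ 𝒸, ∀ v ∈ c, v ∉ L ∪ I := by
    rintro c hc v hv (h1 | h1)
    · exact h1.2 ⟨c, hc, hv⟩
    · exact hIC v h1 (hc.2.2 hv)
  have hst : ∀ m : ℕ, ∃ (J : Set V → Set V) (P : Set (List V)),
      (∀ c ∈ 𝒸, ∃ Q', At E S T (Wm E S T Z F m (insert (F H C) H) c) (J c) Q') ∧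
      (∀ c ∈ 𝒸, ∀ c' ∈ 𝒸, ∀ v, v ∈ J c → v ∈ J c' → c = c') ∧
      (∀ c ∈ 𝒸, ∀ v ∈ J c, v ∈ L ∪ I ∧ ∃ u ∈ c, E v u) ∧
      Sys E P ∧ (∀ v s, v :: s ∈ P → ∀ x ∈ s, x ∈ L) ∧ Hd P ⊆ (S ∩ L) ∪ I ∧
      (T ∩ L) ∪ (⋃ c ∈ 𝒸, J c) ⊆ Lst P := by
    intro m
    obtain ⟨Q, hQ⟩ := hA (m+1)
    refine step1 (f := fun c => Wm E S T Z F m (insert (F H C) H) c) (Q := Q) hQ (fun c _ => Wm_sub _ _ _)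
      (fun c hc c' hc' v => chd_dis hc hc') hcL ?_
    intro c hc a ha b hb he
    refine (h.child hZ hS hF hc).out a ha b (h.csub (Wm_sub (m+1) H C hb)) he
  choose J P j1 j2 j3 j4 j5 j6 j7 using hst
  obtain ⟨f1, f2, -⟩ := hF H C h
  set Kf := ⋃₀ H ∪ F H C ∪ I with hKf
  have hKfin : Kf.Finite := (h.fin.union f1.1).union hI
  have hJK : ∀ m, ∀ c ∈ 𝒸, J m c ⊆ Kf := by
    intro m c hc v hv
    obtain ⟨h1, u, hu, he⟩ := j3 m c hc v hv
    rcases h1 with h1 | h1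
    · left
      have := ((h.child hZ hS hF hc).inn v (h.csub h1.1) u hu he).resolve_left fun h2 => h1.2 ⟨c, hc, h2⟩
      rwa [sU] at this
    · exact Or.inr h1
  set 𝒰 := Filter.hyperfilter ℕ
  have hU : ∀ m : ℕ, ∀ᶠ n in (𝒰 : Filter ℕ), m ≤ n := by
    intro m
    refine Filter.hyperfilter_le_cofinite ?_
    rw [Filter.mem_cofinite]
    refine (finite_lt_nat m).subset ?_
    intro n hn; simpa using hn
  set G : Set V → Set V := fun c => {v | ∀ᶠ m in (𝒰 : Filter ℕ), v ∈ J m c} with hG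
  have hG3 : ∀ c ∈ 𝒸, ∀ v ∈ G c, ∃ m, v ∈ J m c := fun c _ v hv => hv.exists
  have hGK : ∀ c ∈ 𝒸, G c ⊆ Kf := fun c hc v hv => by
    obtain ⟨m, hm⟩ := hG3 c hc v hv; exact hJK m c hc hm
  have hev : ∀ c ∈ 𝒸, ∀ᶠ m in (𝒰 : Filter ℕ), ∀ v ∈ Kf, v ∈ J m c → v ∈ G c := by
    intro c hc
    rw [Filter.eventually_all_finite hKfin]
    intro v _
    by_cases hv : v ∈ G c
    · exact Filter.Eventually.of_forall fun _ _ => hv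
    · have : ∀ᶠ m in (𝒰 : Filter ℕ), ¬ v ∈ J m c := Ultrafilter.eventually_not.2 hv
      exact this.mono fun m h1 h2 => (h1 h2).elim
  obtain ⟨m, hm⟩ : ∃ m, ∀ v ∈ Kf, v ∈ (⋃ c ∈ 𝒸, G c) → v ∈ (⋃ c ∈ 𝒸, J m c) := by
    have : ∀ᶠ m in (𝒰 : Filter ℕ), ∀ v ∈ Kf, v ∈ (⋃ c ∈ 𝒸, G c) → v ∈ (⋃ c ∈ 𝒸, J m c) := by
      rw [Filter.eventually_all_finite hKfin]
      intro v _
      by_cases hv : v ∈ ⋃ c ∈ 𝒸, G c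
      · have hv' := hv
        simp only [mem_iUnion] at hv'
        obtain ⟨c, hc, hvc⟩ := hv'
        exact Filter.Eventually.mono hvc fun m h1 _ => by simp only [mem_iUnion]; exact ⟨c, hc, h1⟩
      · exact Filter.Eventually.of_forall fun _ h => (hv h).elim
    exact this.exists
  have hGT : (⋃ c ∈ 𝒸, G c) ⊆ Lst (P m) := by
    intro v hv
    refine j7 m (Or.inr (hm v ?_ hv))
    simp only [mem_iUnion] at hv
    obtain ⟨c, hc, hvc⟩ := hv
    exact hGK c hc hvc
  refine ⟨G, {l ∈ P m | ∃ t ∈ (T ∩ L) ∪ (⋃ c ∈ 𝒸, G c), l.getLast? = some t}, ?_, ?_, ?_, (j4 m).sub (sep_subset _ _), ?_, ?_, ?_⟩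
  · intro c hc
    refine ⟨fun k => ?_, hKfin.subset (hGK c hc)⟩
    obtain ⟨n, h1, h2⟩ := ((hev c hc).and (hU k)).exists
    obtain ⟨Q, hQ⟩ := j1 n c hc
    have hch := h.child hZ hS hF hc
    refine (hQ.mono fun v hv => h1 v (hJK n c hc hv) hv).restrict (Wm_mono n _ c h2) ?_
    intro a ha b hb he
    by_contra hn
    have hac := Wm_sub n _ _ ha
    rcases Wm_bd hZX hZ hS hF k _ _ hch ⟨hZX (hch.csub hac), hn, b, hb, he⟩ with h3 | h3
    · exact h3.2.1 (hch.csub hac)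
    · exact hch.dis a hac h3
  · intro c hc c' hc' v hv hv'
    obtain ⟨n, h1, h2⟩ := (Filter.Eventually.and hv hv').exists
    exact j2 n c hc c' hc' v h1 h2
  · intro c hc v hv
    obtain ⟨n, hn⟩ := hG3 c hc v hv
    exact j3 n c hc v hn
  · grind
  · rintro v ⟨l, ⟨hl, _⟩, hv⟩; exact j6 m ⟨l, hl, hv⟩
  · ext t; constructor
    · rintro ⟨l, ⟨hl, t', ht', h1⟩, h2⟩
      rw [h1] at h2; cases h2; exact ht'
    · intro ht
      have : t ∈ Lst (P m) := by
        rcases ht with h1 | h1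
        · exact j7 m (Or.inl h1)
        · exact hGT h1
      obtain ⟨l, hl, hlt⟩ := this
      exact ⟨l, ⟨hl, t, ht, hlt⟩, hlt⟩
end

section
variable {E : V → V → Prop} {X S T A B C Z D W W' I L K : Set V} {u v w x y q : V} {H : Set (Set V)}
  {F : Set (Set V) → Set V → Set V}

abbrev Tr (V : Type*) := Set (Set V) × Set V × Set V

structure Iv (E : V → V → Prop) (S T Z K : Set V) (q : V) (F : Set (Set V) → Set V → Set V)
    (N : Set (Tr V)) (Q : Set (List V)) : Prop where
  nd : ∀ n ∈ N, Nd E T Z q n.1 n.2.1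
  at' : ∀ n ∈ N, ∀ m, ∃ Q, At E S T (Wm E S T Z F m n.1 n.2.1) n.2.2 Q
  fi : ∀ n ∈ N, n.2.2.Finite
  nT : ∀ n ∈ N, ∀ v ∈ n.2.2, v ∉ T
  nK : ∀ n ∈ N, ∀ v ∈ n.2.2, v ∈ K ∨ (v ∈ Z ∧ ∀ n ∈ N, v ∉ n.2.1)
  dC : ∀ n ∈ N, ∀ n' ∈ N, ∀ v, v ∈ n.2.1 → v ∈ n'.2.1 → n = n'
  dI : ∀ n ∈ N, ∀ n' ∈ N, ∀ v, v ∈ n.2.2 → v ∈ n'.2.2 → n = n'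
  sys : Sys E Q
  vs : ∀ v ∈ Vs Q, v ∈ K ∨ (v ∈ Z ∧ ∀ n ∈ N, v ∉ n.2.1)
  hd : Hd Q ⊆ S ∪ K
  lst : ∀ v, v ∈ Lst Q ↔ (v ∈ T ∧ v ∈ Z ∧ ∀ n ∈ N, v ∉ n.2.1) ∨ ∃ n ∈ N, v ∈ n.2.2

theorem Iv.step (hD : IsDimaze E T) (hZX : Z ⊆ X) (hZ : Conn E Z) (hS : Stuck E S T Z q) (hF : Fs E T Z q F)
    (hKZ : ∀ v ∈ K, v ∉ Z) {N : Set (Tr V)} {Q : Set (List V)} (h : Iv E S T Z K q F N Q) :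
    ∃ N' Q', Iv E S T Z K q F N' Q' ∧
      (∀ n' ∈ N', ∃ n ∈ N, n'.1 = insert (F n.1 n.2.1) n.1 ∧ n'.2.1 ∈ chd E S T Z F n.1 n.2.1) ∧
      ∀ l ∈ Q, (∃ t ∈ T, l.getLast? = some t) → l ∈ Q' := by
  have hKC : ∀ n ∈ N, ∀ v ∈ K, v ∉ n.2.1 := fun n hn v hv hc => hKZ v hv ((h.nd n hn).csub hc)
  have hIC : ∀ n ∈ N, ∀ v ∈ n.2.2, ∀ n' ∈ N, v ∉ n'.2.1 := by
    intro n hn v hv n' hn'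
    rcases h.nK n hn v hv with h1 | h1
    · exact hKC n' hn' v h1
    · exact h1.2 n' hn'
  have hst : ∀ n : Tr V, ∃ (J : Set V → Set V) (P : Set (List V)), n ∈ N → _ := fun n => by
    by_cases hn : n ∈ N
    · obtain ⟨J, P, h1⟩ := Nd.step hZX hZ hS hF (h.nd n hn) (h.at' n hn) (fun v hv => hIC n hn v hv n hn) (h.fi n hn)
      exact ⟨J, P, fun _ => h1⟩
    · exact ⟨fun _ => ∅, ∅, fun h => (hn h).elim⟩
  choose J P hJP using hst
  have hlC : ∀ n : Tr V, lay E S T Z F n.1 n.2.1 ⊆ n.2.1 := fun n => sdiff_subset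
  have hPm : ∀ n ∈ N, ∀ b ∈ P n, ∀ u ∈ b, (u ∈ lay E S T Z F n.1 n.2.1) ∨ (u ∈ n.2.2 ∧ b.head? = some u) := by
    intro n hn b hb u hu
    obtain ⟨-, -, -, p4, p5, p6, -⟩ := hJP n hn
    cases b with
    | nil => simp at hu
    | cons v s =>
      rcases List.mem_cons.1 hu with rfl | hu
      · rcases p6 ⟨_, hb, rfl⟩ with h1 | h1
        · exact Or.inl h1.2
        · exact Or.inr ⟨h1, rfl⟩
      · exact Or.inl (p5 v s hb u hu)
  set Bs : Set (List V) := {b | ∃ n ∈ N, b ∈ P n} with hBs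
  have hB : Sys E Bs := by
    refine ⟨fun l ⟨n, hn, hl⟩ => (hJP n hn).2.2.2.1.1 l hl, ?_⟩
    rintro l ⟨n, hn, hl⟩ m ⟨n', hn', hm⟩ v hv hv'
    have : n = n' := by
      rcases hPm n hn l hl v hv with h1 | h1 <;> rcases hPm n' hn' m hm v hv' with h2 | h2
      · exact h.dC n hn n' hn' v (hlC n h1) (hlC n' h2)
      · exact (hIC n' hn' v h2.1 n hn (hlC n h1)).elim
      · exact (hIC n hn v h1.1 n' hn' (hlC n' h2)).elim
      · exact h.dI n hn n' hn' v h1.1 h2.1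
    subst this
    exact (hJP n hn).2.2.2.1.2 l hl m hm v hv hv'
  set UI : Set V := {v | ∃ n ∈ N, v ∈ n.2.2} with hUI
  have hHdB : ∀ v ∈ Hd Bs, v ∉ UI → v ∈ S ∧ ∃ n ∈ N, v ∈ lay E S T Z F n.1 n.2.1 := by
    rintro v ⟨b, ⟨n, hn, hb⟩, hv⟩ hvI
    rcases (hJP n hn).2.2.2.2.2.1 ⟨b, hb, hv⟩ with h1 | h1
    · exact ⟨h1.1, n, hn, h1.2⟩
    · exact (hvI ⟨n, hn, h1⟩).elim
  have hQC : ∀ v ∈ Vs Q, ∀ n ∈ N, v ∉ n.2.1 := by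
    intro v hv n hn
    rcases h.vs v hv with h1 | h1
    · exact hKC n hn v h1
    · exact h1.2 n hn
  set As : Set (List V) := Q ∪ {l | ∃ s, s ∈ Hd Bs ∧ s ∉ UI ∧ l = [s]} with hAs
  have hA : Sys E As := by
    constructor
    · rintro l (hl | ⟨s, -, -, rfl⟩)
      · exact h.sys.1 l hl
      · exact ⟨by simp, by simp, by simp⟩
    · have key : ∀ l ∈ Q, ∀ s ∈ Hd Bs, s ∉ UI → s ∉ l := by
        intro l hl s hs hsI hsl
        obtain ⟨-, n, hn, h1⟩ := hHdB s hs hsI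
        exact hQC s ⟨l, hl, hsl⟩ n hn (hlC n h1)
      rintro l (hl | ⟨s, h1, h2, rfl⟩) m (hm | ⟨s', h3, h4, rfl⟩) v hv hv'
      · exact h.sys.2 l hl m hm v hv hv'
      · simp at hv'; subst hv'; exact (key l hl v h3 h4 hv).elim
      · simp at hv; subst hv; exact (key m hm v h1 h2 hv').elim
      · simp at hv hv'; rw [← hv, ← hv']
  have hcomp := comp_sys hA hB (by
    rintro a ha b hb' u hua hub
    obtain ⟨n, hn, hb⟩ := hb'
    rcases ha with ha | ⟨s, h1, h2, rfl⟩
    · rcases hPm n hn b hb u hub with h1 | h1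
      · exact (hQC u ⟨a, ha, hua⟩ n hn (hlC n h1)).elim
      · refine ⟨?_, h1.2⟩
        obtain ⟨a', ha', hl⟩ := (h.lst u).2 (Or.inr ⟨n, hn, h1.1⟩)
        rw [h.sys.2 a ha a' ha' u hua (List.mem_of_getLast? hl)]; exact hl
    · simp at hua; subst hua
      refine ⟨rfl, ?_⟩
      obtain ⟨b', hb', hx⟩ := h1
      rw [hB.2 b ⟨n, hn, hb⟩ b' hb' u hub (List.mem_of_head? hx)]; exact hx)
  have hHA : Hd Bs ⊆ Lst As := by
    intro v hv
    by_cases hI : v ∈ UI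
    · obtain ⟨l, hl, hx⟩ := (h.lst v).2 (Or.inr hI); exact ⟨l, Or.inl hl, hx⟩
    · exact ⟨[v], Or.inr ⟨v, hv, hI, rfl⟩, rfl⟩
  have hcL := comp_Lst hHA fun b hb => (hB.1 b hb).1
  have hTH : ∀ v ∈ T, v ∈ Lst Q → v ∉ Hd Bs := by
    rintro v hvT hvQ hvB
    by_cases hI : v ∈ UI
    · obtain ⟨n, hn, hv⟩ := hI; exact h.nT n hn v hv hvT
    · obtain ⟨-, n, hn, h1⟩ := hHdB v hvB hI
      exact hQC v (Lst_sub_Vs _ hvQ) n hn (hlC n h1)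
  set N' : Set (Tr V) := {n' | ∃ n ∈ N, ∃ c ∈ chd E S T Z F n.1 n.2.1, n' = (insert (F n.1 n.2.1) n.1, c, J n c)} with hN'
  have hnew : ∀ v, (∀ n ∈ N, v ∉ n.2.1) → ∀ n' ∈ N', v ∉ n'.2.1 := by
    rintro v hv n' ⟨n, hn, c, hc, rfl⟩ hvc
    exact hv n hn (hc.2.2 hvc)
  have hnewL : ∀ n ∈ N, ∀ v ∈ lay E S T Z F n.1 n.2.1, v ∈ Z ∧ ∀ n' ∈ N', v ∉ n'.2.1 := by
    rintro n hn v hv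
    refine ⟨(h.nd n hn).csub hv.1, ?_⟩
    rintro n' ⟨n1, hn1, c, hc, rfl⟩ hvc
    have := h.dC n hn n1 hn1 v hv.1 (hc.2.2 hvc)
    subst this
    exact hv.2 ⟨c, hc, hvc⟩
  have hnewI : ∀ n ∈ N, ∀ v ∈ n.2.2, v ∈ K ∨ (v ∈ Z ∧ ∀ n' ∈ N', v ∉ n'.2.1) := by
    intro n hn v hv
    rcases h.nK n hn v hv with h1 | h1
    · exact Or.inl h1
    · exact Or.inr ⟨h1.1, hnew v h1.2⟩
  have hold : ∀ v ∈ Z, (∀ n' ∈ N', v ∉ n'.2.1) → (∀ n ∈ N, v ∉ n.2.1) ∨ ∃ n ∈ N, v ∈ lay E S T Z F n.1 n.2.1 := by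
    intro v hvZ hv
    by_contra hh
    push Not at hh
    obtain ⟨⟨n, hn, hvn⟩, h2⟩ := hh
    refine h2 n hn ⟨hvn, ?_⟩
    rintro ⟨c, hc, hvc⟩
    exact hv _ ⟨n, hn, c, hc, rfl⟩ hvc
  set G : Set V := {v | (v ∈ T ∧ v ∈ Z ∧ ∀ n ∈ N', v ∉ n.2.1) ∨ ∃ n ∈ N', v ∈ n.2.2} with hG
  refine ⟨N', {l ∈ comp As Bs | ∃ v ∈ G, l.getLast? = some v}, ?_, ?_, ?_⟩
  · constructor
    · rintro _ ⟨n, hn, c, hc, rfl⟩; exact (h.nd n hn).child hZ hS hF hc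
    · rintro _ ⟨n, hn, c, hc, rfl⟩; exact ((hJP n hn).1 c hc).1
    · rintro _ ⟨n, hn, c, hc, rfl⟩; exact ((hJP n hn).1 c hc).2
    · rintro _ ⟨n, hn, c, hc, rfl⟩ v hv hvT
      obtain ⟨-, u, -, he⟩ := (hJP n hn).2.2.1 c hc v hv
      exact hD v hvT u he
    · rintro _ ⟨n, hn, c, hc, rfl⟩ v hv
      rcases ((hJP n hn).2.2.1 c hc v hv).1 with h1 | h1
      · exact Or.inr (hnewL n hn v h1)
      · exact hnewI n hn v h1
    · rintro _ ⟨n, hn, c, hc, rfl⟩ _ ⟨n', hn', c', hc', rfl⟩ v hv hv'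
      have := h.dC n hn n' hn' v (hc.2.2 hv) (hc'.2.2 hv')
      subst this
      have := chd_dis hc hc' hv hv'
      subst this; rfl
    · rintro _ ⟨n, hn, c, hc, rfl⟩ _ ⟨n', hn', c', hc', rfl⟩ v hv hv'
      have : n = n' := by
        rcases ((hJP n hn).2.2.1 c hc v hv).1 with h1 | h1 <;> rcases ((hJP n' hn').2.2.1 c' hc' v hv').1 with h2 | h2
        · exact h.dC n hn n' hn' v (hlC n h1) (hlC n' h2)
        · exact (hIC n' hn' v h2 n hn (hlC n h1)).elim
        · exact (hIC n hn v h1 n' hn' (hlC n' h2)).elim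
        · exact h.dI n hn n' hn' v h1 h2
      subst this
      have := (hJP n hn).2.1 c hc c' hc' v hv hv'
      subst this; rfl
    · exact hcomp.sub (sep_subset _ _)
    · rintro v ⟨l, ⟨hl, -⟩, hv⟩
      have hBv : v ∈ Vs Bs → v ∈ K ∨ (v ∈ Z ∧ ∀ n' ∈ N', v ∉ n'.2.1) := by
        rintro ⟨b, ⟨n, hn, hb⟩, hvb⟩
        rcases hPm n hn b hb v hvb with h1 | h1
        · exact Or.inr (hnewL n hn v h1)
        · exact hnewI n hn v h1.1
      rcases comp_Vs As Bs ⟨l, hl, hv⟩ with ⟨a, ha | ⟨s, h1, h2, rfl⟩, hva⟩ | h1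
      · rcases h.vs v ⟨a, ha, hva⟩ with h1 | h1
        · exact Or.inl h1
        · exact Or.inr ⟨h1.1, hnew v h1.2⟩
      · simp at hva; subst hva
        exact hBv (Hd_sub_Vs _ h1)
      · exact hBv h1
    · rintro v ⟨l, ⟨hl, -⟩, hv⟩
      have : v ∈ Hd (comp As Bs) := ⟨l, hl, hv⟩
      rw [comp_Hd] at this
      obtain ⟨a, ha | ⟨s, h1, h2, rfl⟩, hva⟩ := this
      · exact h.hd ⟨a, ha, hva⟩
      · simp at hva; subst hva
        exact Or.inl (hHdB _ h1 h2).1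
    · intro v
      change _ ↔ v ∈ G
      constructor
      · rintro ⟨l, ⟨hl, w, hw, hlw⟩, hv⟩
        rw [hlw] at hv; cases hv; exact hw
      · intro hv
        have : v ∈ Lst (comp As Bs) := by
          rw [hcL]
          rcases hv with ⟨h1, h2, h3⟩ | ⟨_, ⟨n, hn, c, hc, rfl⟩, hv⟩
          · rcases hold v h2 h3 with h4 | ⟨n, hn, h4⟩
            · have h5 : v ∈ Lst Q := (h.lst v).2 (Or.inl ⟨h1, h2, h4⟩)
              obtain ⟨l, hl, hx⟩ := h5
              exact Or.inr ⟨⟨l, Or.inl hl, hx⟩, hTH v h1 ⟨l, hl, hx⟩⟩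
            · have : v ∈ Lst (P n) := by rw [(hJP n hn).2.2.2.2.2.2]; exact Or.inl ⟨h1, h4⟩
              obtain ⟨l, hl, hx⟩ := this
              exact Or.inl ⟨l, ⟨n, hn, hl⟩, hx⟩
          · have : v ∈ Lst (P n) := by
              rw [(hJP n hn).2.2.2.2.2.2]; right; simp only [mem_iUnion]; exact ⟨c, hc, hv⟩
            obtain ⟨l, hl, hx⟩ := this
            exact Or.inl ⟨l, ⟨n, hn, hl⟩, hx⟩
        obtain ⟨l, hl, hx⟩ := this
        exact ⟨l, ⟨hl, v, hv, hx⟩, hx⟩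
  · grind
  · rintro l hl ⟨t, ht, hlt⟩
    have htQ : t ∈ Lst Q := ⟨l, hl, hlt⟩
    refine ⟨Or.inr ⟨Or.inl hl, ?_⟩, t, Or.inl ⟨ht, ?_⟩, hlt⟩
    · intro v hv; rw [hlt] at hv; cases hv; exact hTH t ht htQ
    · rcases (h.lst t).1 htQ with h1 | ⟨n, hn, h1⟩
      · exact ⟨h1.2.1, hnew t h1.2.2⟩
      · exact (h.nT n hn t h1 ht).elim
end

section
variable {E : V → V → Prop} {X S T A B C Z D W W' I L K : Set V} {u v w x y q : V} {H : Set (Set V)}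
  {F : Set (Set V) → Set V → Set V}

def Rds (E : V → V → Prop) (T X : Set V) : Prop :=
  ∃ (A : ℕ → Set V) (x : ℕ → V) (l : ℕ → List (V × Bool)), (∀ k, ZW E T (A k) true (x k) (l k) true (x (k+1))) ∧
    (∀ i j, i ≠ j → Disjoint (A i) (A j)) ∧ (∀ k, ∃ a ∈ l k, a.2 = false) ∧ ∀ k, A k ⊆ X

theorem ladder (G : ℕ → Set V) (hZ : ∀ n, G n ⊆ Z) (hG : ∀ n, Fat E T (G n)) (hd : ∀ i j, i < j → Disjoint (G i) (G j))
    (he : ∀ i j, i < j → ∃ a ∈ G i, ∃ c ∈ G j, E a c) : Rds E T Z := by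
  have hd' : ∀ i j, i ≠ j → Disjoint (G i) (G j) := fun i j h => by
    rcases lt_or_gt_of_ne h with h | h
    · exact hd i j h
    · exact (hd j i h).symm
  choose a ha x hx hax using fun k : ℕ => he (2*k) (2*k+3) (by omega)
  choose b hb y hy hby using fun k : ℕ => he (2*k+2) (2*k+3) (by omega)
  have h1 : ∀ k, ∃ l, ZW E T (G (2*k+3)) true (x k) l false (b k) := fun k =>
    (hG (2*k+3)).zw true (hx k) (hy k) (d' := false) (hby k)
  have h2 : ∀ k, ∃ l, ZW E T (G (2*k+2)) false (b k) l true (x (k+1)) := fun k =>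
    (hG (2*k+2)).zw false (hb k) (ha (k+1)) (d' := true) (hax (k+1))
  choose l hl using h1
  choose m hm using h2
  refine ⟨fun k => G (2*k+3) ∪ G (2*k+2), x, fun k => l k ++ m k, fun k => (hl k).append (hm k) (hd' _ _ (by omega)), ?_, ?_,
    fun k => union_subset (hZ _) (hZ _)⟩
  · intro i j hij
    simp only [disjoint_union_left, disjoint_union_right]
    refine ⟨⟨hd' _ _ (by omega), hd' _ _ (by omega)⟩, hd' _ _ (by omega), hd' _ _ (by omega)⟩
  · intro k
    obtain ⟨a, h1, h2⟩ := (hl k).hasF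
    exact ⟨a, by simp [h1], h2⟩

theorem survive (hF : Fs E T Z q F) (Hn : ℕ → Set (Set V)) (Cs : ℕ → Set V)
    (hn : ∀ n, Nd E T Z q (Hn n) (Cs n)) (hH : ∀ n, Hn (n+1) = insert (F (Hn n) (Cs n)) (Hn n))
    (hC : ∀ n, Cs (n+1) ⊆ Cs n) {t : V} (ht : ∀ n, t ∈ Cs n) : Rds E T Z := by
  set Fn := fun n => F (Hn n) (Cs n) with hFn
  have hFs := fun n => hF _ _ (hn n)
  have hmem : ∀ i n, i < n → Fn i ∈ Hn n := by
    intro i n hin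
    induction n with
    | zero => omega
    | succ n ih =>
      rw [hH]
      rcases Nat.lt_succ_iff_lt_or_eq.1 hin with h | rfl
      · exact mem_insert_of_mem _ (ih h)
      · exact mem_insert _ _
  have hdis : ∀ i n, i < n → ∀ v ∈ Fn i, v ∉ Cs n := fun i n h v hv hc => (hn n).dis v hc ⟨_, hmem i n h, hv⟩
  set Ci := ⋂ n, Cs n with hCi
  have htC : t ∈ Ci := mem_iInter.2 ht
  set C' := cpt E Ci t with hC'
  have hcomp : Comp E Ci C' := comp_cpt htC
  have hC's : ∀ n, C' ⊆ Cs n := fun n => hcomp.sub.trans (iInter_subset _ n)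
  have hinf : ∀ N, ∃ n > N, ∃ a ∈ Fn n, ∃ c ∈ C', E a c := by
    intro N0
    set N := N0 + 1
    obtain ⟨f, hf⟩ := (hFs N).2.2.1
    obtain ⟨a, c, h1, h2, h3, h4, h5⟩ := cn_cross ((hn N).conn f ((hFs N).2.1 hf) t (ht N)) (B := C')
      (fun h => hdis N (N+1) (by omega) f hf (hC's _ h)) (self_cpt htC)
    have haC : a ∉ Ci := fun h => h1 (hcomp.adj h2 h h3)
    have h3' : E a c := by
      rcases h3 with h3 | h3
      · exact h3
      · refine (haC (mem_iInter.2 fun n => (hn n).out c (hC's n h2) a ((hn N).csub h4) h3)).elim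
    have hex : ∃ n, a ∉ Cs n := by simpa [hCi] using haC
    classical
    set n := Nat.find hex with hnd
    have hn1 : a ∉ Cs n := Nat.find_spec hex
    have hmin : ∀ i, i < n → a ∈ Cs i := fun i hi => by_contra fun h => Nat.find_min hex hi h
    have hanti : ∀ i j, i ≤ j → Cs j ⊆ Cs i := fun i j h => antitone_nat_of_succ_le (f := Cs) (fun n => hC n) h
    have hNn : N < n := by grind
    obtain ⟨k, hk⟩ : ∃ k, n = k + 1 := ⟨n - 1, by omega⟩
    refine ⟨k, by omega, a, ?_, c, h2, h3'⟩
    have := ((hn n).inn a ((hn N).csub h4) c (hC's n h2) h3').resolve_left hn1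
    rw [hk, hH, sU] at this
    exact this.resolve_left ((hn k).dis a (hmin k (by omega)))
  obtain ⟨φ, hφ, hφ'⟩ := Nat.exists_strictMono_subsequence hinf
  refine ladder (fun k => Fn (φ k)) (fun k => (hFs _).2.1.trans (hn _).csub) (fun k => (hFs _).1) ?_ ?_
  · intro i j hij
    refine disjoint_left.2 fun v hv hv' => hdis _ _ (hφ hij) v hv ((hFs _).2.1 hv')
  · intro i j hij
    obtain ⟨a, ha, c, hc, he⟩ := hφ' i
    exact (hFs (φ j)).2.2.2.1 (Fn (φ i)) (hmem _ _ (hφ hij)) ⟨a, ha, c, hC's _ hc, he⟩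

theorem At_root (h : Col E (W ∪ K) (S ∪ K) (T ∩ W)) :
    ∃ Q, At E S T W K Q := by
  obtain ⟨P, p1, p2, p3, p4⟩ := h
  set P' : Set (List V) := {l | ∃ a, a ++ l ∈ P ∧ ((a = [] ∧ ∀ u ∈ l, u ∉ K) ∨ ∃ v t, l = v :: t ∧ v ∈ K ∧ ∀ u ∈ t, u ∉ K)} with hP'
  have hne : ∀ l ∈ P', l ≠ [] := by
    rintro l ⟨a, h1, ⟨rfl, -⟩ | ⟨v, t, rfl, -⟩⟩
    · exact (p1.1 _ h1).1
    · simp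
  refine ⟨P', ⟨?_, ?_⟩, ?_, ?_, ?_⟩
  · rintro l ⟨a, h1, h2⟩
    refine ⟨hne l ⟨a, h1, h2⟩, ?_, ?_⟩
    · exact (List.nodup_append.1 (p1.1 _ h1).2.1).2.1
    · exact (p1.1 _ h1).2.2.right_of_append
  · rintro l ⟨a, h1, h2⟩ m ⟨a', h1', h2'⟩ v hv hv'
    have := p1.2 _ h1 _ h1' v (by simp [hv]) (by simp [hv'])
    rcases h2 with ⟨rfl, h2⟩ | ⟨z, t, rfl, hz, ht⟩ <;> rcases h2' with ⟨rfl, h2'⟩ | ⟨z', t', rfl, hz', ht'⟩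
    · simpa using this
    · grind
    · grind
    · rcases List.append_eq_append_iff.1 this with ⟨c, h3, h4⟩ | ⟨c, h3, h4⟩
      · cases c with
        | nil => simpa using h4
        | cons p c => simp at h4; exact (ht z' (by simp [h4.2]) hz').elim
      · cases c with
        | nil => simpa using h4.symm
        | cons p c => simp at h4; exact (ht' z (by simp [h4.2]) hz).elim
  · rintro v s ⟨a, h1, h2⟩ x hx
    have : x ∉ K := by grind
    exact (p2 ⟨_, h1, by simp [hx]⟩).resolve_right this
  · rintro v ⟨l, ⟨a, h1, h2⟩, hv⟩
    rcases h2 with ⟨rfl, h2⟩ | ⟨z, t, rfl, hz, ht⟩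
    · have hvl := List.mem_of_head? hv
      refine Or.inl ⟨(p3 ⟨_, h1, hv⟩).resolve_right (h2 v hvl), (p2 ⟨_, h1, hvl⟩).resolve_right (h2 v hvl)⟩
    · grind
  · rw [← p4]
    ext v; constructor
    · rintro ⟨l, ⟨a, h1, h2⟩, hv⟩
      obtain ⟨s, rfl⟩ := last_form hv
      exact ⟨_, h1, by rw [← List.append_assoc]; simp⟩
    · rintro ⟨l, hl, hv⟩
      by_cases h : ∃ u ∈ l, u ∈ K
      · obtain ⟨s, z, t, rfl, h1, h2⟩ := last_hit (X := K) h
        exact ⟨z :: t, ⟨s, hl, Or.inr ⟨z, t, rfl, h1, h2⟩⟩, by rw [← hv, List.getLast?_append_cons]⟩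
      · grind

theorem flemma (hD : IsDimaze E T) (hAC : ¬ Rds E T Z) (hL : Loose E X S T) (hZX : Z ⊆ X)
    (hZ : Conn E Z) (hP : Prd E T Z) (hq : q ∈ Z) (hK : (bd E X Z).Finite) (hS : Stuck E S T Z q) :
    Near E S T Z := by
  obtain ⟨F, hF⟩ := exists_Fs E T Z q
  set K := bd E X Z with hKd
  have hKZ : ∀ v ∈ K, v ∉ Z := fun v hv => hv.2.1
  have hr := Nd.root hZ hP hq
  have h0 : Iv E S T Z K q F {((∅ : Set (Set V)), Z, K)} {l | ∃ k ∈ K, l = [k]} := by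
    constructor
    · rintro _ rfl; exact hr
    · rintro _ rfl m
      refine At_root ?_
      refine fix hD hL ((Wm_sub _ _ _).trans hZX) (fun v hv => hv.1) ?_ (Wm_near hD hL hZX hK hZ hS hF m _ _ hr)
      simpa using Wm_bd hZX hZ hS hF m _ _ hr
    · rintro _ rfl; exact hK
    · rintro _ rfl v ⟨_, _, u, _, he⟩ hvT; exact hD v hvT u he
    · grind
    · rintro _ rfl _ rfl v _ _; rfl
    · rintro _ rfl _ rfl v _ _; rfl
    · refine ⟨?_, ?_⟩
      · rintro _ ⟨k, hk, rfl⟩; exact ⟨by simp, by simp, by simp⟩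
      · grind
    · grind
    · grind
    · intro v; constructor
      · rintro ⟨_, ⟨k, hk, rfl⟩, hv⟩; simp at hv; subst hv; exact Or.inr ⟨_, rfl, hk⟩
      · rintro (⟨_, h1, h2⟩ | ⟨_, rfl, h⟩)
        · exact (h2 _ rfl h1).elim
        · exact ⟨[v], ⟨v, h, rfl⟩, rfl⟩
  let StT := {p : Set (Tr V) × Set (List V) // Iv E S T Z K q F p.1 p.2}
  have hstep : ∀ p : StT, ∃ p' : StT, (∀ n' ∈ p'.1.1, ∃ n ∈ p.1.1, n'.1 = insert (F n.1 n.2.1) n.1 ∧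
      n'.2.1 ∈ chd E S T Z F n.1 n.2.1) ∧ ∀ l ∈ p.1.2, (∃ t ∈ T, l.getLast? = some t) → l ∈ p'.1.2 := by
    rintro ⟨p, hp⟩
    obtain ⟨N', Q', h1, h2, h3⟩ := hp.step hD hZX hZ hS hF hKZ
    exact ⟨⟨(N', Q'), h1⟩, h2, h3⟩
  choose g hg1 hg2 using hstep
  let st : ℕ → StT := fun n => Nat.rec (⟨(_, _), h0⟩ : StT) (fun _ p => g p) n
  have hst : ∀ n, st (n+1) = g (st n) := fun n => rfl
  by_cases hsv : ∃ t, ∀ n, ∃ ν ∈ (st n).1.1, t ∈ ν.2.1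
  · obtain ⟨t, ht⟩ := hsv
    choose ν hν hνt using ht
    have hpar : ∀ n, (ν (n+1)).1 = insert (F (ν n).1 (ν n).2.1) (ν n).1 ∧
      (ν (n+1)).2.1 ∈ chd E S T Z F (ν n).1 (ν n).2.1 := by
      intro n
      obtain ⟨μ, h1, h2, h3⟩ := hg1 (st n) (ν (n+1)) (hν (n+1))
      have := (st n).2.dC μ h1 (ν n) (hν n) t (h3.2.2 (hνt (n+1))) (hνt n)
      rw [← this]; exact ⟨h2, h3⟩
    exact (hAC (survive hF (fun n => (ν n).1) (fun n => (ν n).2.1) (fun n => (st n).2.nd _ (hν n))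
      (fun n => (hpar n).1) (fun n => (hpar n).2.2.2) hνt)).elim
  push Not at hsv
  set R : ℕ → Set (List V) := fun n => {l ∈ (st n).1.2 | ∃ t ∈ T, l.getLast? = some t} with hR
  have hmono : Monotone R := monotone_nat_of_le_succ fun n l hl => ⟨hg2 (st n) l hl.1 hl.2, hl.2⟩
  set U : Set (List V) := ⋃ n, R n with hU
  have hUs : Sys E U := by
    constructor
    · intro l hl; obtain ⟨n, hn⟩ := mem_iUnion.1 hl; exact (st n).2.sys.1 l hn.1
    · intro l hl m hm v hv hv'
      obtain ⟨n, hn⟩ := mem_iUnion.1 hl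
      obtain ⟨n', hn'⟩ := mem_iUnion.1 hm
      exact (st (max n n')).2.sys.2 l (hmono (le_max_left _ _) hn).1 m (hmono (le_max_right _ _) hn').1 v hv hv'
  have hUL : T ∩ Z ⊆ Lst U := by
    rintro t ⟨htT, htZ⟩
    obtain ⟨n, hn⟩ := hsv t
    obtain ⟨l, hl, hx⟩ := ((st n).2.lst t).2 (Or.inl ⟨htT, htZ, hn⟩)
    exact ⟨l, mem_iUnion.2 ⟨n, hl, t, htT, hx⟩, hx⟩
  have hUv : ∀ v ∈ Vs U, v ∈ K ∨ v ∈ Z := by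
    rintro v ⟨l, hl, hv⟩
    obtain ⟨n, hn⟩ := mem_iUnion.1 hl
    exact ((st n).2.vs v ⟨l, hn.1, hv⟩).imp_right And.left
  have hUh : Hd U ⊆ S ∪ K := by
    rintro v ⟨l, hl, hv⟩
    obtain ⟨n, hn⟩ := mem_iUnion.1 hl
    exact (st n).2.hd ⟨l, hn.1, hv⟩
  refine near_of (P := {l ∈ U | ∀ u ∈ l, u ∉ K}) (hUs.sub (sep_subset _ _)) ?_ ?_ ?_
  · rintro v ⟨l, ⟨hl, h1⟩, hv⟩
    exact (hUv v ⟨l, hl, hv⟩).resolve_left (h1 v hv)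
  · rintro v ⟨l, ⟨hl, h1⟩, hv⟩
    exact (hUh ⟨l, hl, hv⟩).resolve_right (h1 v (List.mem_of_head? hv))
  · have : ∀ k : V, {v | ∃ l ∈ U, k ∈ l ∧ l.getLast? = some v}.Subsingleton := by
      rintro k v ⟨l, h1, h2, h3⟩ v' ⟨l', h1', h2', h3'⟩
      rw [hUs.2 l h1 l' h1' k h2 h2', h3'] at h3
      exact (Option.some.inj h3).symm
    refine (hK.biUnion fun k _ => (this k).finite).subset ?_
    rintro t ⟨ht, ht'⟩
    obtain ⟨l, hl, hx⟩ := hUL ht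
    have : ∃ k ∈ l, k ∈ K := by grind
    obtain ⟨k, h1, h2⟩ := this
    simp only [mem_iUnion]
    exact ⟨k, h2, l, hl, h1, hx⟩
end

section
variable {E E' E2 : V → V → Prop} {X X' S T T' T2 A B C Z D W W' I K N U Y : Set V} {u v w x y q e z : V}
  {L L' : Set (List V)} {d d' : Bool}

theorem reach (ha : v ∈ pr E T Z) (hb : v ∉ pr E T (Z \ B)) : ∃ s b, IsP E (s ++ [b]) ∧
    (s ++ [b]).head? = some v ∧ b ∈ B ∧ b ∈ Z ∧ ∀ u ∈ s, u ∈ Z ∧ u ∉ B ∧ u ∉ pr E T (Z \ B) := by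
  obtain ⟨l, h1, h2, ⟨t, ht, h3⟩, h4⟩ := pto_of_pr ha
  have hvl := List.mem_of_head? h2
  have hit : ∃ u ∈ l, u ∈ B := by
    by_contra h; push Not at h
    exact hb (chain_pr (A := Z \ B) h1.2.2 (fun u hu => ⟨h4 u hu, h u hu⟩)
      ⟨t, h3, pr_T ht ⟨h4 t (List.mem_of_getLast? h3), h t (List.mem_of_getLast? h3)⟩⟩ v hvl)
  obtain ⟨s, b, r, rfl, h5, h6⟩ := first_hit hit
  have hp : IsP E (s ++ [b]) := by
    have : s ++ b :: r = (s ++ [b]) ++ r := by simp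
    rw [this] at h1; exact h1.prefix (by simp)
  have hh : (s ++ [b]).head? = some v := by grind
  refine ⟨s, b, hp, hh, h5, h4 b (by simp), fun u hu => ⟨h4 u (by simp [hu]), h6 u hu, fun hup => ?_⟩⟩
  obtain ⟨s1, s2, rfl⟩ := List.append_of_mem hu
  have hc : (s1 ++ [u]).IsChain E := by
    have := hp.2.2
    rw [show (s1 ++ u :: s2) ++ [b] = (s1 ++ [u]) ++ (s2 ++ [b]) by simp] at this
    exact this.left_of_append
  refine hb (chain_pr hc (fun z hz => ?_) ⟨u, by simp, hup⟩ v ?_)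
  · grind
  · cases s1 with
    | nil => simp at hh; simp [hh]
    | cons a s1 => simp at hh; simp [hh]

theorem ZW.path {s : List V} {b : V} (h : IsP E (s ++ [b])) (hd : (s ++ [b]).head? = some v) (hA : ∀ u ∈ s, u ∈ A) (d : Bool) :
    ∃ l d', ZW E T A d v l d' b := by
  cases s with
  | nil => simp at hd; subst hd; exact ⟨[], d, ZW.nil⟩
  | cons a s =>
    simp at hd; subst hd
    exact ⟨_, _, ZW.fwd (l := s) h.2.2 (List.nodup_append.1 h.2.1).1 hA⟩

theorem fat_cons {s : List V} (hK : Fat E T K) (h : (s ++ [v]).IsChain E) (hv : v ∈ K) :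
    Fat E T (K ∪ {u | u ∈ s}) := by
  induction s with
  | nil => simpa using hK
  | cons a s ih =>
    have h' : (s ++ [v]).IsChain E := by
      rw [List.cons_append] at h; exact h.tail
    have h1 := ih h'
    obtain ⟨b, hb, he⟩ : ∃ b ∈ K ∪ {u | u ∈ s}, E a b := by
      cases s with
      | nil => simp at h; exact ⟨v, Or.inl hv, h⟩
      | cons b s => simp [List.isChain_cons_cons] at h; exact ⟨b, Or.inr (by simp), h.1⟩
    have he' : K ∪ {u | u ∈ a :: s} = insert a (K ∪ {u | u ∈ s}) := by
      ext z; simp; tauto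
    rw [he']
    refine ⟨h1.1.insert a, ?_, ?_⟩
    · rw [insert_eq]
      refine Conn.union (a := a) (b := b) ?_ h1.2.1 rfl hb (by tauto)
      rintro _ rfl _ rfl; exact .refl
    · intro z hz
      rcases hz with rfl | hz
      · exact pr_in (pr_mono (subset_insert _ _) (h1.2.2 hb)) (mem_insert _ _) he
      · exact pr_mono (subset_insert _ _) (h1.2.2 hz)

theorem nonstuck (hP : Prd E T Z) (hS : ¬ Stuck E S T Z q) (hK : (bd E X Z).Finite) :
    ∃ Z' z A l, Z' ⊆ Z ∧ Conn E Z' ∧ Prd E T Z' ∧ ¬ Near E S T Z' ∧ (bd E X Z').Finite ∧ z ∈ Z' ∧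
      ZW E T A true q l false z ∧ A ⊆ Z ∧ Disjoint A Z' := by
  simp only [Stuck] at hS
  push Not at hS
  obtain ⟨K, k1, k2, k3, C, c1, c2, c, hc, w, hw, he, hwC⟩ := hS
  have hwp : w ∉ pr E T (Z \ K) := fun h => hwC (c1.adj hc h (Or.inr he))
  obtain ⟨s, b, s1, s2, s3, s4, s5⟩ := reach (hP hw) hwp
  have hf := fat_cons k1 s1.2.2 s3
  have hwA : w ∈ K ∪ {u | u ∈ s} := by
    have := List.mem_of_head? s2
    simp at this
    rcases this with h | rfl
    exacts [Or.inr h, Or.inl s3]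
  obtain ⟨l, hl⟩ := hf.zw true (Or.inl k3) hwA (d' := false) he
  refine ⟨C, c, _, l, fun v hv => (c1.sub hv).1.1, c1.conn, c1.prd pr_prd, c2, ?_, hc, hl, ?_, ?_⟩
  · refine (hK.union k1.1).subset ?_
    rintro v ⟨h1, h2, u, hu, h3⟩
    by_cases hvK : v ∈ K
    · exact Or.inr hvK
    · refine Or.inl ⟨h1, fun hvZ => h2 (comp_in c1 ⟨hvZ, hvK⟩ hu h3), u, (c1.sub hu).1.1, h3⟩
  · grind
  · rw [disjoint_left]
    rintro v (hv | hv) hvC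
    · exact (c1.sub hvC).1.2 hv
    · exact (s5 v hv).2.2 (c1.sub hvC)

structure Ln (E : V → V → Prop) (T : Set V) (E' : V → V → Prop) (X' T' : Set V) (L : Set (List V)) : Prop where
  le : ∀ a b, E' a b → E a b
  sys : Sys E L
  hd : Hd L = T'
  lst : Lst L ⊆ T
  tl : ∀ v s, v :: s ∈ L → ∀ x ∈ s, x ∉ X'

def Cl (L : Set (List V)) (A : Set V) : Set V := A ∪ {v | ∃ l ∈ L, v ∈ l ∧ ∃ h ∈ A, l.head? = some h}

theorem Cl_mono (h : A ⊆ B) : Cl L A ⊆ Cl L B := by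
  rintro v (hv | ⟨l, h1, h2, a, h3, h4⟩)
  exacts [Or.inl (h hv), Or.inr ⟨l, h1, h2, a, h h3, h4⟩]

theorem Ln.head (h : Ln E T E' X' T' L) {l : List V} (hl : l ∈ L) (hv : v ∈ l) (hX : v ∈ X') : l.head? = some v := by
  cases l with
  | nil => simp at hv
  | cons a s =>
    rcases List.mem_cons.1 hv with rfl | hv
    · rfl
    · exact (h.tl a s hl v hv hX).elim

theorem Ln.dis (h : Ln E T E' X' T' L) (hA : A ⊆ X') (hB : B ⊆ X') (hd : Disjoint A B) :
    Disjoint (Cl L A) (Cl L B) := by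
  rw [disjoint_left] at *
  rintro v (hv | ⟨l, h1, h2, a, h3, h4⟩) (hv' | ⟨l', h1', h2', a', h3', h4'⟩)
  · exact hd hv hv'
  · have := (h.head h1' h2' (hA hv)).symm.trans h4'; cases this; exact hd hv h3'
  · have := (h.head h1 h2 (hB hv')).symm.trans h4; cases this; exact hd h3 hv'
  · have := h.sys.2 l h1 l' h1' v h2 h2'
    subst this
    have := h4.symm.trans h4'; cases this; exact hd h3 h3'

theorem Walk.mono {l : List (V × Bool)} (h : Walk E' x l w) (hE : ∀ a b, E' a b → E a b) : Walk E x l w := by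
  induction l generalizing x with
  | nil => exact h
  | cons a l ih =>
    obtain ⟨h1, x', h2, h3⟩ := h
    refine ⟨h1, x', ?_, ih h3⟩
    cases ha : a.2 <;> rw [ha] at h2 <;> exact hE _ _ h2

theorem Ln.zw (h : Ln E T E' X' T' L) (hA : A ⊆ X') {l : List (V × Bool)} (hz : ZW E' T' A d x l d' w) :
    ZW E T (Cl L A) d x l d' w := by
  classical
  obtain ⟨M, m1, m2⟩ := hz.links
  have hext : ∀ v, ∃ r : List V, v ∈ sinks d l → PTo E T (Cl L A) v (M v ++ r) ∧ (∀ u ∈ r, u ∉ X') ∧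
      ∃ t ∈ M v, t :: r ∈ L := by
    intro v
    by_cases hv : v ∈ sinks d l
    swap
    · exact ⟨[], fun h => (hv h).elim⟩
    obtain ⟨⟨p1, p2, ⟨t, ht, p3⟩, p4⟩, -⟩ := m1 v hv
    rw [← h.hd] at ht
    obtain ⟨b, hb, hbt⟩ := ht
    obtain ⟨r, rfl⟩ := head_form hbt
    obtain ⟨s, hs⟩ := last_form p3
    refine ⟨r, fun _ => ⟨⟨?_, ?_, ?_, ?_⟩, h.tl t r hb, t, List.mem_of_getLast? p3, hb⟩⟩
    · rw [hs] at p1 p4 ⊢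
      have hr := h.sys.1 _ hb
      refine ⟨by simp, ?_, ?_⟩
      · rw [List.nodup_append]
        refine ⟨p1.2.1, (List.nodup_cons.1 hr.2.1).2, fun a ha b hb' hab => ?_⟩
        subst hab; exact h.tl t r hb a hb' (hA (p4 a ha))
      · rw [List.append_assoc, List.singleton_append]
        have h1 := p1.2.2.imp (S := E) fun _ _ => h.le _ _
        have h2 := hr.2.2
        exact (List.isChain_split (R := E)).2 ⟨h1, h2⟩
    · grind
    · obtain ⟨t', ht'⟩ := exists_last (h.sys.1 _ hb).1
      refine ⟨t', h.lst ⟨_, hb, ht'⟩, ?_⟩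
      rw [hs, List.append_assoc, List.singleton_append, List.getLast?_append_cons, ht']
    · intro u hu
      rcases List.mem_append.1 hu with hu | hu
      · exact Or.inl (p4 u hu)
      · exact Or.inr ⟨_, hb, by simp [hu], t, p4 t (List.mem_of_getLast? p3), rfl⟩
  choose r hr using hext
  refine ⟨hz.walk.mono h.le, hz.lfe, hz.nodup, fun v hv => Or.inl (hz.sub v hv), fun v => M v ++ r v, ?_, ?_⟩
  · intro v hv
    obtain ⟨a1, a2, t, a3, a4⟩ := hr v hv
    refine ⟨a1, fun u hu hul => ?_⟩
    rcases List.mem_append.1 hu with hu | hu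
    · grind
    · exact (a2 u hu (hA (hz.sub u hul))).elim
  · intro v hv v' hv' u hu hu'
    obtain ⟨a1, a2, t, a3, a4⟩ := hr v hv
    obtain ⟨a1', a2', t', a3', a4'⟩ := hr v' hv'
    have hM : ∀ v ∈ sinks d l, ∀ u ∈ M v, u ∈ X' := fun v hv u hu => hA ((m1 v hv).1.2.2.2 u hu)
    rcases List.mem_append.1 hu with hu | hu <;> rcases List.mem_append.1 hu' with hu' | hu'
    · grind
    · grind
    · grind
    · have := h.sys.2 _ a4 _ a4' u (by simp [hu]) (by simp [hu'])
      simp at this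
      exact m2 v hv v' hv' t a3 (this.1 ▸ a3')

theorem Ln.comp (hD : IsDimaze E' T') (h : Ln E T E' X' T' L) (h' : Ln E' T' E2 X T2 L') (hX : X ⊆ X') (hV : Vs L' ⊆ X') :
    Ln E T E2 X T2 (comp L' L) where
  le := fun a b hab => h.le a b (h'.le a b hab)
  sys := by
    refine comp_sys (h'.sys.mono h.le) h.sys ?_
    intro a ha b hb u hu hu'
    have h1 := h.head hb hu' (hV ⟨a, ha, hu⟩)
    refine ⟨?_, h1⟩
    exact exit_last hD (h'.sys.1 a ha) (by rw [← h.hd]; exact ⟨b, hb, h1⟩) hu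
  hd := by rw [comp_Hd, h'.hd]
  lst := by
    rintro v ⟨l, ⟨s, w, t, h1, h2, rfl⟩ | ⟨h1, h2⟩, hv⟩
    · rw [List.getLast?_append_cons] at hv; exact h.lst ⟨_, h2, hv⟩
    · exact (h2 v hv (by rw [h.hd]; exact h'.lst ⟨l, h1, hv⟩)).elim
  tl := by
    rintro v r (⟨s, w, t, h1, h2, h3⟩ | ⟨h1, h2⟩) x hx
    · have ht : ∀ x ∈ t, x ∉ X := fun x hx hX' => h.tl w t h2 x hx (hX hX')
      cases s with
      | nil => simp at h3; rw [h3.2] at hx; exact ht x hx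
      | cons a s =>
        simp at h3
        rw [h3.2] at hx
        have := h'.tl a (s ++ [w]) (by simpa using h1) x
        simp at hx this
        rcases hx with hx | hx | hx
        exacts [this (Or.inl hx), this (Or.inr hx), ht x hx]
    · exact h'.tl v r h1 x hx

theorem Cl_comp : Cl (comp L' L) A ⊆ Cl L (Cl L' A) := by
  rintro v (hv | ⟨l, ⟨s, w, t, h1, h2, rfl⟩ | ⟨h1, -⟩, hvl, a, ha, hd⟩)
  · exact Or.inl (Or.inl hv)
  · have hd' : (s ++ [w]).head? = some a := by rw [← hd]; exact head?_split _ _ _ _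
    rcases List.mem_append.1 hvl with h | h
    · exact Or.inl (Or.inr ⟨_, h1, by simp [h], a, ha, hd'⟩)
    · exact Or.inr ⟨_, h2, h, w, Or.inr ⟨_, h1, by simp, a, ha, hd'⟩, rfl⟩
  · exact Or.inl (Or.inr ⟨l, h1, hvl, a, ha, hd⟩)

theorem Cl_sub (h : A ⊆ X) (hV : Vs L ⊆ X) : Cl L A ⊆ X := by
  rintro v (hv | ⟨l, h1, h2, -⟩)
  exacts [h hv, hV ⟨l, h1, h2⟩]
end

section
variable {E E' E2 : V → V → Prop} {X X' S T T' T2 A B C Z D W W' I K N U Y : Set V} {u v w x y q e z : V}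
  {L L' : Set (List V)} {d d' : Bool}

theorem Col.near (h : Col E A S (T ∩ A)) : Near E S T A := ⟨∅, finite_empty, by simpa using h⟩

theorem back {s : List V} {c : V} (h : IsP E (s ++ [e])) (hh : (s ++ [e]).head? = some v) (hA : ∀ u ∈ s, u ∈ A)
    (hc : E c v) : ∃ a l, E a e ∧ ZW E T A false a l false c := by
  rcases s.eq_nil_or_concat' with rfl | ⟨s, a, rfl⟩
  · simp at hh; subst hh; exact ⟨c, [], hc, ZW.nil⟩
  · have hae : E a e := by
      have := h.2.2
      rw [List.append_assoc] at this
      simpa using this.right_of_append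
    have hp : IsP E (s ++ [a]) := h.prefix (by simp)
    have hh' : (s ++ [a]).head? = some v := by grind
    refine ⟨a, _, hae, ZW.bwd (l := s) ?_ hp.2.1 hA (by simp)⟩
    obtain ⟨r, hr⟩ := head_form hh'
    rw [hr, List.isChain_cons_cons]
    exact ⟨hc, hr ▸ hp.2.2⟩

def Good (E : V → V → Prop) (X S T N : Set V) : Prop :=
  N ⊆ X ∧ Conn E N ∧ Prd E T N ∧ ¬ Near E S T N ∧ (bd E X N).Finite

theorem good_exit (hin : ∀ v ∈ X, ∀ u ∈ Y, E v u → v ∈ Y) (hY : Y ⊆ X) (hN : Comp E (pr E T (Y \ {y})) N) (hb : ¬ Near E S T N) :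
    Good E X S T N := by
  refine ⟨fun v hv => hY (hN.sub hv).1.1, hN.conn, hN.prd pr_prd, hb, (finite_singleton y).subset ?_⟩
  rintro v ⟨h1, h2, u, hu, he⟩
  by_contra hvy
  exact h2 (comp_in hN ⟨hin v h1 u (hN.sub hu).1.1 he, hvy⟩ hu he)

theorem elemma (hD : IsDimaze E T) (hL : Loose E X S T) (hY : Y ⊆ X) (hin : ∀ v ∈ X, ∀ u ∈ Y, E v u → v ∈ Y)
    (hP : Prd E T Y) (hbad : ∀ C, Comp E Y C → ¬ Near E S T C) (heT : e ∈ T) (heY : e ∈ Y) :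
    ∃ a N n A l, E a e ∧ ZW E T A false a l true n ∧ A ⊆ Y ∧ e ∉ A ∧ n ∈ N ∧ N ⊆ Y ∧ e ∉ N ∧ Good E X S T N ∧ Disjoint A N := by
  have hC : Comp E Y (cpt E Y e) := comp_cpt heY
  set C := cpt E Y e with hCd
  have heC : e ∈ C := self_cpt heY
  have hCX : C ⊆ X := hC.sub.trans hY
  set X1 := C \ {e} with hX1
  have hX1X : X1 ⊆ X := sdiff_subset.trans hCX
  have hX1in : ∀ v ∈ X, ∀ u ∈ X1, E v u → v ∈ X1 := by
    intro v hv u hu he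
    refine ⟨hC.adj hu.1 (hin v hv u (hC.sub hu.1) he) (Or.inl he), ?_⟩
    rintro rfl; exact hD _ heT u he
  obtain ⟨c1, c2, -, c4⟩ := core hD hL hX1X hX1in (S := S) rfl
  obtain ⟨u1, u2, u3⟩ := U2_ex (E := E) (X := X1) (S := S) (T := T)
  set U3 := U2 E X1 S T with hU3
  set Y1 := X1 \ U3 with hY1
  have hY1X : Y1 ⊆ X := sdiff_subset.trans hX1X
  have hne : Y1.Nonempty := by
    by_contra h
    have : U3 = X1 := subset_antisymm u1 fun v hv => by_contra fun h' => h ⟨v, hv, h'⟩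
    rw [this] at u3
    refine hbad C hC (near_sup u3.near sdiff_subset (finite_singleton e) ?_)
    rintro t ⟨-, ht⟩
    by_cases h : t = e
    exacts [Or.inr h, Or.inl ⟨ht, h⟩]
  obtain ⟨y0, hy0⟩ := hne
  have heU : e ∉ U3 := fun h => (u1 h).2 rfl
  set M := insert e U3 with hM
  have hMc : Comp E M (cpt E M e) := comp_cpt (mem_insert _ _)
  obtain ⟨u, y1, h1, h2, h3, h4, h5⟩ := cn_cross (hC.conn e heC y0 hy0.1.1) (B := C \ cpt E M e)
    (fun h => h.2 (self_cpt (mem_insert _ _))) ⟨hy0.1.1, fun h => by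
      rcases h.1 with h | h
      exacts [hy0.1.2 h, hy0.2 h]⟩
  have hu : u ∈ cpt E M e := by by_contra h; exact h1 ⟨h4, h⟩
  have hyM : y1 ∉ M := fun h => h2.2 (hMc.adj hu h h3.symm)
  have hy1 : y1 ∈ Y1 := ⟨⟨h5, fun h => hyM (Or.inl h)⟩, fun h => hyM (Or.inr h)⟩
  have huY1 : u ∉ Y1 := fun h => by
    rcases hu.1 with h' | h'
    exacts [h.1.2 h', h.2 h']
  have hedge : E y1 u := by grind
  have hy1T : y1 ∉ T := fun h => hD y1 h u hedge
  obtain ⟨N, n1, n2, n, n3, n4⟩ := c4 y1 hy1 hy1T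
  have hNY : N ⊆ Y1 := fun v hv => (n1.sub hv).1.1
  have hY1Y : Y1 ⊆ Y := fun v hv => hC.sub hv.1.1
  have hgood := good_exit c1 hY1X n1 n2
  have hyN : y1 ∉ N := fun h => (n1.sub h).1.2 rfl
  have hU3Y : U3 ⊆ Y := fun v hv => hC.sub (u1 hv).1
  suffices h : ∃ a A l, E a e ∧ ZW E T A false a l false y1 ∧ A ⊆ U3 by
    obtain ⟨a, A, l, g1, g2, g3⟩ := h
    have g4 : ZW E T {y1} false y1 [(y1, true)] true n := ZW.single n4 (Or.inr rfl)
    refine ⟨a, N, n, _, _, g1, g2.append g4 ?_, ?_, ?_, n3, hNY.trans hY1Y, fun h => (hNY h).1.2 rfl, hgood, ?_⟩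
    · grind
    · grind
    · grind
    · grind
  set R := pr E T U3 with hR
  have hMe : M \ {e} = U3 := by rw [hM, insert_sdiff_self_of_notMem heU]
  have hrM : ∀ v ∈ M, v ∈ pr E T M := by
    intro v hv
    rcases hv with rfl | hv
    · exact pr_T heT (mem_insert _ _)
    obtain ⟨p1, t, p2, p3, p4⟩ := hC.prd hP (u1 hv).1
    obtain ⟨q1, q2⟩ := rtg_closed (C := M) (R' := Rs E M) p4 (Or.inr hv) (by
      rintro a b ha ⟨r1, r2, r3⟩
      have hb : b ∈ M := by grind
      exact ⟨hb, r1, ha, hb⟩)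
    exact ⟨Or.inr hv, t, p2, q1, q2⟩
  have hback : ∀ v c, v ∈ M → v ∉ R → E c v → ∃ a A l, E a e ∧ ZW E T A false a l false c ∧ A ⊆ U3 \ R := by
    intro v c hv hvR hc
    obtain ⟨s, b, s1, s2, s3, s4, s5⟩ := reach (B := {e}) (hrM v hv) (by rwa [hMe])
    rw [mem_singleton_iff] at s3; subst s3
    obtain ⟨a, l, b1, b2⟩ := back (T := T) (A := U3 \ R) s1 s2 (fun u hu => by
      obtain ⟨t1, t2, t3⟩ := s5 u hu
      rw [hMe] at t3
      exact ⟨t1.resolve_left t2, t3⟩) hc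
    exact ⟨a, _, l, b1, b2, subset_rfl⟩
  by_cases huR : u ∈ R
  swap
  · grind
  have hG : Comp E R (cpt E R u) := comp_cpt huR
  set G := cpt E R u with hGd
  have heR : e ∉ R := fun h => heU (pr_sub h)
  obtain ⟨a, c, a1, a2, a3, a4, a5⟩ := cn_cross hu.2 (B := G) (fun h => heR (hG.sub h)) (self_cpt huR)
  have haR : a ∉ R := fun h => a1 (hG.adj a2 h a3)
  have hca : E c a := by
    rcases a3 with a3 | a3
    · rcases a4 with rfl | a4
      · exact (hD _ heT c a3).elim
      · exact (haR (pr_in (hG.sub a2) a4 a3)).elim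
    · exact a3
  obtain ⟨a0, A, l, g1, g2, g3⟩ := hback a c a4 haR hca
  obtain ⟨Fh, f1, f2, f3, f4⟩ := fat_hull1 hG.conn (hG.prd (T := T) pr_prd) a2 (self_cpt huR)
  obtain ⟨m, hm⟩ := f1.zw false f3 f4 (d' := false) (w := y1) hedge
  refine ⟨a0, _, _, g1, g2.append hm ?_, ?_⟩
  · exact disjoint_left.2 fun v hv hv' => (g3 hv).2 (hG.sub (f2 hv'))
  · exact union_subset (g3.trans sdiff_subset) fun v hv => pr_sub (hG.sub (f2 hv))
end

section
variable {E E' E2 : V → V → Prop} {X X' S T T' T2 A B C Z D W W' I K N U Y : Set V} {u v w x y q e z : V}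
  {L L' : Set (List V)} {d d' : Bool}

theorem wave_ln (hD : IsDimaze E T) {W : Set (List V)} (hW : Wave E Z S T U W) :
    ∃ L, Ln E T (rE E Z U) (Z \ U) (rT E Z T U) L ∧ Vs L ⊆ Z := by
  have hm : ∀ l ∈ W, ∀ v ∈ l, v ∈ T → v ∈ U := by
    intro l hl v hv ht
    rcases hW.mem hl hv with ⟨-, -, -, u, -, h⟩ | h
    exacts [(hD v ht u h).elim, h]
  refine ⟨W ∪ {l | ∃ t ∈ T ∩ (Z \ U), l = [t]}, ⟨fun a b h => h.1, ⟨?_, ?_⟩, ?_, ?_, ?_⟩, ?_⟩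
  · rintro l (hl | ⟨t, -, rfl⟩)
    exacts [hW.sys.1 l hl, ⟨by simp, by simp, by simp⟩]
  · rintro l (hl | ⟨t, ht, rfl⟩) m (hm' | ⟨t', ht', rfl⟩) v hv hv'
    · exact hW.sys.2 l hl m hm' v hv hv'
    · grind
    · grind
    · grind
  · ext v; constructor
    · rintro ⟨l, hl | ⟨t, ht, rfl⟩, hv⟩
      · exact Or.inl (hW.hd ▸ ⟨l, hl, hv⟩)
      · simp at hv; subst hv; exact Or.inr ht
    · rintro (hv | hv)
      · rw [← hW.hd] at hv; obtain ⟨l, hl, hv⟩ := hv; exact ⟨l, Or.inl hl, hv⟩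
      · exact ⟨[v], Or.inr ⟨v, hv, rfl⟩, rfl⟩
  · rintro v ⟨l, hl | ⟨t, ht, rfl⟩, hv⟩
    · exact hW.lst ⟨l, hl, hv⟩
    · grind
  · rintro v s (hl | ⟨t, ht, h⟩) x hx
    · exact fun h => h.2 (hW.tl v s hl x hx)
    · grind
  · rintro v ⟨l, hl | ⟨t, ht, rfl⟩, hv⟩
    · rcases hW.mem hl hv with h | h
      exacts [h.2.1, hW.sub h]
    · grind

theorem gcore (hD : IsDimaze E' T') (hL : Loose E' X' S T') (h : Ln E T E' X' T' L) (hY : Y ⊆ X')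
    (hin : ∀ v ∈ X', ∀ u ∈ Y, E' v u → v ∈ Y) (hP : Prd E' T' Y) (hbad : ∀ C, Comp E' Y C → ¬ Near E' S T' C)
    (hex : ∀ y ∈ Y, y ∉ T' → ∃ N, Comp E' (pr E' T' (Y \ {y})) N ∧ ¬ Near E' S T' N ∧ ∃ n ∈ N, E' y n)
    (hw : w ∈ Cl L Y) (d : Bool) : ∃ N n A l, Good E' X' S T' N ∧ n ∈ N ∧ ZW E T A d w l true n ∧
      A ⊆ Cl L Y ∧ N ⊆ Y ∧ Disjoint A (Cl L N) := by
  by_cases hc : w ∈ Y ∧ w ∉ T'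
  · obtain ⟨h1, h2⟩ := hc
    cases d
    · obtain ⟨N, n1, n2, n, n3, n4⟩ := hex w h1 h2
      have hNY : N ⊆ Y := fun v hv => (n1.sub hv).1.1
      have h4 : ZW E T {w} false w [(w, true)] true n := ZW.single (h.le _ _ n4) (Or.inr rfl)
      refine ⟨N, n, _, _, good_exit hin hY n1 n2, n3, h4, ?_, hNY, ?_⟩
      · exact singleton_subset_iff.2 hw
      · have := h.dis (A := {w}) (singleton_subset_iff.2 (hY h1)) (hNY.trans hY)
          (disjoint_singleton_left.2 fun h => (n1.sub h).1.2 rfl)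
        exact this.mono_left fun v hv => Or.inl hv
    · have hC : Comp E' Y (cpt E' Y w) := comp_cpt h1
      refine ⟨_, w, ∅, [], ⟨hC.sub.trans hY, hC.conn, hC.prd hP, hbad _ hC, ?_⟩, self_cpt h1, ZW.nil, empty_subset _, hC.sub, empty_disjoint _⟩
      convert finite_empty (α := V)
      ext v; simp only [mem_empty_iff_false, iff_false]
      rintro ⟨g1, g2, u, g3, g4⟩
      exact g2 (hC.adj g3 (hin v g1 u (hC.sub g3) g4) (Or.inl g4))
  · obtain ⟨l, e, l1, l2, l3, l4⟩ : ∃ l e, l ∈ L ∧ w ∈ l ∧ l.head? = some e ∧ e ∈ Y := by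
      rcases hw with hw | ⟨l, h1, h2, e, h3, h4⟩
      · have : w ∈ T' := by by_contra h; exact hc ⟨hw, h⟩
        rw [← h.hd] at this
        obtain ⟨l, hl, hlw⟩ := this
        exact ⟨l, w, hl, List.mem_of_head? hlw, hlw, hw⟩
      · grind
    have heT : e ∈ T' := h.hd ▸ ⟨l, l1, l3⟩
    obtain ⟨a, N, n, A, m, a1, a2, a3, a4, a5, a6, a7, a8, a9⟩ := elemma hD hL hY hin hP hbad heT l4
    obtain ⟨t, ht⟩ := exists_last (h.sys.1 l l1).1
    have hf : Fat E T {v | v ∈ l} := fat_path (A := univ) (v := e) ⟨h.sys.1 l l1, l3, ⟨t, h.lst ⟨l, l1, ht⟩, ht⟩, fun _ _ => trivial⟩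
    obtain ⟨m', hm'⟩ := hf.zw d l2 (List.mem_of_head? l3) (d' := false) (w := a) (h.le _ _ a1)
    have hlC : {v | v ∈ l} ⊆ Cl L {e} := fun v hv => Or.inr ⟨l, l1, hv, e, rfl, l3⟩
    have hdis : ∀ B ⊆ X', e ∉ B → Disjoint {v | v ∈ l} (Cl L B) := fun B hB he =>
      (h.dis (singleton_subset_iff.2 (hY l4)) hB (disjoint_singleton_left.2 he)).mono_left hlC
    refine ⟨N, n, _, _, a8, a5, hm'.append (h.zw (a3.trans hY) a2) (hdis A (a3.trans hY) a4), ?_, a6, ?_⟩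
    · exact union_subset (hlC.trans (Cl_mono (singleton_subset_iff.2 l4))) (Cl_mono a3)
    · exact disjoint_union_left.2 ⟨hdis N (a6.trans hY) a7, h.dis (a3.trans hY) (a6.trans hY) a9⟩

theorem toB (hC : Conn E Z) (hP : Prd E T Z) (hB : B ⊆ Z) (hw : w ∈ B) (hz : z ∈ Z) :
    ∃ b d A l, b ∈ B ∧ ZW E T A false z l d b ∧ A ⊆ Z ∧ Disjoint A B := by
  set R := pr E T (Z \ B) with hR
  have sub : ∀ a ∈ Z, a ∉ R → ∀ d, ∃ b d' A l, b ∈ B ∧ ZW E T A d a l d' b ∧ A ⊆ Z ∧ Disjoint A B ∧ Disjoint A R := by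
    intro a ha haR d
    obtain ⟨s, b, s1, s2, s3, s4, s5⟩ := reach (hP ha) haR
    obtain ⟨l, d', hl⟩ := ZW.path (T := T) (A := (Z \ B) \ R) s1 s2 (fun u hu => ⟨⟨(s5 u hu).1, (s5 u hu).2.1⟩, (s5 u hu).2.2⟩) d
    exact ⟨b, d', _, l, s3, hl, fun v hv => hv.1.1, disjoint_left.2 fun v hv => hv.1.2, disjoint_left.2 fun v hv => hv.2⟩
  by_cases hzR : z ∈ R
  swap
  · obtain ⟨b, d, A, l, h1, h2, h3, h4, -⟩ := sub z hz hzR false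
    exact ⟨b, d, A, l, h1, h2, h3, h4⟩
  have hG : Comp E R (cpt E R z) := comp_cpt hzR
  set G := cpt E R z
  have hGZ : G ⊆ Z \ B := fun v hv => pr_sub (hG.sub hv)
  obtain ⟨a, c, h1, h2, h3, h4, h5⟩ := cn_cross (hC w (hB hw) z hz) (B := G) (fun h => (hGZ h).2 hw) (self_cpt hzR)
  have haR : a ∉ R := fun h => h1 (hG.adj h2 h h3)
  obtain ⟨F, f1, f2, f3, f4⟩ := fat_hull1 hG.conn (hG.prd (T := T) pr_prd) (self_cpt hzR) h2
  have hFB : Disjoint F B := disjoint_left.2 fun v hv => (hGZ (f2 hv)).2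
  have hFZ : F ⊆ Z := fun v hv => (hGZ (f2 hv)).1
  rcases h3 with h3 | h3
  · have haB : a ∈ B := by by_contra h; exact haR (pr_in (hG.sub h2) ⟨h4, h⟩ h3)
    obtain ⟨l, hl⟩ := f1.zw false f3 f4 (d' := false) (w := a) h3
    exact ⟨a, _, F, l, haB, hl, hFZ, hFB⟩
  · obtain ⟨l, hl⟩ := f1.zw false f3 f4 (d' := true) (w := a) h3
    obtain ⟨b, d, A, m, g1, g2, g3, g4, g5⟩ := sub a h4 haR true
    exact ⟨b, d, _, _, g1, hl.append g2 (disjoint_left.2 fun v hv hv' => disjoint_left.1 g5 hv' (hG.sub (f2 hv))),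
      union_subset hFZ g3, disjoint_union_left.2 ⟨hFB, g4⟩⟩

theorem glemma (hD : IsDimaze E T) (hL : Loose E X S T) (hg : Good E X S T Z) (hz : z ∈ Z) :
    ∃ E' X' T' L N n A l, Ln E T E' X' T' L ∧ Vs L ⊆ Z ∧ X' ⊆ Z ∧ IsDimaze E' T' ∧ Loose E' X' S T' ∧
      Good E' X' S T' N ∧ n ∈ N ∧ ZW E T A false z l true n ∧ A ⊆ Z ∧ Disjoint A (Cl L N) := by
  obtain ⟨g1, g2, g3, g4, g5⟩ := hg
  obtain ⟨U, W, hW, hmax⟩ := max_wave E Z S T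
  obtain ⟨L, hLn, hV⟩ := wave_ln hD hW
  have hL' := res_loose hW hmax
  have hD' := r_dimaze (X := Z) (U := U) hD
  have hbad : ¬ Near (rE E Z U) S (rT E Z T U) (Z \ U) := fun h =>
    res_bad hD hW (wave_miss hD hL g1 g5 (fun v hv => hv.1) subset_rfl hW) subset_rfl h g4 (by
      rintro v (hv | hv)
      exacts [⟨hv.1, hv.2.1⟩, hv.2])
  obtain ⟨c1, c2, c3, c4⟩ := core hD' hL' subset_rfl (fun v hv _ _ _ => hv) (S := S) rfl
  obtain ⟨u1, -, u3⟩ := U2_ex (E := rE E Z U) (X := Z \ U) (S := S) (T := rT E Z T U)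
  set Y := (Z \ U) \ U2 (rE E Z U) (Z \ U) S (rT E Z T U) with hY
  have hne : Y.Nonempty := by
    by_contra h
    have : U2 (rE E Z U) (Z \ U) S (rT E Z T U) = Z \ U :=
      subset_antisymm u1 fun v hv => by_contra fun h' => h ⟨v, hv, h'⟩
    rw [this] at u3
    exact hbad u3.near
  obtain ⟨y, hy⟩ := hne
  have hYX : Y ⊆ Z \ U := sdiff_subset
  have hBZ : Cl L Y ⊆ Z := Cl_sub (hYX.trans sdiff_subset) hV
  obtain ⟨b, d, A, l, b1, b2, b3, b4⟩ := toB g2 g3 hBZ (Or.inl hy) hz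
  obtain ⟨N, n, A', l', n1, n2, n3, n4, n5, n6⟩ := gcore hD' hL' hLn hYX c1 c2 c3 c4 b1 d
  exact ⟨_, _, _, L, N, n, _, _, hLn, hV, sdiff_subset, hD', hL', n1, n2, b2.append n3 (b4.mono_right n4),
    union_subset b3 (n4.trans hBZ), disjoint_union_left.2 ⟨b4.mono_right (Cl_mono n5), n6⟩⟩

theorem Ln.rds {D : V → V → Prop} {B0 : Set V} (h : Ln D B0 E X T L) (hZ : Z ⊆ X) (hr : Rds E T Z) : ContainsAltComb D B0 := by
  obtain ⟨A, x, l, h1, h2, h3, h4⟩ := hr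
  exact asm (fun k => Cl L (A k)) x l (fun k => h.zw ((h4 k).trans hZ) (h1 k))
    (fun i j hij => h.dis ((h4 i).trans hZ) ((h4 j).trans hZ) (h2 i j hij)) h3

def Sta (D : V → V → Prop) (B0 S : Set V) (q : V) (R : Set V) : Prop :=
  ∃ E X T L Z, Ln D B0 E X T L ∧ IsDimaze E T ∧ Loose E X S T ∧ Good E X S T Z ∧ q ∈ Z ∧ R = Cl L Z

theorem rnd1 {D : V → V → Prop} {B0 R : Set V} (hAC : ¬ ContainsAltComb D B0) (h : Sta D B0 S q R) :
    ∃ q' R' A l, Sta D B0 S q' R' ∧ ZW D B0 A true q l true q' ∧ (∃ a ∈ l, a.2 = false) ∧ A ⊆ R ∧ R' ⊆ R ∧ Disjoint A R' := by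
  obtain ⟨E, X, T, L, Z, h1, h2, h3, ⟨g1, g2, g3, g4, g5⟩, h5, rfl⟩ := h
  have hS : ¬ Stuck E S T Z q := fun hS => g4 (flemma h2 (fun hr => hAC (h1.rds g1 hr)) h3 g1 g2 g3 h5 g5 hS)
  obtain ⟨Z', z, A, l, a1, a2, a3, a4, a5, a6, a7, a8, a9⟩ := nonstuck g3 hS g5
  obtain ⟨E', X', T', L', N, n, A', l', b1, b2, b3, b4, b5, b6, b7, b8, b9, b10⟩ :=
    glemma h2 h3 ⟨a1.trans g1, a2, a3, a4, a5⟩ a6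
  have hX' : X' ⊆ X := (b3.trans a1).trans g1
  have hN : Cl L' N ⊆ Z' := Cl_sub (b6.1.trans b3) b2
  have hAZ : A ∪ A' ⊆ Z := union_subset a8 (b9.trans a1)
  have hR : Cl (comp L' L) N ⊆ Cl L (Cl L' N) := Cl_comp
  refine ⟨n, _, _, _, ⟨E', X', T', comp L' L, N, h1.comp h2 b1 hX' ((b2.trans a1).trans g1), b4, b5, b6, b7, rfl⟩,
    h1.zw (hAZ.trans g1) (a7.append b8 (a9.mono_right b9)), ?_, Cl_mono hAZ, hR.trans (Cl_mono (hN.trans a1)), ?_⟩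
  · obtain ⟨a, ha, ha'⟩ := a7.hasF
    exact ⟨a, List.mem_append_left _ ha, ha'⟩
  · exact (h1.dis (hAZ.trans g1) ((hN.trans a1).trans g1)
      (disjoint_union_left.2 ⟨a9.mono_right hN, b10⟩)).mono_right hR

theorem no_sta {D : V → V → Prop} {B0 R : Set V} (hAC : ¬ ContainsAltComb D B0) (h : Sta D B0 S q R) : False := by
  choose f g A l r1 r2 r3 r4 r5 r6 using fun p : {p : V × Set V // Sta D B0 S p.1 p.2} => rnd1 hAC p.2
  let s : ℕ → {p : V × Set V // Sta D B0 S p.1 p.2} := fun n => (fun p => ⟨(f p, g p), r1 p⟩)^[n] ⟨(q, R), h⟩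
  have hs : ∀ n, (s (n+1)).1 = (f (s n), g (s n)) := fun n => by
    simp only [s, Function.iterate_succ_apply']
  have hm : ∀ i j, i ≤ j → (s j).1.2 ⊆ (s i).1.2 := by
    intro i j hij
    induction j, hij using Nat.le_induction with
    | base => exact subset_rfl
    | succ j _ ih => rw [hs]; exact (r5 _).trans ih
  have hd : ∀ i j, i < j → Disjoint (A (s i)) (A (s j)) := fun i j hij => by
    have h1 := (r4 (s j)).trans (hm (i+1) j hij)
    rw [hs] at h1
    exact (r6 (s i)).mono_right h1
  refine hAC (asm (fun k => A (s k)) (fun k => (s k).1.1) (fun k => l (s k)) (fun k => ?_) (fun i j hij => ?_) fun k => r3 _)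
  · grind
  · grind

theorem thmM {D : V → V → Prop} {B0 : Set V} (hAC : ¬ ContainsAltComb D B0) (h : Ln D B0 E X T L) (hD : IsDimaze E T)
    (hL : Loose E X S T) : Col E X S (T ∩ X) := by
  have hb0 : ∀ C, Comp E (pr E T X) C → bd E X C = ∅ := by
    intro C hC
    ext v; simp only [mem_empty_iff_false, iff_false]
    rintro ⟨g1, g2, u, g3, g4⟩
    exact g2 (comp_in hC g1 g3 g4)
  have hN : ∀ C ∈ {C | Comp E (pr E T X) C}, Near E S T C := by
    intro C hC
    by_contra hn
    obtain ⟨q, hq⟩ := hC.ne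
    exact no_sta hAC ⟨E, X, T, L, C, h, hD, hL, ⟨hC.sub.trans pr_sub, hC.conn, hC.prd pr_prd, hn, by
      rw [hb0 C hC]; exact finite_empty⟩, hq, rfl⟩
  have h5 := m5 hD hL (K := ∅) (fun a ha b hb v hv hv' => Comp.dis ha hb hv hv') finite_empty (empty_subset _)
    (fun C hC => (Comp.sub hC).trans pr_sub) (fun C hC => (hb0 C hC).subset) hN
  refine fix0 hD hL subset_rfl ?_ (near_sup h5 ?_ finite_empty ?_)
  · ext v; simp only [mem_empty_iff_false, iff_false]
    exact fun h => h.2.1 h.1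
  · exact sUnion_subset fun C hC => (Comp.sub hC).trans pr_sub
  · exact fun t ht => Or.inl ⟨_, comp_cpt (pr_T ht.1 ht.2), self_cpt (pr_T ht.1 ht.2)⟩
end

section
variable {E E' D : V → V → Prop} {X X' S T T' B0 A B C Z W I K U Y : Set V} {u v w x y q e z : V} {L L' : Set (List V)}

theorem trunc_chain {s : List V} (h : (s ++ [v]).IsChain D) (hh : ∀ a, (s ++ [v]).head? = some a → a ∉ U)
    (hs : ∀ u ∈ s, u ∉ rT D univ B0 U) : (s ++ [v]).IsChain (rE D univ U) := by
  induction s with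
  | nil => simp
  | cons a s ih =>
    have ha : a ∉ U := hh a rfl
    have hb : a ∉ bd D univ U := fun h => hs a (by simp) (Or.inl h)
    have key : ∀ b, D a b → b ∉ U := fun b hab hbU => hb ⟨trivial, ha, b, hbU, hab⟩
    have h2 : ∀ u ∈ s, u ∉ rT D univ B0 U := fun u hu => hs u (by simp [hu])
    cases s with
    | nil => simp at h ⊢; exact ⟨h, ⟨trivial, ha⟩, ⟨trivial, key _ h⟩, hb⟩
    | cons b s =>
      simp only [List.cons_append, List.isChain_cons_cons] at h ih ⊢
      exact ⟨⟨h.1, ⟨trivial, ha⟩, ⟨trivial, key _ h.1⟩, hb⟩, ih h.2 (fun c hc => by simp at hc; exact hc ▸ key _ h.1) h2⟩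

theorem trunc_hit {l : List V} (h : l.IsChain D) (hh : ∀ a, l.head? = some a → a ∉ U) {t : V} (ht : l.getLast? = some t)
    (htB : t ∈ B0) : ∃ u ∈ l, u ∈ rT D univ B0 U := by
  induction l with
  | nil => simp at ht
  | cons a l ih =>
    have ha : a ∉ U := hh a rfl
    cases l with
    | nil => simp at ht; subst ht; exact ⟨a, by simp, Or.inr ⟨htB, trivial, ha⟩⟩
    | cons b l =>
      rw [List.isChain_cons_cons] at h
      by_cases hb : b ∈ U
      · exact ⟨a, by simp, Or.inl ⟨trivial, ha, b, hb, h.1⟩⟩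
      · grind

theorem trunc {Q : Set (List V)} (hQ : Sys D Q) (hL : Lst Q ⊆ B0) (hU : ∀ v ∈ Hd Q, v ∉ U) :
    ∃ Q', Sys (rE D univ U) Q' ∧ Hd Q' = Hd Q ∧ Lst Q' ⊆ rT D univ B0 U := by
  refine ⟨{p | ∃ s v t, p = s ++ [v] ∧ s ++ v :: t ∈ Q ∧ v ∈ rT D univ B0 U ∧ ∀ u ∈ s, u ∉ rT D univ B0 U}, ⟨?_, ?_⟩, ?_, ?_⟩
  · rintro _ ⟨s, v, t, rfl, h1, h2, h3⟩
    have hp : IsP D (s ++ [v]) := by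
      have := hQ.1 _ h1
      rw [show s ++ v :: t = (s ++ [v]) ++ t by simp] at this
      exact this.prefix (by simp)
    exact ⟨hp.1, hp.2.1, trunc_chain hp.2.2 (fun a ha => hU a ⟨_, h1, by rw [← ha]; exact head?_split _ _ _ _⟩) h3⟩
  · rintro _ ⟨s, v, t, rfl, h1, h2, h3⟩ _ ⟨s', v', t', rfl, h1', h2', h3'⟩ u hu hu'
    have h := hQ.2 _ h1 _ h1' u (by simp at hu ⊢; tauto) (by simp at hu' ⊢; tauto)
    rcases List.append_eq_append_iff.1 h with ⟨a, rfl, g⟩ | ⟨a, rfl, g⟩ <;> cases a with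
    | nil => simp at g ⊢; simp [g.1]
    | cons b a => simp at g; first | exact (h3' b (by simp) (g.1 ▸ h2)).elim | exact (h3 b (by simp) (g.1 ▸ h2')).elim
  · ext v; constructor
    · rintro ⟨_, ⟨s, w, t, rfl, h1, h2, h3⟩, hv⟩
      exact ⟨_, h1, by rw [← hv]; exact head?_split _ _ _ _⟩
    · rintro ⟨l, hl, hv⟩
      obtain ⟨t, ht⟩ := exists_last (hQ.1 l hl).1
      obtain ⟨s, w, r, rfl, h5, h6⟩ := first_hit (trunc_hit (B0 := B0) (U := U) (hQ.1 l hl).2.2 (fun a ha => hU a ⟨l, hl, ha⟩) ht (hL ⟨l, hl, ht⟩))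
      exact ⟨_, ⟨s, w, r, rfl, hl, h5, h6⟩, by rw [← hv]; exact head?_split _ _ _ _⟩
  · grind

theorem lift_sys {R : Set (List V)} (hD : IsDimaze E T) (h : Ln D B0 E X T L) (hR : Sys E R) (hL : Lst R ⊆ T) (hX : Vs R ⊆ X) :
    Sys D (comp R L) ∧ Hd (comp R L) = Hd R ∧ Lst (comp R L) ⊆ Lst L := by
  have h' : Ln E T (fun _ _ => False) ∅ (Hd R) R := ⟨fun _ _ h => h.elim, hR, rfl, hL, fun _ _ _ _ _ h => h⟩
  have hc := h.comp hD h' (empty_subset _) hX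
  refine ⟨hc.sys, hc.hd, ?_⟩
  rintro v ⟨l, ⟨s, w, t, h1, h2, rfl⟩ | ⟨h1, h2⟩, hv⟩
  · grind
  · exact (h2 v hv (by rw [h.hd]; exact hL ⟨l, h1, hv⟩)).elim

theorem linkable_sub (hD : IsDimaze D B0) : (∃ B, LinkableOnto D B0 B ∧ I ⊆ B) ↔ Linkable D B0 I := by
  constructor
  · rintro ⟨B, hB, hI⟩
    obtain ⟨P, h1, h2, rfl⟩ := linkableOnto_iff.1 hB
    refine linkable_iff.2 ⟨{l ∈ P | ∃ v ∈ I, l.head? = some v}, h1.sub fun l hl => hl.1, ?_, ?_⟩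
    · grind
    · ext v; constructor
      · rintro ⟨l, ⟨-, w, hw, hlw⟩, hv⟩
        have := hv.symm.trans hlw; cases this; exact hw
      · grind
  · intro h
    obtain ⟨P, h1, h2, rfl⟩ := linkable_iff.1 h
    exact ⟨_, ext_triv hD h1 h2, subset_union_left⟩

theorem im (hD : IsDimaze D B0) (hAC : ¬ ContainsAltComb D B0) (hI : Linkable D B0 I) (hS : I ⊆ S) :
    ∃ J, Linkable D B0 J ∧ I ⊆ J ∧ J ⊆ S ∧ ∀ K, Linkable D B0 K → K ⊆ S → J ⊆ K → K = J := by
  obtain ⟨U, W, hW, hmax⟩ := max_wave D univ S B0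
  obtain ⟨L, hLn, -⟩ := wave_ln hD hW
  have hD' := r_dimaze (X := univ) (U := U) hD
  obtain ⟨P0, p1, p2, p3, p4⟩ := thmM hAC hLn hD' (res_loose hW hmax)
  have hTX : rT D univ B0 U ⊆ univ \ U := by
    rintro v (hv | hv)
    exacts [⟨trivial, hv.2.1⟩, hv.2]
  rw [inter_eq_left.2 hTX] at p4
  have hV : ∀ R, Sys (rE D univ U) R → Hd R ⊆ S → Vs R ⊆ univ \ U := by
    rintro R hR hRS v ⟨l, hl, hv⟩
    rcases mem_cases hv with h | ⟨s, u, t, rfl⟩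
    · exact ⟨trivial, fun h' => hW.dis v h' (hRS ⟨l, hl, h⟩)⟩
    · have := (hR.1 _ hl).2.2.right_of_append
      rw [List.isChain_cons_cons] at this
      exact this.1.2.2.1
  have htr : ∀ K, Linkable D B0 K → K ⊆ S → ∃ Q, Sys (rE D univ U) Q ∧ Hd Q = K ∧ Lst Q ⊆ rT D univ B0 U := by
    intro K hK hKS
    obtain ⟨Q, q1, q2, rfl⟩ := linkable_iff.1 hK
    exact trunc q1 q2 fun v hv h => hW.dis v h (hKS hv)
  obtain ⟨Q, q1, q2, q3⟩ := htr I hI hS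
  obtain ⟨R, r1, r2, r3, r4, r5⟩ := pym q1 p1
  rw [p4] at r4 r5
  have hRL : Lst R ⊆ rT D univ B0 U := r5.trans (union_subset q3 subset_rfl)
  have hRS : Hd R ⊆ S := r3.trans (union_subset (q2 ▸ hS) p3)
  obtain ⟨c1, c2, c3⟩ := lift_sys hD' hLn r1 hRL (hV R r1 hRS)
  refine ⟨Hd R, linkable_iff.2 ⟨_, c1, c3.trans hLn.lst, c2⟩, q2 ▸ r2, hRS, fun K hK hKS hJK => ?_⟩
  obtain ⟨Q', k1, k2, k3⟩ := htr K hK hKS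
  obtain ⟨e1, e2, e3⟩ := lift_sys hD' hLn k1 k3 (hV Q' k1 (k2 ▸ hKS))
  refine subset_antisymm (fun a ha => by_contra fun ha' => hAC ?_) hJK
  refine lemmaC e1 c1 (c3.trans hLn.lst) (by rw [c2, e2, k2]; exact hJK) (e3.trans ?_) (a0 := a) (by rw [e2, k2]; exact ha) (by rw [c2]; exact ha')
  rw [comp_Lst (by rw [hLn.hd]; exact r4) (fun b hb => (hLn.sys.1 b hb).1)]
  exact subset_union_left
end

/-- The sets linkable onto the exits form the bases of a matroid iff the dimaze
contains no alternating comb; in that case the independent sets of this matroid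
are exactly the linkable sets. -/
theorem linkableOnto_bases_iff_noAC (D : V → V → Prop) (B0 : Set V)
    (hD : IsDimaze D B0) :
    (IsMatroidBases {B : Set V | LinkableOnto D B0 B} ↔ ¬ ContainsAltComb D B0) ∧
    (¬ ContainsAltComb D B0 →
      ∀ I : Set V, (∃ B, LinkableOnto D B0 B ∧ I ⊆ B) ↔ Linkable D B0 I) := by
  refine ⟨⟨?_, fun hAC => ⟨?_, ?_, ?_⟩⟩, fun _ I => linkable_sub hD⟩
  · rintro ⟨-, h, -⟩ hAC
    obtain ⟨A, B, hA, hB, hBA, x, hx⟩ := ac_not_b2 hD hAC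
    obtain ⟨y, hy, -⟩ := h A hA B hB x hx
    exact hy.2 (hBA hy.1)
  · exact ⟨_, ext_triv hD (Q := ∅) ⟨by simp, by simp⟩ (by rintro v ⟨l, hl, -⟩; exact hl.elim)⟩
  · exact fun B1 h1 B2 h2 x hx => b2 hAC h1 h2 hx
  · have : (fun I : Set V => ∃ B ∈ {B : Set V | LinkableOnto D B0 B}, I ⊆ B) = Linkable D B0 := by
      ext I; exact linkable_sub hD
    rw [this]
    exact fun I X hI hX => im hD hAC hI hX
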